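/- arXiv:2404.15123 — 4 statements merged into one kernel-verified Lean document; each statement's English description precedes it below -/
import Mathlib

section
/- Let ε ∈ (0,2/5]. There exists a constant K_ε > 0 such that the following holds. Let ψ, θ: ℕ → ℝ≥0 be finitely supported with supports V and W respectively, and let f, g: ℕ → ℝ≥0 be multiplicative functions satisfying (1⋆f)(n) ≤ n and (1⋆g)(n) ≤ n for all n ≥ 1, where ⋆ denotes Dirichlet convolution. Let t ≥ 1 and C ∈ ℝ, and suppose ℰ ⊆ ℰ_{ψ,θ}^{t,C} := {(v,w) ∈ V × W : D_{ψ,θ}(v,w) ≤ 1 and ∑_{p prime, p | vw/gcd(v,w)², p ≥ t} 1/p ≥ C}, where D_{ψ,θ}(v,w) := max(w·ψ(v), v·θ(w))/gcd(v,w). Then ∑_{(v,w)∈ℰ} (f(v)ψ(v)/v)·(g(w)θ(w)/w) ≤ K_ε · ( (∑_{v∈V} f(v)ψ(v)/v) · (∑_{w∈W} g(w)θ(w)/w) · e^{−Ct} )^{1/2+ε}. -/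
/-- `μ_ψ^f(v) = f(v) ψ(v) / v`. -/
noncomputable def mu (ψ f : ℕ → ℝ) (v : ℕ) : ℝ := f v * ψ v / v

/-- `∑_{p prime, p | k, p ≥ t} 1/p`. -/
noncomputable def primeSum (t : ℝ) (k : ℕ) : ℝ :=
  ∑ p ∈ k.primeFactors, Set.indicator {q : ℕ | t ≤ (q : ℝ)} (fun q => 1 / (q : ℝ)) p

/-- `D_{ψ,θ}(v,w) = max(w ψ(v), v θ(w)) / gcd(v,w)`. -/
noncomputable def Dpair (ψ θ : ℕ → ℝ) (v w : ℕ) : ℝ :=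
  max ((w : ℝ) * ψ v) ((v : ℝ) * θ w) / (Nat.gcd v w : ℝ)

/-- `ℰ_{ψ,θ}^{t,C} = {(v,w) ∈ supp ψ × supp θ : D_{ψ,θ}(v,w) ≤ 1 and
∑_{p | vw/gcd(v,w)², p ≥ t} 1/p ≥ C}`. -/
noncomputable def Eset (ψ θ : ℕ → ℝ) (t C : ℝ) : Set (ℕ × ℕ) :=
  {vw | ψ vw.1 ≠ 0 ∧ θ vw.2 ≠ 0 ∧ Dpair ψ θ vw.1 vw.2 ≤ 1 ∧
    C ≤ primeSum t (vw.1 * vw.2 / Nat.gcd vw.1 vw.2 ^ 2)}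

section Helpers
open Finset



noncomputable def mm (F : ℕ → ℕ → ℝ) (e : ℕ → ℕ → ℕ) (Q : Finset ℕ) (x : ℕ → ℝ) (v : ℕ) : ℝ :=
  x v * ∏ p ∈ Q, F p (e v p)

def GoodF (F : ℕ → ℕ → ℝ) : Prop :=
  (∀ p i, 0 ≤ F p i) ∧ ∀ p k, p.Prime → ∑ i ∈ range (k + 1), F p i * (p : ℝ) ^ i ≤ (p : ℝ) ^ k

structure Dat (e : ℕ → ℕ → ℕ) (t : ℝ) (Q : Finset ℕ) (x y : ℕ → ℝ) (V W : Finset ℕ)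
    (E : Finset (ℕ × ℕ)) (C : ℝ) : Prop where
  x0 : ∀ v, 0 ≤ x v
  y0 : ∀ v, 0 ≤ y v
  sub : E ⊆ V ×ˢ W
  injV : ∀ v ∈ V, ∀ v' ∈ V, (∀ p ∈ Q, e v p = e v' p) → v = v'
  injW : ∀ v ∈ W, ∀ v' ∈ W, (∀ p ∈ Q, e v p = e v' p) → v = v'
  cx : ∀ z ∈ E, x z.1 * ∏ p ∈ Q, (p : ℝ) ^ (e z.2 p - e z.1 p) ≤ 1
  cy : ∀ z ∈ E, y z.2 * ∏ p ∈ Q, (p : ℝ) ^ (e z.1 p - e z.2 p) ≤ 1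
  cC : ∀ z ∈ E, C ≤ ∑ p ∈ Q, if e z.1 p ≠ e z.2 p ∧ t ≤ (p : ℝ) then 1 / (p : ℝ) else 0

def Bd (F G : ℕ → ℕ → ℝ) (e : ℕ → ℕ → ℕ) (t q K : ℝ) (Q : Finset ℕ) : Prop :=
  ∀ (x y : ℕ → ℝ) (V W : Finset ℕ) (E : Finset (ℕ × ℕ)) (C : ℝ), Dat e t Q x y V W E C →
    ∑ z ∈ E, mm F e Q x z.1 * mm G e Q y z.2 ≤
      K * ((∑ v ∈ V, mm F e Q x v) * (∑ w ∈ W, mm G e Q y w) * Real.exp (-(C * t))) ^ q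

noncomputable def cc (s : ℝ) (i j : ℕ) : ℝ := if i = j then 1 else 3 * s ^ ((i - j) + (j - i))

lemma GoodF.le_one {F : ℕ → ℕ → ℝ} (hF : GoodF F) {p : ℕ} (hp : p.Prime) (k : ℕ) : F p k ≤ 1 := by
  have h := hF.2 p k hp
  have hp0 : (0:ℝ) < (p:ℝ) ^ k := by have := hp.pos; positivity
  have h2 : F p k * (p:ℝ) ^ k ≤ ∑ i ∈ range (k + 1), F p i * (p : ℝ) ^ i :=
    Finset.single_le_sum (f := fun i => F p i * (p : ℝ) ^ i)
      (fun i _ => mul_nonneg (hF.1 p i) (by positivity)) (by simp)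
  have : F p k * (p:ℝ) ^ k ≤ 1 * (p:ℝ) ^ k := by linarith
  exact le_of_mul_le_mul_right this hp0

lemma mm_nonneg {F : ℕ → ℕ → ℝ} (hF : GoodF F) {x : ℕ → ℝ} (hx : ∀ v, 0 ≤ x v) (e Q v) :
    0 ≤ mm F e Q x v := mul_nonneg (hx v) (prod_nonneg fun p _ => hF.1 p _)

lemma cell_arith (q A a b X r B : ℝ) (hq0 : 0 < q) (hq : q < 1) (hA : 0 ≤ A) (ha : 0 ≤ a)
    (hX : 0 ≤ X) (hr : 0 ≤ r) (hb : 0 ≤ b) (hAB : A ≤ B) :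
    A * (a * b * (X * r)) ^ q ≤ B ^ (1 - q) * r ^ q * (A * (a * b) * X) ^ q := by
  have h1 : A = A ^ (1 - q) * A ^ q := by
    rcases hA.eq_or_lt with h | h
    · rw [← h, Real.zero_rpow hq0.ne']; simp
    · rw [← Real.rpow_add h]; simp
  have e1 : (a * b * (X * r)) ^ q = (a * b * X) ^ q * r ^ q := by
    rw [← Real.mul_rpow (by positivity) hr]; ring_nf
  have e2 : (A * (a * b) * X) ^ q = A ^ q * (a * b * X) ^ q := by
    rw [← Real.mul_rpow hA (by positivity)]; ring_nf
  rw [e1, e2]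
  have h3 : A ^ (1 - q) ≤ B ^ (1 - q) := Real.rpow_le_rpow hA hAB (by linarith)
  calc A * ((a * b * X) ^ q * r ^ q) = (A ^ (1 - q)) * (r ^ q * (A ^ q * (a * b * X) ^ q)) := by
        conv_lhs => rw [h1]
        ring
    _ ≤ B ^ (1 - q) * (r ^ q * (A ^ q * (a * b * X) ^ q)) := by
        apply mul_le_mul_of_nonneg_right h3; positivity
    _ = _ := by ring

lemma cell {F G : ℕ → ℕ → ℝ} {e : ℕ → ℕ → ℕ} {t q K : ℝ} {Q : Finset ℕ} (hF : GoodF F)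
    (hG : GoodF G) (ht : 1 ≤ t) (hq0 : 0 < q) (hq : q < 1) (hK : 0 ≤ K) {p : ℕ} (hp : p.Prime)
    (hpQ : p ∉ Q) (hB : Bd F G e t q K Q) {x y V W E C} (hD : Dat e t (insert p Q) x y V W E C)
    (i j : ℕ) :
    ∑ z ∈ E with e z.1 p = i ∧ e z.2 p = j, mm F e (insert p Q) x z.1 * mm G e (insert p Q) y z.2 ≤
      K * (cc ((p:ℝ) ^ (-(1 - q))) i j * ((∑ v ∈ V with e v p = i, mm F e (insert p Q) x v) *
        (∑ w ∈ W with e w p = j, mm G e (insert p Q) y w) * Real.exp (-(C * t))) ^ q) := by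
  have hpp : (0:ℝ) < p := by exact_mod_cast hp.pos
  set d : ℝ := if i ≠ j ∧ t ≤ (p:ℝ) then 1 / (p:ℝ) else 0 with hd
  have hD' : Dat e t Q (fun v => (p:ℝ) ^ (j - i) * x v) (fun v => (p:ℝ) ^ (i - j) * y v)
      (V.filter (fun v => e v p = i)) (W.filter (fun w => e w p = j))
      (E.filter (fun z => e z.1 p = i ∧ e z.2 p = j)) (C - d) := by
    refine ⟨fun v => mul_nonneg (by positivity) (hD.x0 v),
      fun v => mul_nonneg (by positivity) (hD.y0 v), ?_, ?_, ?_, ?_, ?_, ?_⟩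
    · intro z hz
      rw [mem_filter] at hz
      have := hD.sub hz.1
      simp only [mem_product, mem_filter] at this ⊢
      tauto
    · intro v hv v' hv' h
      rw [mem_filter] at hv hv'
      refine hD.injV v hv.1 v' hv'.1 ?_
      intro r hr
      rcases mem_insert.1 hr with rfl | hr
      · rw [hv.2, hv'.2]
      · exact h r hr
    · intro v hv v' hv' h
      rw [mem_filter] at hv hv'
      refine hD.injW v hv.1 v' hv'.1 ?_
      intro r hr
      rcases mem_insert.1 hr with rfl | hr
      · rw [hv.2, hv'.2]
      · exact h r hr
    · intro z hz
      rw [mem_filter] at hz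
      have := hD.cx z hz.1
      rw [prod_insert hpQ, hz.2.1, hz.2.2] at this
      calc _ = _ := by ring
        _ ≤ _ := this
    · intro z hz
      rw [mem_filter] at hz
      have := hD.cy z hz.1
      rw [prod_insert hpQ, hz.2.1, hz.2.2] at this
      calc _ = _ := by ring
        _ ≤ _ := this
    · intro z hz
      rw [mem_filter] at hz
      have := hD.cC z hz.1
      rw [sum_insert hpQ, hz.2.1, hz.2.2] at this
      linarith
  have key := hB _ _ _ _ _ _ hD'
  set A : ℝ := F p i * G p j * ((p:ℝ) ^ ((i - j) + (j - i)))⁻¹ with hA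
  have hA0 : 0 ≤ A := mul_nonneg (mul_nonneg (hF.1 _ _) (hG.1 _ _)) (by positivity)
  have hmF : ∀ v, e v p = i → mm F e (insert p Q) x v =
      F p i * ((p:ℝ) ^ (j - i))⁻¹ * mm F e Q (fun v => (p:ℝ) ^ (j - i) * x v) v := by
    intro v hv
    simp only [mm]
    rw [prod_insert hpQ, hv]
    field_simp
  have hmG : ∀ v, e v p = j → mm G e (insert p Q) y v =
      G p j * ((p:ℝ) ^ (i - j))⁻¹ * mm G e Q (fun v => (p:ℝ) ^ (i - j) * y v) v := by
    intro v hv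
    simp only [mm]
    rw [prod_insert hpQ, hv]
    field_simp
  have hL : ∑ z ∈ E with e z.1 p = i ∧ e z.2 p = j,
      mm F e (insert p Q) x z.1 * mm G e (insert p Q) y z.2 =
      A * ∑ z ∈ E with e z.1 p = i ∧ e z.2 p = j,
        mm F e Q (fun v => (p:ℝ) ^ (j - i) * x v) z.1 *
        mm G e Q (fun v => (p:ℝ) ^ (i - j) * y v) z.2 := by
    rw [mul_sum]
    apply sum_congr rfl
    intro z hz
    rw [mem_filter] at hz
    rw [hmF _ hz.2.1, hmG _ hz.2.2, hA, pow_add]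
    field_simp
  have hLV : ∑ v ∈ V with e v p = i, mm F e (insert p Q) x v =
      F p i * ((p:ℝ) ^ (j - i))⁻¹ * ∑ v ∈ V with e v p = i,
        mm F e Q (fun v => (p:ℝ) ^ (j - i) * x v) v := by
    rw [mul_sum]
    exact sum_congr rfl fun v hv => hmF v (mem_filter.1 hv).2
  have hLW : ∑ v ∈ W with e v p = j, mm G e (insert p Q) y v =
      G p j * ((p:ℝ) ^ (i - j))⁻¹ * ∑ v ∈ W with e v p = j,
        mm G e Q (fun v => (p:ℝ) ^ (i - j) * y v) v := by
    rw [mul_sum]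
    exact sum_congr rfl fun v hv => hmG v (mem_filter.1 hv).2
  rw [hL, hLV, hLW]
  set a := ∑ v ∈ V with e v p = i, mm F e Q (fun v => (p:ℝ) ^ (j - i) * x v) v
  set b := ∑ v ∈ W with e v p = j, mm G e Q (fun v => (p:ℝ) ^ (i - j) * y v) v
  have ha : 0 ≤ a := sum_nonneg fun v _ => mm_nonneg hF hD'.x0 _ _ _
  have hb : 0 ≤ b := sum_nonneg fun v _ => mm_nonneg hG hD'.y0 _ _ _
  have hexp : Real.exp (-((C - d) * t)) = Real.exp (-(C * t)) * Real.exp (d * t) := by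
    rw [← Real.exp_add]; ring_nf
  rw [hexp] at key
  have hAB : A ≤ ((p:ℝ) ^ ((i - j) + (j - i)))⁻¹ := by
    rw [hA]
    have h1 := hF.le_one hp i
    have h2 := hG.le_one hp j
    have h3 : F p i * G p j ≤ 1 := mul_le_one₀ h1 (hG.1 _ _) h2
    have h4 : 0 ≤ ((p:ℝ) ^ ((i - j) + (j - i)))⁻¹ := by positivity
    nlinarith
  have har := cell_arith q A a b (Real.exp (-(C * t))) (Real.exp (d * t)) _ hq0 hq hA0 ha
    (Real.exp_pos _).le (Real.exp_pos _).le hb hAB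
  have hcc : (((p:ℝ) ^ ((i - j) + (j - i)))⁻¹) ^ (1 - q) * (Real.exp (d * t)) ^ q ≤
      cc ((p:ℝ) ^ (-(1 - q))) i j := by
    unfold cc
    split_ifs with hij
    · subst hij
      simp [hd]
    · have hdt : d * t ≤ 1 := by
        rw [hd]
        split_ifs with h
        · rw [div_mul_eq_mul_div, one_mul, div_le_one hpp]; exact h.2
        · simp
      have h1 : (Real.exp (d * t)) ^ q ≤ 3 := by
        rw [← Real.exp_mul]
        have : d * t * q ≤ 1 := by
          have : 0 ≤ d := by rw [hd]; split_ifs <;> positivity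
          have : 0 ≤ d * t := by positivity
          nlinarith
        calc Real.exp (d * t * q) ≤ Real.exp 1 := Real.exp_le_exp.2 this
          _ ≤ 3 := by linarith [Real.exp_one_lt_d9]
      have h2 : (((p:ℝ) ^ ((i - j) + (j - i)))⁻¹) ^ (1 - q) =
          ((p:ℝ) ^ (-(1 - q))) ^ ((i - j) + (j - i)) := by
        rw [← Real.rpow_natCast, ← Real.rpow_natCast, ← Real.rpow_neg hpp.le,
          ← Real.rpow_mul hpp.le, ← Real.rpow_mul hpp.le]
        ring_nf
      rw [h2, mul_comm]
      apply mul_le_mul_of_nonneg_right h1; positivity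
  have hAab : F p i * ((p:ℝ) ^ (j - i))⁻¹ * a * (G p j * ((p:ℝ) ^ (i - j))⁻¹ * b) = A * (a * b) := by
    rw [hA, pow_add]; field_simp
  rw [hAab]
  calc A * _ ≤ A * (K * (a * b * (Real.exp (-(C * t)) * Real.exp (d * t))) ^ q) :=
        mul_le_mul_of_nonneg_left key hA0
    _ = K * (A * (a * b * (Real.exp (-(C * t)) * Real.exp (d * t))) ^ q) := by ring
    _ ≤ K * (_ * (A * (a * b) * Real.exp (-(C * t))) ^ q) := by
        apply mul_le_mul_of_nonneg_left _ hK
        refine har.trans (mul_le_mul_of_nonneg_right hcc ?_)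
        positivity


lemma geom_inj {s : ℝ} (hs : 0 ≤ s) (hs1 : s < 1) (J : Finset ℕ) (φ : ℕ → ℕ)
    (hφ : Set.InjOn φ J) (h1 : ∀ j ∈ J, 1 ≤ φ j) : ∑ j ∈ J, s ^ φ j ≤ s / (1 - s) := by
  have e1 : ∑ j ∈ J, s ^ φ j = s * ∑ d ∈ J.image (fun j => φ j - 1), s ^ d := by
    rw [sum_image, mul_sum]
    · apply sum_congr rfl
      intro j hj
      rw [← pow_succ', Nat.sub_add_cancel (h1 j hj)]
    · intro a ha b hb hab
      apply hφ ha hb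
      have := h1 a ha
      have := h1 b hb
      simp only at hab
      omega
  rw [e1, div_eq_mul_inv]
  apply mul_le_mul_of_nonneg_left _ hs
  rw [← tsum_geometric_of_lt_one hs hs1]
  exact (summable_geometric_of_lt_one hs hs1).sum_le_tsum _ (fun i _ => by positivity)

lemma cc_nonneg {s : ℝ} (hs : 0 ≤ s) (i j : ℕ) : 0 ≤ cc s i j := by
  unfold cc; split_ifs <;> positivity

lemma cc_symm (s : ℝ) (i j : ℕ) : cc s i j = cc s j i := by
  unfold cc
  rw [add_comm (i - j)]
  by_cases h : i = j
  · simp [h]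
  · simp [h, Ne.symm h]

lemma rowcc {s : ℝ} (hs : 0 ≤ s) (hs1 : s < 1) (J : Finset ℕ) (i : ℕ) :
    ∑ j ∈ J with j ≠ i, cc s i j ≤ 6 * (s / (1 - s)) := by
  have e1 : ∑ j ∈ J with j ≠ i, cc s i j =
      ∑ j ∈ J with j < i, 3 * s ^ (i - j) + ∑ j ∈ J with i < j, 3 * s ^ (j - i) := by
    rw [sum_filter, sum_filter, sum_filter, ← sum_add_distrib]
    apply sum_congr rfl
    intro j _
    rcases lt_trichotomy j i with h | h | h
    · have h2 : j - i = 0 := by omega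
      simp [cc, h, h.ne, h.ne', not_lt_of_gt h, h2]
    · simp [h]
    · have h2 : i - j = 0 := by omega
      simp [cc, h, h.ne, h.ne', not_lt_of_gt h, h2]
  rw [e1, ← mul_sum, ← mul_sum]
  have h1 : ∑ j ∈ J with j < i, s ^ (i - j) ≤ s / (1 - s) := by
    apply geom_inj hs hs1
    · intro a ha b hb hab
      simp at ha hb hab; omega
    · intro a ha
      simp at ha; omega
  have h2 : ∑ j ∈ J with i < j, s ^ (j - i) ≤ s / (1 - s) := by
    apply geom_inj hs hs1
    · intro a ha b hb hab
      simp at ha hb hab; omega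
    · intro a ha
      simp at ha; omega
  linarith

lemma amgm {u w q : ℝ} (hu : 0 ≤ u) (hw : 0 ≤ w) :
    (u * w) ^ q ≤ (u ^ (2 * q) + w ^ (2 * q)) / 2 := by
  rw [Real.mul_rpow hu hw, mul_comm 2 q, Real.rpow_mul hu, Real.rpow_mul hw]
  have := sq_nonneg (u ^ q - w ^ q)
  norm_num
  nlinarith

lemma offdiag {s q : ℝ} (hs : 0 ≤ s) (hs1 : s < 1) (I : Finset ℕ) (u w : ℕ → ℝ)
    (hu : ∀ i, 0 ≤ u i) (hw : ∀ i, 0 ≤ w i) :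
    ∑ i ∈ I, ∑ j ∈ I with j ≠ i, cc s i j * (u i * w j) ^ q ≤
      6 * (s / (1 - s)) * ((∑ i ∈ I, u i ^ (2 * q) + ∑ i ∈ I, w i ^ (2 * q)) / 2) := by
  set τ := 6 * (s / (1 - s))
  have h1 : ∑ i ∈ I, ∑ j ∈ I with j ≠ i, cc s i j * (u i * w j) ^ q ≤
      ∑ i ∈ I, ∑ j ∈ I with j ≠ i, (cc s i j * (u i ^ (2 * q) / 2) + cc s i j * (w j ^ (2 * q) / 2)) := by
    apply sum_le_sum; intro i _
    apply sum_le_sum; intro j _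
    rw [← mul_add, ← add_div]
    exact mul_le_mul_of_nonneg_left (amgm (hu i) (hw j)) (cc_nonneg hs _ _)
  refine h1.trans ?_
  simp_rw [sum_add_distrib]
  have h2 : ∑ i ∈ I, ∑ j ∈ I with j ≠ i, cc s i j * (u i ^ (2 * q) / 2) ≤
      ∑ i ∈ I, τ * (u i ^ (2 * q) / 2) := by
    apply sum_le_sum; intro i _
    rw [← sum_mul]
    apply mul_le_mul_of_nonneg_right (rowcc hs hs1 I i)
    have := hu i
    positivity
  have h3 : ∑ i ∈ I, ∑ j ∈ I with j ≠ i, cc s i j * (w j ^ (2 * q) / 2) ≤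
      ∑ i ∈ I, τ * (w i ^ (2 * q) / 2) := by
    simp_rw [sum_filter]
    rw [sum_comm]
    apply sum_le_sum; intro i _
    rw [← sum_filter, ← sum_mul]
    apply mul_le_mul_of_nonneg_right
    · have := rowcc hs hs1 I i
      simp_rw [cc_symm s _ i, ne_comm (a := i)]
      exact this
    have := hw i
    positivity
  rw [← mul_sum, ← sum_div] at h2 h3
  linarith

lemma alldiag {s q : ℝ} (hs : 0 ≤ s) (hs1 : s < 1) (I : Finset ℕ) (u w : ℕ → ℝ)
    (hu : ∀ i, 0 ≤ u i) (hw : ∀ i, 0 ≤ w i) :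
    ∑ i ∈ I, ∑ j ∈ I, cc s i j * (u i * w j) ^ q ≤ ∑ i ∈ I, (u i * w i) ^ q + 
      6 * (s / (1 - s)) * ((∑ i ∈ I, u i ^ (2 * q) + ∑ i ∈ I, w i ^ (2 * q)) / 2) := by
  refine le_trans (le_of_eq ?_) (add_le_add_right (offdiag hs hs1 I u w hu hw) _)
  rw [← sum_add_distrib]
  apply sum_congr rfl
  intro i hi
  rw [← add_sum_erase _ _ hi]
  congr 1
  · simp [cc]
  · rw [← filter_ne']

lemma sum_sq_le {q : ℝ} (hq : 1 / 2 < q) (I : Finset ℕ) (u : ℕ → ℝ) (hu : ∀ i, 0 ≤ u i) (M : ℝ)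
    (hM : ∀ i ∈ I, u i ≤ M) : ∑ i ∈ I, u i ^ (2 * q) ≤ M ^ (2 * q - 1) * ∑ i ∈ I, u i := by
  rw [mul_sum]
  apply sum_le_sum
  intro i hi
  rcases (hu i).eq_or_lt with h | h
  · rw [← h, Real.zero_rpow (by linarith)]; simp
  · have : u i ^ (2 * q) = u i ^ (2 * q - 1) * u i := by
      nth_rw 3 [← Real.rpow_one (u i)]
      rw [← Real.rpow_add h]; ring_nf
    rw [this]
    exact mul_le_mul_of_nonneg_right (Real.rpow_le_rpow h.le (hM i hi) (by linarith)) h.le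

lemma sum_sq_le' {q : ℝ} (hq : 1 / 2 < q) (I : Finset ℕ) (u : ℕ → ℝ) (hu : ∀ i, 0 ≤ u i) (m : ℝ)
    (hm : ∑ i ∈ I, u i ≤ m) : ∑ i ∈ I, u i ^ (2 * q) ≤ m ^ (2 * q) := by
  have h0 : 0 ≤ ∑ i ∈ I, u i := sum_nonneg fun i _ => hu i
  have h1 := sum_sq_le hq I u hu m (fun i hi =>
    (single_le_sum (f := u) (fun i _ => hu i) hi).trans hm)
  have hm0 := h0.trans hm
  rcases hm0.eq_or_lt with h | h
  · have : ∑ i ∈ I, u i = 0 := by linarith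
    rw [this] at h1
    rw [← h, Real.zero_rpow (by linarith)]; simpa using h1
  · have : m ^ (2 * q) = m ^ (2 * q - 1) * m := by
      nth_rw 3 [← Real.rpow_one m]
      rw [← Real.rpow_add h]; ring_nf
    rw [this]
    exact h1.trans (mul_le_mul_of_nonneg_left hm (by positivity))


lemma split4 (I : Finset ℕ) (g : ℕ → ℕ → ℝ) (k : ℕ) (hk : k ∈ I) :
    ∑ i ∈ I, ∑ j ∈ I, g i j = g k k + ∑ j ∈ I.erase k, g k j + ∑ i ∈ I.erase k, g i k +
      ∑ i ∈ I.erase k, ∑ j ∈ I.erase k, g i j := by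
  rw [← add_sum_erase _ _ hk, ← add_sum_erase I (fun j => g k j) hk]
  have : ∑ i ∈ I.erase k, ∑ j ∈ I, g i j =
      ∑ i ∈ I.erase k, (g i k + ∑ j ∈ I.erase k, g i j) := by
    apply sum_congr rfl; intro i _; rw [← add_sum_erase _ _ hk]
  rw [this, sum_add_distrib]; ring

set_option maxHeartbeats 1000000 in
lemma localB (q : ℝ) (hq : 1 / 2 < q) (hq1 : q < 1) : ∃ s0 > (0:ℝ), ∃ D > (0:ℝ),
    ∀ s, 0 < s → s ≤ s0 → ∀ (I : Finset ℕ) (α β : ℕ → ℝ), (∀ i, 0 ≤ α i) → (∀ i, 0 ≤ β i) →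
    ∑ i ∈ I, α i = 1 → ∑ i ∈ I, β i = 1 →
    1 < ∑ i ∈ I, ∑ j ∈ I, cc s i j * (α i * β j) ^ q →
    ∃ k, ∑ i ∈ I.erase k, ∑ j ∈ I.erase k, cc s i j * (α i * β j) ^ q ≤
      D * (s ^ (1 / (1 - q))) ^ (2 * q) := by
  have hκ : 0 < 2 * q - 1 := by linarith
  obtain ⟨η, hη0, hη1, hη2⟩ : ∃ η : ℝ, 0 < η ∧ η ≤ 1 / 100 ∧ η ^ (2 * q - 1) ≤ 1 / 8 := by
    refine ⟨min (1 / 100) ((1 / 8) ^ (1 / (2 * q - 1))), by positivity, min_le_left _ _, ?_⟩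
    calc _ ≤ (((1:ℝ) / 8) ^ (1 / (2 * q - 1))) ^ (2 * q - 1) :=
          Real.rpow_le_rpow (by positivity) (min_le_right _ _) hκ.le
      _ = 1 / 8 := by
          rw [← Real.rpow_mul (by norm_num), one_div_mul_cancel hκ.ne', Real.rpow_one]
  have hγ : (1 - η) ^ (2 * q - 1) < 1 := Real.rpow_lt_one (by linarith) (by linarith) hκ
  set γ := 1 - (1 - η) ^ (2 * q - 1) with hγd
  have hγ0 : 0 < γ := by linarith
  refine ⟨min (1 / 48) (γ / 24), by positivity, 2 * ((96:ℝ) ^ (1 / (1 - q))) ^ (2 * q), by positivity, ?_⟩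
  intro s hs hs0 I α β hα hβ sα sβ htot
  have hs48 : s ≤ 1 / 48 := hs0.trans (min_le_left _ _)
  have hsγ : s ≤ γ / 24 := hs0.trans (min_le_right _ _)
  set τ := 6 * (s / (1 - s)) with hτ
  have hs1 : s < 1 := by linarith
  have hτ12 : τ ≤ 12 * s := by
    have : s / (1 - s) ≤ 2 * s := by
      rw [div_le_iff₀ (by linarith)]; nlinarith
    linarith
  have hτ0 : 0 ≤ τ := by have : 0 < 1 - s := by linarith
                         positivity
  have hα1 : ∑ i ∈ I, α i ^ (2 * q) ≤ 1 := by
    simpa using sum_sq_le' hq I α hα 1 sα.le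
  have hβ1 : ∑ i ∈ I, β i ^ (2 * q) ≤ 1 := by
    simpa using sum_sq_le' hq I β hβ 1 sβ.le
  have hdiag : 1 - τ < ∑ i ∈ I, (α i * β i) ^ q := by
    have := alldiag (q := q) hs.le hs1 I α β hα hβ
    rw [← hτ] at this
    nlinarith
  have hI : I.Nonempty := by
    by_contra h
    rw [not_nonempty_iff_eq_empty] at h
    rw [h] at sα; simp at sα
  obtain ⟨k, hk, hkm⟩ := exists_max_image I α hI
  obtain ⟨l, hl, hlm⟩ := exists_max_image I β hI
  have hd2 : ∑ i ∈ I, (α i * β i) ^ q ≤ (∑ i ∈ I, α i ^ (2 * q) + ∑ i ∈ I, β i ^ (2 * q)) / 2 := by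
    rw [← sum_add_distrib, sum_div]
    exact sum_le_sum fun i _ => amgm (hα i) (hβ i)
  have hαk : 1 - η ≤ α k := by
    by_contra! h
    have h1 := sum_sq_le hq I α hα (α k) hkm
    have h2 : α k ^ (2 * q - 1) ≤ (1 - η) ^ (2 * q - 1) := Real.rpow_le_rpow (hα k) h.le hκ.le
    rw [sα] at h1
    linarith
  have hβl : 1 - η ≤ β l := by
    by_contra! h
    have h1 := sum_sq_le hq I β hβ (β l) hlm
    have h2 : β l ^ (2 * q - 1) ≤ (1 - η) ^ (2 * q - 1) := Real.rpow_le_rpow (hβ l) h.le hκ.le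
    rw [sβ] at h1
    linarith
  have hαe : α k + ∑ i ∈ I.erase k, α i = 1 := by rw [add_sum_erase _ _ hk, sα]
  have hβe : β l + ∑ i ∈ I.erase l, β i = 1 := by rw [add_sum_erase _ _ hl, sβ]
  have hkl : l = k := by
    by_contra hne
    have hβk : β k ≤ η := by
      have := single_le_sum (f := β) (fun i _ => hβ i) (mem_erase.2 ⟨Ne.symm hne, hk⟩)
      linarith
    have hαk1 : α k ≤ 1 := by
      have : 0 ≤ ∑ i ∈ I.erase k, α i := sum_nonneg fun i _ => hα i
      linarith
    rw [← add_sum_erase _ _ hk] at hdiag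
    have h1 : (α k * β k) ^ q ≤ 1 / 10 := by
      have : α k * β k ≤ 1 / 100 := by nlinarith [hβ k, hα k]
      calc (α k * β k) ^ q ≤ (1 / 100) ^ q := Real.rpow_le_rpow (mul_nonneg (hα k) (hβ k)) this (by linarith)
        _ ≤ (1 / 100) ^ ((1:ℝ) / 2) := Real.rpow_le_rpow_of_exponent_ge (by norm_num) (by norm_num) hq.le
        _ = 1 / 10 := by
          rw [show (1:ℝ) / 100 = (1 / 10) ^ (2:ℝ) by norm_num, ← Real.rpow_mul (by norm_num)]; norm_num
    have h2 : ∑ i ∈ I.erase k, (α i * β i) ^ q ≤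
        (∑ i ∈ I.erase k, α i ^ (2 * q) + ∑ i ∈ I.erase k, β i ^ (2 * q)) / 2 := by
      rw [← sum_add_distrib, sum_div]
      exact sum_le_sum fun i _ => amgm (hα i) (hβ i)
    have h3 : ∑ i ∈ I.erase k, α i ^ (2 * q) ≤ 1 / 100 := by
      have h4 := sum_sq_le hq (I.erase k) α hα 1 (fun i hi => by
        have := single_le_sum (f := α) (fun i _ => hα i) hi
        linarith)
      rw [Real.one_rpow] at h4
      linarith
    have h4 : ∑ i ∈ I.erase k, β i ^ (2 * q) ≤ 1 :=
      le_trans (sum_le_sum_of_subset_of_nonneg (erase_subset _ _)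
        (fun i _ _ => Real.rpow_nonneg (hβ i) _)) hβ1
    linarith
  subst hkl
  set a := ∑ i ∈ I.erase l, α i
  set b := ∑ i ∈ I.erase l, β i
  have ha0 : 0 ≤ a := sum_nonneg fun i _ => hα i
  have hb0 : 0 ≤ b := sum_nonneg fun i _ => hβ i
  set m := max a b with hm
  have ham : a ≤ m := le_max_left _ _
  have hbm : b ≤ m := le_max_right _ _
  have hm0 : 0 ≤ m := ha0.trans ham
  have hmη : m ≤ η := max_le (by linarith) (by linarith)
  have hR : ∑ i ∈ I.erase l, ∑ j ∈ I.erase l, cc s i j * (α i * β j) ^ q ≤ 2 * m ^ (2 * q) := by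
    have h1 := alldiag (q := q) hs.le hs1 (I.erase l) α β hα hβ
    have h2 : ∑ i ∈ I.erase l, (α i * β i) ^ q ≤
        (∑ i ∈ I.erase l, α i ^ (2 * q) + ∑ i ∈ I.erase l, β i ^ (2 * q)) / 2 := by
      rw [← sum_add_distrib, sum_div]
      exact sum_le_sum fun i _ => amgm (hα i) (hβ i)
    have h3 := sum_sq_le' hq (I.erase l) α hα m ham
    have h4 := sum_sq_le' hq (I.erase l) β hβ m hbm
    have h5 : 0 ≤ m ^ (2 * q) := by positivity
    rw [← hτ] at h1
    nlinarith
  have hrow : ∀ (c u : ℕ → ℝ) (x : ℝ), 0 ≤ x → x ≤ 1 → (∀ i, 0 ≤ u i) → (∑ i ∈ I.erase l, u i ≤ m) →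
      (∀ i, c i = cc s l i) → ∑ j ∈ I.erase l, c j * (x * u j) ^ q ≤ τ * m ^ q := by
    intro c u x hx0 hx1 hu hum hc
    have h1 := rowcc hs.le hs1 I l
    rw [filter_ne'] at h1
    calc _ ≤ ∑ j ∈ I.erase l, cc s l j * m ^ q := by
          apply sum_le_sum; intro j hj
          rw [hc]
          apply mul_le_mul_of_nonneg_left _ (cc_nonneg hs.le _ _)
          apply Real.rpow_le_rpow (mul_nonneg hx0 (hu j)) _ (by linarith)
          have := single_le_sum (f := u) (fun i _ => hu i) hj
          nlinarith [hu j]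
      _ ≤ _ := by
          rw [← sum_mul]
          exact mul_le_mul_of_nonneg_right h1 (by positivity)
  have hr1 := hrow (fun j => cc s l j) β (α l) (hα l) (by linarith) hβ hbm (fun _ => rfl)
  have hr2 := hrow (fun j => cc s j l) α (β l) (hβ l) (by linarith) hα ham (fun _ => cc_symm _ _ _)
  have hmain : cc s l l * (α l * β l) ^ q ≤ 1 - m / 2 := by
    have h1 : α l * β l ≤ 1 - m := by
      have e1 : α l = 1 - a := by linarith
      have e2 : β l = 1 - b := by linarith
      rcases max_choice a b with h | h
      · rw [hm, h, ← e1]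
        exact mul_le_of_le_one_right (hα l) (by linarith)
      · rw [hm, h, ← e2]
        exact mul_le_of_le_one_left (hβ l) (by linarith)
    have h2 : (1 + -m) ^ q ≤ 1 + q * (-m) :=
      rpow_one_add_le_one_add_mul_self (by linarith) (by linarith) hq1.le
    have h3 := Real.rpow_le_rpow (mul_nonneg (hα l) (hβ l)) h1 (by linarith : 0 ≤ q)
    have h4 : cc s l l = 1 := by simp [cc]
    rw [h4, one_mul]
    rw [← sub_eq_add_neg] at h2
    nlinarith
  refine ⟨l, hR.trans ?_⟩
  rw [mul_assoc]
  apply mul_le_mul_of_nonneg_left _ (by norm_num)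
  rw [← Real.mul_rpow (by positivity) (by positivity), ← Real.mul_rpow (by norm_num) hs.le]
  apply Real.rpow_le_rpow hm0 _ (by linarith)
  rcases hm0.eq_or_lt with h | hmpos
  · rw [← h]; positivity
  have hsp := split4 I (fun i j => cc s i j * (α i * β j) ^ q) l hl
  simp_rw [mul_comm (β l)] at hr2
  have e1 : m ^ (2 * q) = m ^ (2 * q - 1) * m := by
    nth_rw 3 [← Real.rpow_one m]
    rw [← Real.rpow_add hmpos]; ring_nf
  have e2 : m = m ^ (1 - q) * m ^ q := by
    rw [← Real.rpow_add hmpos]; simp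
  have h8 : m ^ (2 * q - 1) ≤ 1 / 8 := (Real.rpow_le_rpow hm0 hmη hκ.le).trans hη2
  have hmq : 0 < m ^ q := by positivity
  have h9 : m < 96 * s * m ^ q := by
    have : m ^ (2 * q) ≤ 1 / 8 * m := by rw [e1]; exact mul_le_mul_of_nonneg_right h8 hm0
    have : τ * m ^ q ≤ 12 * s * m ^ q := mul_le_mul_of_nonneg_right hτ12 hmq.le
    linarith
  have h10 : m ^ (1 - q) ≤ 96 * s := by
    have : m ^ (1 - q) * m ^ q < 96 * s * m ^ q := by rw [← e2]; exact h9
    exact (lt_of_mul_lt_mul_right this hmq.le).le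
  calc m = (m ^ (1 - q)) ^ (1 / (1 - q)) := by
        rw [← Real.rpow_mul hm0, mul_one_div_cancel (by linarith), Real.rpow_one]
    _ ≤ _ := Real.rpow_le_rpow (by positivity) h10 (by
        have : 0 < 1 - q := by linarith
        positivity)


lemma sum_cells (E : Finset (ℕ × ℕ)) (e : ℕ → ℕ → ℕ) (p : ℕ) (I J : Finset ℕ) (g : ℕ × ℕ → ℝ) :
    ∑ z ∈ E with e z.1 p ∈ I ∧ e z.2 p ∈ J, g z =
      ∑ i ∈ I, ∑ j ∈ J, ∑ z ∈ E with e z.1 p = i ∧ e z.2 p = j, g z := by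
  have h1 : ∀ i j, ∑ z ∈ E with e z.1 p = i ∧ e z.2 p = j, g z =
      ∑ z ∈ E, if i = e z.1 p then (if j = e z.2 p then g z else 0) else 0 := by
    intro i j
    rw [sum_filter]
    apply sum_congr rfl
    intro z _
    by_cases h : e z.1 p = i <;> by_cases h' : e z.2 p = j <;> simp [h, h', eq_comm]
    · intro h2; exact absurd h2.symm h'
    · intro h2; exact absurd h2.symm h
    · intro h2; exact absurd h2.symm h
  simp_rw [h1]
  have h2 : ∀ i, ∑ j ∈ J, ∑ z ∈ E, (if i = e z.1 p then (if j = e z.2 p then g z else 0) else 0) =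
      ∑ z ∈ E, if i = e z.1 p then (if e z.2 p ∈ J then g z else 0) else 0 := by
    intro i
    rw [sum_comm]
    apply sum_congr rfl
    intro z _
    by_cases h : i = e z.1 p <;> simp [h]
  simp_rw [h2]
  rw [sum_comm, sum_filter]
  apply sum_congr rfl
  intro z _
  simp
  by_cases h : e z.1 p ∈ I <;> by_cases h' : e z.2 p ∈ J <;> simp [h, h']

lemma cells {F G : ℕ → ℕ → ℝ} {e : ℕ → ℕ → ℕ} {t q K : ℝ} {Q : Finset ℕ} (hF : GoodF F)
    (hG : GoodF G) (ht : 1 ≤ t) (hq0 : 0 < q) (hq : q < 1) (hK : 0 ≤ K) {p : ℕ} (hp : p.Prime)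
    (hpQ : p ∉ Q) (hB : Bd F G e t q K Q) {x y V W E C} (hD : Dat e t (insert p Q) x y V W E C)
    (ha : 0 < ∑ v ∈ V, mm F e (insert p Q) x v) (hb : 0 < ∑ v ∈ W, mm G e (insert p Q) y v) :
    ∃ (I : Finset ℕ) (α β : ℕ → ℝ), (∀ i, 0 ≤ α i) ∧ (∀ i, 0 ≤ β i) ∧ ∑ i ∈ I, α i = 1 ∧
      ∑ i ∈ I, β i = 1 ∧ (∀ z ∈ E, e z.1 p ∈ I ∧ e z.2 p ∈ I) ∧ ∀ i j,
      ∑ z ∈ E with e z.1 p = i ∧ e z.2 p = j, mm F e (insert p Q) x z.1 * mm G e (insert p Q) y z.2 ≤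
      K * ((∑ v ∈ V, mm F e (insert p Q) x v) * (∑ v ∈ W, mm G e (insert p Q) y v) *
        Real.exp (-(C * t))) ^ q * (cc ((p:ℝ) ^ (-(1 - q))) i j * (α i * β j) ^ q) := by
  set a := ∑ v ∈ V, mm F e (insert p Q) x v with had
  set b := ∑ v ∈ W, mm G e (insert p Q) y v with hbd
  have hα : ∀ i, 0 ≤ (∑ v ∈ V with e v p = i, mm F e (insert p Q) x v) / a := fun i =>
    div_nonneg (sum_nonneg fun v _ => mm_nonneg hF hD.x0 _ _ _) ha.le
  have hβ : ∀ i, 0 ≤ (∑ v ∈ W with e v p = i, mm G e (insert p Q) y v) / b := fun i =>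
    div_nonneg (sum_nonneg fun v _ => mm_nonneg hG hD.y0 _ _ _) hb.le
  refine ⟨(V ∪ W).image (fun v => e v p), fun i => (∑ v ∈ V with e v p = i, mm F e (insert p Q) x v) / a,
    fun i => (∑ v ∈ W with e v p = i, mm G e (insert p Q) y v) / b, hα, hβ, ?_, ?_, ?_, ?_⟩
  · rw [← sum_div, sum_fiberwise_of_maps_to, ← had, div_self ha.ne']
    intro v hv
    exact mem_image_of_mem _ (mem_union_left _ hv)
  · rw [← sum_div, sum_fiberwise_of_maps_to, ← hbd, div_self hb.ne']
    intro v hv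
    exact mem_image_of_mem _ (mem_union_right _ hv)
  · intro z hz
    have := mem_product.1 (hD.sub hz)
    exact ⟨mem_image_of_mem (fun v => e v p) (mem_union_left _ this.1),
      mem_image_of_mem (fun v => e v p) (mem_union_right _ this.2)⟩
  · intro i j
    refine (cell hF hG ht hq0 hq hK hp hpQ hB hD i j).trans (le_of_eq ?_)
    have h1 := hα i
    have h2 := hβ j
    set ai := ∑ v ∈ V with e v p = i, mm F e (insert p Q) x v
    set bj := ∑ v ∈ W with e v p = j, mm G e (insert p Q) y v
    have : ai * bj * Real.exp (-(C * t)) = (a * b * Real.exp (-(C * t))) * (ai / a * (bj / b)) := by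
      field_simp
    rw [this, Real.mul_rpow (by positivity) (by positivity)]
    ring

lemma zero_case {F G : ℕ → ℕ → ℝ} {e : ℕ → ℕ → ℕ} {t : ℝ} {Q : Finset ℕ} (hF : GoodF F)
    (hG : GoodF G) {x y V W E C} (hD : Dat e t Q x y V W E C) :
    ∑ z ∈ E, mm F e Q x z.1 * mm G e Q y z.2 ≤
      (∑ v ∈ V, mm F e Q x v) * (∑ v ∈ W, mm G e Q y v) := by
  rw [sum_mul_sum, ← sum_product']
  exact sum_le_sum_of_subset_of_nonneg hD.sub fun z _ _ =>
    mul_nonneg (mm_nonneg hF hD.x0 _ _ _) (mm_nonneg hG hD.y0 _ _ _)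

lemma small_step {F G : ℕ → ℕ → ℝ} {e : ℕ → ℕ → ℕ} {t q K : ℝ} {Q : Finset ℕ} (hF : GoodF F)
    (hG : GoodF G) (ht : 1 ≤ t) (hq0 : 1 / 2 < q) (hq : q < 1) (hK : 0 ≤ K) {p : ℕ} (hp : p.Prime)
    (hpQ : p ∉ Q) (hB : Bd F G e t q K Q) :
    Bd F G e t q (K * (1 + 6 * ((p:ℝ) ^ (-(1 - q)) / (1 - (p:ℝ) ^ (-(1 - q)))))) (insert p Q) := by
  intro x y V W E C hD
  have hp1 : (1:ℝ) < p := by exact_mod_cast hp.one_lt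
  have hs1 : (p:ℝ) ^ (-(1 - q)) < 1 := Real.rpow_lt_one_of_one_lt_of_neg hp1 (by linarith)
  have hs0 : 0 < (p:ℝ) ^ (-(1 - q)) := by positivity
  set s := (p:ℝ) ^ (-(1 - q)) with hs
  have hM : 0 ≤ 1 + 6 * (s / (1 - s)) := by
    have : 0 < 1 - s := by linarith
    positivity
  have hz := zero_case hF hG hD
  have ha0 : 0 ≤ ∑ v ∈ V, mm F e (insert p Q) x v := sum_nonneg fun v _ => mm_nonneg hF hD.x0 _ _ _
  have hb0 : 0 ≤ ∑ v ∈ W, mm G e (insert p Q) y v := sum_nonneg fun v _ => mm_nonneg hG hD.y0 _ _ _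
  rcases ha0.eq_or_lt with h | ha
  · rw [← h] at hz ⊢
    refine hz.trans ?_
    rw [zero_mul, zero_mul, Real.zero_rpow (by linarith)]; simp
  rcases hb0.eq_or_lt with h | hb
  · rw [← h] at hz ⊢
    refine hz.trans ?_
    rw [mul_zero, zero_mul, Real.zero_rpow (by linarith)]; simp
  obtain ⟨I, α, β, hα, hβ, sα, sβ, hI, hcell⟩ := cells hF hG ht (by linarith) hq hK hp hpQ hB hD ha hb
  rw [← hs] at hcell
  set B := ((∑ v ∈ V, mm F e (insert p Q) x v) * (∑ v ∈ W, mm G e (insert p Q) y v) *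
        Real.exp (-(C * t))) ^ q
  have hB0 : 0 ≤ B := by positivity
  have hE : E = E.filter (fun z => e z.1 p ∈ I ∧ e z.2 p ∈ I) := by
    rw [filter_true_of_mem hI]
  rw [hE, sum_cells]
  have hall := alldiag (q := q) hs0.le hs1 I α β hα hβ
  have hα1 : ∑ i ∈ I, α i ^ (2 * q) ≤ 1 := by
    simpa using sum_sq_le' hq0 I α hα 1 sα.le
  have hβ1 : ∑ i ∈ I, β i ^ (2 * q) ≤ 1 := by
    simpa using sum_sq_le' hq0 I β hβ 1 sβ.le
  have hd2 : ∑ i ∈ I, (α i * β i) ^ q ≤ (∑ i ∈ I, α i ^ (2 * q) + ∑ i ∈ I, β i ^ (2 * q)) / 2 := by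
    rw [← sum_add_distrib, sum_div]
    exact sum_le_sum fun i _ => amgm (hα i) (hβ i)
  calc _ ≤ ∑ i ∈ I, ∑ j ∈ I, K * B * (cc s i j * (α i * β j) ^ q) :=
        sum_le_sum fun i _ => sum_le_sum fun j _ => hcell i j
    _ = K * B * ∑ i ∈ I, ∑ j ∈ I, (cc s i j * (α i * β j) ^ q) := by
        simp_rw [mul_sum]
    _ ≤ K * B * (1 + 6 * (s / (1 - s))) := by
        apply mul_le_mul_of_nonneg_left _ (by positivity)
        have : 0 ≤ 6 * (s / (1 - s)) := by
          have : 0 < 1 - s := by linarith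
          positivity
        nlinarith
    _ = _ := by ring

lemma large_step {F G : ℕ → ℕ → ℝ} {e : ℕ → ℕ → ℕ} {t q K s0 D : ℝ} {Q : Finset ℕ} (hF : GoodF F)
    (hG : GoodF G) (ht : 1 ≤ t) (hq0 : 1 / 2 < q) (hq : q < 1) (hK : 0 ≤ K) {p : ℕ} (hp : p.Prime)
    (hpQ : p ∉ Q) (hB : Bd F G e t q K Q) (hD0 : 0 < D)
    (hloc : ∀ s, 0 < s → s ≤ s0 → ∀ (I : Finset ℕ) (α β : ℕ → ℝ), (∀ i, 0 ≤ α i) → (∀ i, 0 ≤ β i) →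
    ∑ i ∈ I, α i = 1 → ∑ i ∈ I, β i = 1 →
    1 < ∑ i ∈ I, ∑ j ∈ I, cc s i j * (α i * β j) ^ q →
    ∃ k, ∑ i ∈ I.erase k, ∑ j ∈ I.erase k, cc s i j * (α i * β j) ^ q ≤
      D * (s ^ (1 / (1 - q))) ^ (2 * q)) (hps : (p:ℝ) ^ (-(1 - q)) ≤ s0)
    {x y V W E C} (hD : Dat e t (insert p Q) x y V W E C)
    (hbig : K * ((∑ v ∈ V, mm F e (insert p Q) x v) * (∑ v ∈ W, mm G e (insert p Q) y v) *
        Real.exp (-(C * t))) ^ q < ∑ z ∈ E, mm F e (insert p Q) x z.1 * mm G e (insert p Q) y z.2) :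
    ∃ k, ∑ z ∈ E with e z.1 p ≠ k ∧ e z.2 p ≠ k, mm F e (insert p Q) x z.1 * mm G e (insert p Q) y z.2
      ≤ D * (p:ℝ) ^ (-(2 * q)) * ∑ z ∈ E, mm F e (insert p Q) x z.1 * mm G e (insert p Q) y z.2 := by
  have hp1 : (1:ℝ) < p := by exact_mod_cast hp.one_lt
  have hs1 : (p:ℝ) ^ (-(1 - q)) < 1 := Real.rpow_lt_one_of_one_lt_of_neg hp1 (by linarith)
  have hs0 : 0 < (p:ℝ) ^ (-(1 - q)) := by positivity
  have hsp : (((p:ℝ) ^ (-(1 - q))) ^ (1 / (1 - q))) ^ (2 * q) = (p:ℝ) ^ (-(2 * q)) := by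
    rw [← Real.rpow_mul (by positivity), ← Real.rpow_mul (by positivity)]
    congr 1
    have : 1 - q ≠ 0 := by linarith
    field_simp
  set s := (p:ℝ) ^ (-(1 - q)) with hs
  have hz := zero_case hF hG hD
  have ha0 : 0 ≤ ∑ v ∈ V, mm F e (insert p Q) x v := sum_nonneg fun v _ => mm_nonneg hF hD.x0 _ _ _
  have hb0 : 0 ≤ ∑ v ∈ W, mm G e (insert p Q) y v := sum_nonneg fun v _ => mm_nonneg hG hD.y0 _ _ _
  rcases ha0.eq_or_lt with h | ha
  · exfalso
    rw [← h] at hz hbig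
    rw [zero_mul] at hz
    rw [zero_mul, zero_mul, Real.zero_rpow (by linarith)] at hbig
    linarith
  rcases hb0.eq_or_lt with h | hb
  · exfalso
    rw [← h] at hz hbig
    rw [mul_zero] at hz
    rw [mul_zero, zero_mul, Real.zero_rpow (by linarith)] at hbig
    linarith
  obtain ⟨I, α, β, hα, hβ, sα, sβ, hI, hcell⟩ := cells hF hG ht (by linarith) hq hK hp hpQ hB hD ha hb
  rw [← hs] at hcell
  set B := ((∑ v ∈ V, mm F e (insert p Q) x v) * (∑ v ∈ W, mm G e (insert p Q) y v) *
        Real.exp (-(C * t))) ^ q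
  have hB0 : 0 ≤ B := by positivity
  have hgen : ∀ J : Finset ℕ, ∑ z ∈ E with e z.1 p ∈ J ∧ e z.2 p ∈ J,
      mm F e (insert p Q) x z.1 * mm G e (insert p Q) y z.2 ≤
      K * B * ∑ i ∈ J, ∑ j ∈ J, (cc s i j * (α i * β j) ^ q) := by
    intro J
    rw [sum_cells]
    calc _ ≤ ∑ i ∈ J, ∑ j ∈ J, K * B * (cc s i j * (α i * β j) ^ q) :=
        sum_le_sum fun i _ => sum_le_sum fun j _ => hcell i j
      _ = K * B * ∑ i ∈ J, ∑ j ∈ J, (cc s i j * (α i * β j) ^ q) := by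
        simp_rw [mul_sum]
  have hE : E.filter (fun z => e z.1 p ∈ I ∧ e z.2 p ∈ I) = E := by
    rw [filter_true_of_mem hI]
  have h1 : 1 < ∑ i ∈ I, ∑ j ∈ I, cc s i j * (α i * β j) ^ q := by
    by_contra! h
    have := hgen I
    rw [hE] at this
    have : K * B * ∑ i ∈ I, ∑ j ∈ I, (cc s i j * (α i * β j) ^ q) ≤ K * B :=
      mul_le_of_le_one_right (by positivity) h
    linarith
  obtain ⟨k, hk⟩ := hloc s hs0 hps I α β hα hβ sα sβ h1
  refine ⟨k, ?_⟩
  have h2 := hgen (I.erase k)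
  have h3 : E.filter (fun z => e z.1 p ∈ I.erase k ∧ e z.2 p ∈ I.erase k) =
      E.filter (fun z => e z.1 p ≠ k ∧ e z.2 p ≠ k) := by
    apply filter_congr
    intro z hz
    simp [(hI z hz).1, (hI z hz).2]
  rw [h3] at h2
  rw [hsp] at hk
  calc _ ≤ _ := h2
    _ ≤ K * B * (D * (p:ℝ) ^ (-(2 * q))) := mul_le_mul_of_nonneg_left hk (by positivity)
    _ = D * (p:ℝ) ^ (-(2 * q)) * (K * B) := by ring
    _ ≤ _ := mul_le_mul_of_nonneg_left hbig.le (by positivity)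


lemma pi_bound (Q : Finset ℕ) (e : ℕ → ℕ → ℕ) (V : Finset ℕ)
    (hV : ∀ v ∈ V, ∀ v' ∈ V, (∀ p ∈ Q, e v p = e v' p) → v = v') (S : ℕ → Finset ℕ)
    (φ : ℕ → ℕ → ℝ) (hφ : ∀ p i, 0 ≤ φ p i) (hVS : ∀ v ∈ V, ∀ p ∈ Q, e v p ∈ S p) :
    ∑ v ∈ V, ∏ p ∈ Q, φ p (e v p) ≤ ∏ p ∈ Q, ∑ i ∈ S p, φ p i := by
  rw [prod_sum]
  have h1 : ∑ v ∈ V, ∏ p ∈ Q, φ p (e v p) =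
      ∑ g ∈ V.image (fun v => (fun p (_ : p ∈ Q) => e v p)), ∏ x ∈ Q.attach, φ x.1 (g x.1 x.2) := by
    rw [sum_image]
    · apply sum_congr rfl
      intro v _
      exact (prod_attach Q (fun p => φ p (e v p))).symm
    · intro v hv v' hv' h
      apply hV v hv v' hv'
      intro p hp
      exact congrFun (congrFun h p) hp
  rw [h1]
  apply sum_le_sum_of_subset_of_nonneg
  · intro g hg
    obtain ⟨v, hv, rfl⟩ := mem_image.1 hg
    rw [mem_pi]
    intro p hp
    exact hVS v hv p hp
  · intro g _ _
    exact prod_nonneg fun x _ => hφ _ _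

lemma sum_dvd (Q : Finset ℕ) (hQ : ∀ p ∈ Q, p.Prime) (δ : ℕ → ℝ) (hδ : ∀ p, 0 ≤ δ p) (Y : ℕ) :
    ∑ n ∈ Ioc 0 Y, ∏ p ∈ Q, (if p ∣ n then 1 + δ p else 1) ≤ Y * ∏ p ∈ Q, (1 + δ p / p) := by
  have h1 : ∀ n, ∏ p ∈ Q, (if p ∣ n then 1 + δ p else 1) =
      ∑ T ∈ Q.powerset, ∏ p ∈ T, (if p ∣ n then δ p else 0) := by
    intro n
    rw [← prod_one_add]
    apply prod_congr rfl
    intro p _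
    split_ifs <;> simp
  simp_rw [h1]
  rw [sum_comm, prod_one_add, mul_sum]
  apply sum_le_sum
  intro T hT
  rw [mem_powerset] at hT
  have h2 : ∀ n, ∏ p ∈ T, (if p ∣ n then δ p else 0) = if (∏ p ∈ T, p) ∣ n then ∏ p ∈ T, δ p else 0 := by
    intro n
    split_ifs with h
    · apply prod_congr rfl
      intro p hp
      rw [if_pos ((dvd_prod_of_mem _ hp).trans h)]
    · have : ∃ p ∈ T, ¬ p ∣ n := by
        by_contra! h'
        exact h (Finset.prod_primes_dvd n (fun p hp => (hQ p (hT hp)).prime) h')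
      obtain ⟨p, hp, hpn⟩ := this
      exact prod_eq_zero hp (if_neg hpn)
  simp_rw [h2]
  rw [← sum_filter, sum_const, Nat.Ioc_filter_dvd_card_eq_div, nsmul_eq_mul, prod_div_distrib]
  have h3 : ((Y / ∏ p ∈ T, p : ℕ) : ℝ) ≤ Y / ∏ p ∈ T, (p:ℝ) := by
    refine Nat.cast_div_le.trans (le_of_eq ?_)
    push_cast; rfl
  calc _ ≤ (Y / ∏ p ∈ T, (p:ℝ)) * ∏ p ∈ T, δ p :=
        mul_le_mul_of_nonneg_right h3 (prod_nonneg fun p _ => hδ p)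
    _ = _ := by ring

def vp (e : ℕ → ℕ → ℕ) (k : ℕ → ℕ) (Q : Finset ℕ) (v : ℕ) : ℕ := ∏ p ∈ Q, p ^ (e v p - k p)

lemma vp_fact {e : ℕ → ℕ → ℕ} {k : ℕ → ℕ} {Q : Finset ℕ} (hQ : ∀ p ∈ Q, p.Prime) (v : ℕ)
    {p : ℕ} (hp : p ∈ Q) : (vp e k Q v).factorization p = e v p - k p := by
  unfold vp
  rw [Nat.factorization_prod (fun r hr => pow_ne_zero _ (hQ r hr).ne_zero), Finsupp.finsetSum_apply,
    sum_eq_single p]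
  · rw [(hQ p hp).factorization_pow]; simp
  · intro r hr hrp
    rw [(hQ r hr).factorization_pow]; simp [hrp]
  · intro h; exact absurd hp h

lemma loc_sum {F : ℕ → ℕ → ℝ} (hF : GoodF F) {p : ℕ} (hp : p.Prime) (k : ℕ) (d : ℝ) (hd : 0 ≤ d) :
    ∑ i ∈ range (k + 1), F p i * ((p:ℝ) ^ (k - i))⁻¹ * (if i ≠ k then 1 + d else 1) ≤ 1 + d / p := by
  have hpp : (0:ℝ) < p := by exact_mod_cast hp.pos
  have h1 : ∑ i ∈ range (k + 1), F p i * ((p:ℝ) ^ (k - i))⁻¹ * (if i ≠ k then 1 + d else 1) =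
      (∑ i ∈ range (k + 1), F p i * (p:ℝ) ^ i) / (p:ℝ) ^ k +
      d * ((∑ i ∈ range k, F p i * (p:ℝ) ^ i) / (p:ℝ) ^ k) := by
    have h0 : ∀ i ≤ k, ((p:ℝ) ^ (k - i))⁻¹ = (p:ℝ) ^ i / (p:ℝ) ^ k := by
      intro i hi
      rw [eq_div_iff (by positivity)]
      have : (p:ℝ) ^ k = (p:ℝ) ^ (k - i) * (p:ℝ) ^ i := by
        rw [← pow_add, Nat.sub_add_cancel hi]
      rw [this]; field_simp
    rw [sum_range_succ, sum_range_succ _ k, add_div, sum_div, mul_sum]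
    have h2 : ∑ i ∈ range k, F p i * ((p:ℝ) ^ (k - i))⁻¹ * (if i ≠ k then 1 + d else 1) =
        ∑ i ∈ range k, F p i * (p:ℝ) ^ i / (p:ℝ) ^ k +
        ∑ i ∈ range k, d * (F p i * (p:ℝ) ^ i / (p:ℝ) ^ k) := by
      rw [← sum_add_distrib]
      apply sum_congr rfl
      intro i hi
      rw [mem_range] at hi
      rw [h0 i hi.le, if_pos hi.ne]
      ring
    rw [h2, h0 k le_rfl]
    simp
    ring
  rw [h1]
  have h3 : (∑ i ∈ range (k + 1), F p i * (p:ℝ) ^ i) / (p:ℝ) ^ k ≤ 1 := by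
    rw [div_le_one (by positivity)]
    exact hF.2 p k hp
  have h4 : (∑ i ∈ range k, F p i * (p:ℝ) ^ i) / (p:ℝ) ^ k ≤ 1 / p := by
    rw [div_le_div_iff₀ (by positivity) hpp, one_mul]
    cases k with
    | zero => simp
    | succ k =>
      rw [pow_succ]
      exact mul_le_mul_of_nonneg_right (hF.2 p k hp) hpp.le
  have h5 := mul_le_mul_of_nonneg_left h4 hd
  rw [mul_one_div] at h5
  linarith

lemma count {F : ℕ → ℕ → ℝ} (hF : GoodF F) {e : ℕ → ℕ → ℕ} (k : ℕ → ℕ) {Q : Finset ℕ}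
    (hQ : ∀ p ∈ Q, p.Prime) (V : Finset ℕ)
    (hV : ∀ v ∈ V, ∀ v' ∈ V, (∀ p ∈ Q, e v p = e v' p) → v = v') (δ : ℕ → ℝ) (hδ : ∀ p, 0 ≤ δ p)
    (Y : ℕ) :
    ∑ v ∈ V with vp e k Q v ≤ Y, ∏ p ∈ Q, (F p (e v p) * ((p:ℝ) ^ (k p - e v p))⁻¹ *
      (if e v p ≠ k p then 1 + δ p else 1)) ≤ Y * (∏ p ∈ Q, (1 + δ p / p)) ^ 2 := by
  have hP0 : 0 ≤ ∏ p ∈ Q, (1 + δ p / p) := prod_nonneg fun p _ => by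
    have := hδ p
    positivity
  have hφ : ∀ p i, 0 ≤ (F p i * ((p:ℝ) ^ (k p - i))⁻¹ * (if i ≠ k p then 1 + δ p else 1)) := by
    intro p i
    have h1 := hδ p
    have h2 := hF.1 p i
    split_ifs <;> positivity
  have hmaps : ∀ v ∈ V.filter (fun v => vp e k Q v ≤ Y), vp e k Q v ∈ Ioc 0 Y := by
    intro v hv
    rw [mem_Ioc]
    exact ⟨prod_pos fun p hp => pow_pos (hQ p hp).pos _, (mem_filter.1 hv).2⟩
  rw [← sum_fiberwise_of_maps_to hmaps]
  have hn : ∀ n ∈ Ioc 0 Y, ∑ v ∈ V.filter (fun v => vp e k Q v ≤ Y) with vp e k Q v = n,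
      ∏ p ∈ Q, (F p (e v p) * ((p:ℝ) ^ (k p - e v p))⁻¹ *
      (if e v p ≠ k p then 1 + δ p else 1)) ≤
      (∏ p ∈ Q, (1 + δ p / p)) * ∏ p ∈ Q, (if p ∣ n then 1 + δ p else 1) := by
    intro n hn
    rw [← prod_mul_distrib]
    refine (pi_bound Q e _ ?_ (fun p => if p ∣ n then {k p + n.factorization p} else range (k p + 1))
      (fun p i => F p i * ((p:ℝ) ^ (k p - i))⁻¹ * (if i ≠ k p then 1 + δ p else 1)) hφ ?_).trans ?_
    · intro v hv v' hv'
      exact hV v (mem_filter.1 (mem_filter.1 hv).1).1 v' (mem_filter.1 (mem_filter.1 hv').1).1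
    · intro v hv p hp
      have h1 := (mem_filter.1 hv).2
      have h2 := vp_fact (e := e) (k := k) hQ v hp
      rw [h1] at h2
      have hn0 : n ≠ 0 := by rw [mem_Ioc] at hn; omega
      split_ifs with h
      · have := (hQ p hp).factorization_pos_of_dvd hn0 h
        rw [mem_singleton]; omega
      · have := Nat.factorization_eq_zero_of_not_dvd h
        rw [mem_range]; omega
    · apply prod_le_prod
      · intro p _
        exact sum_nonneg fun i _ => hφ p i
      · intro p hp
        have hd := hδ p
        have h0 : 1 ≤ 1 + δ p / p := by
          have : 0 ≤ δ p / p := by positivity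
          linarith
        split_ifs with h
        · rw [sum_singleton]
          have h1 := hF.le_one (hQ p hp) (k p + n.factorization p)
          have h2 : k p - (k p + n.factorization p) = 0 := by omega
          rw [h2, pow_zero, inv_one, mul_one]
          have h3 : (if k p + n.factorization p ≠ k p then 1 + δ p else 1) ≤ 1 + δ p := by
            split_ifs <;> linarith
          calc _ ≤ 1 * (1 + δ p) := mul_le_mul h1 h3 (by split_ifs <;> positivity) (by norm_num)
            _ ≤ _ := mul_le_mul_of_nonneg_right h0 (by positivity)
        · rw [mul_one]
          exact loc_sum hF (hQ p hp) (k p) (δ p) hd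
  refine (sum_le_sum hn).trans ?_
  rw [← mul_sum]
  refine (mul_le_mul_of_nonneg_left (sum_dvd Q hQ δ hδ Y) hP0).trans (le_of_eq ?_)
  ring

lemma tail_sq (Q : Finset ℕ) (t : ℝ) (ht : 1 ≤ t) :
    ∑ p ∈ Q, (if t ≤ (p:ℝ) then t / (p:ℝ) ^ 2 else 0) ≤ 2 := by
  have h1 : ∀ N : ℕ, ∑ p ∈ range N, (if t ≤ (p:ℝ) then 1 / (p:ℝ) ^ 2 else 0) ≤ 
      if t ≤ (N:ℝ) then 2 / t - 2 / (N:ℝ) else 0 := by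
    intro N
    induction N with
    | zero => 
      simp only [range_zero, sum_empty, Nat.cast_zero]
      rw [if_neg (by linarith)]
    | succ n ih =>
      rw [sum_range_succ]
      by_cases h : t ≤ (n:ℝ)
      · have h' : t ≤ ((n + 1 : ℕ) : ℝ) := by push_cast; linarith
        rw [if_pos h] at ih
        rw [if_pos h, if_pos h']
        have hn : (0:ℝ) < n := by linarith
        have : 1 / (n:ℝ) ^ 2 ≤ 2 / n - 2 / (n + 1) := by
          rw [div_sub_div _ _ (by positivity) (by positivity),
            div_le_div_iff₀ (by positivity) (by positivity)]
          have h1 : (1:ℝ) ≤ n := by linarith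
          nlinarith [mul_pos hn hn]
        push_cast
        linarith
      · rw [if_neg h] at ih
        rw [if_neg h, add_zero]
        refine ih.trans ?_
        split_ifs with h2
        · have : 2 / ((n + 1 : ℕ) : ℝ) ≤ 2 / t := div_le_div_of_nonneg_left (by norm_num) (by linarith) h2
          linarith
        · exact le_rfl
  obtain ⟨N, hN⟩ : ∃ N, Q ⊆ range N := ⟨Q.sup id + 1, fun p hp => by
    rw [mem_range]
    have := le_sup (f := id) hp
    simp only [id] at this
    omega⟩
  have h2 : ∑ p ∈ range N, (if t ≤ (p:ℝ) then 1 / (p:ℝ) ^ 2 else 0) ≤ 2 / t := by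
    refine (h1 N).trans ?_
    split_ifs
    · have : (0:ℝ) ≤ 2 / N := by positivity
      linarith
    · positivity
  have h3 : ∑ p ∈ Q, (if t ≤ (p:ℝ) then 1 / (p:ℝ) ^ 2 else 0) ≤ 2 / t :=
    (sum_le_sum_of_subset_of_nonneg hN (fun p _ _ => by split_ifs <;> positivity)).trans h2
  have h4 : ∑ p ∈ Q, (if t ≤ (p:ℝ) then t / (p:ℝ) ^ 2 else 0) =
      t * ∑ p ∈ Q, (if t ≤ (p:ℝ) then 1 / (p:ℝ) ^ 2 else 0) := by
    rw [mul_sum]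
    apply sum_congr rfl
    intro p _
    split_ifs
    · ring
    · simp
  rw [h4]
  calc _ ≤ t * (2 / t) := mul_le_mul_of_nonneg_left h3 (by linarith)
    _ = 2 := by field_simp

noncomputable def dl (t : ℝ) (p : ℕ) : ℝ := if t ≤ (p:ℝ) then Real.exp (10 * t / p) - 1 else 0

lemma dl_nonneg {t : ℝ} (ht : 1 ≤ t) (p : ℕ) : 0 ≤ dl t p := by
  unfold dl
  split_ifs
  · have : 0 ≤ 10 * t / (p:ℝ) := by positivity
    linarith [Real.add_one_le_exp (10 * t / (p:ℝ))]
  · rfl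

lemma dl_prod (Q : Finset ℕ) {t : ℝ} (ht : 1 ≤ t) :
    ∏ p ∈ Q, (1 + dl t p / p) ≤ Real.exp (20 * Real.exp 10) := by
  have h1 : ∀ p ∈ Q, 1 + dl t p / p ≤
      Real.exp (10 * Real.exp 10 * (if t ≤ (p:ℝ) then t / (p:ℝ) ^ 2 else 0)) := by
    intro p _
    have : dl t p / p ≤ 10 * Real.exp 10 * (if t ≤ (p:ℝ) then t / (p:ℝ) ^ 2 else 0) := by
      unfold dl
      split_ifs with h
      · have hp : (0:ℝ) < p := by linarith
        set y := 10 * t / (p:ℝ) with hy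
        have hy0 : 0 ≤ y := by positivity
        have hy1 : y ≤ 10 := by rw [hy, div_le_iff₀ hp]; linarith
        have h2 : Real.exp y - 1 ≤ y * Real.exp 10 := by
          have h3 := Real.add_one_le_exp (-y)
          have h4 : Real.exp y * Real.exp (-y) = 1 := by rw [← Real.exp_add]; simp
          have h5 := Real.exp_pos y
          have h6 : Real.exp y ≤ Real.exp 10 := Real.exp_le_exp.2 hy1
          nlinarith
        rw [div_le_iff₀ hp]
        refine h2.trans (le_of_eq ?_)
        rw [hy]; field_simp
      · simp
    linarith [Real.add_one_le_exp (10 * Real.exp 10 * (if t ≤ (p:ℝ) then t / (p:ℝ) ^ 2 else 0))]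
  refine (prod_le_prod (fun p _ => ?_) h1).trans ?_
  · have := dl_nonneg ht p
    positivity
  · rw [← Real.exp_sum, ← mul_sum, Real.exp_le_exp]
    have := tail_sq Q t ht
    have := Real.exp_pos 10
    nlinarith


lemma refine_graph (E : Finset (ℕ × ℕ)) (V W : Finset ℕ) (hE : E ⊆ V ×ˢ W) (μ ν : ℕ → ℝ)
    (hμ : ∀ v, 0 ≤ μ v) (hν : ∀ v, 0 ≤ ν v) (l κ : ℝ) (hl : 0 ≤ l) (hκ : 0 ≤ κ)
    (h : l * ∑ v ∈ V, μ v + κ * ∑ w ∈ W, ν w < ∑ z ∈ E, μ z.1 * ν z.2) :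
    ∃ V' ⊆ V, ∃ W' ⊆ W, W'.Nonempty ∧ (∀ v ∈ V', l ≤ ∑ w ∈ W' with (v, w) ∈ E, ν w) ∧
      (∀ w ∈ W', κ ≤ ∑ v ∈ V' with (v, w) ∈ E, μ v) := by
  set V0 := V.filter (fun v => 0 < μ v) with hV0
  set W0 := W.filter (fun v => 0 < ν v) with hW0
  let Φ : Finset ℕ × Finset ℕ → ℝ := fun A => 
    ∑ v ∈ A.1, ∑ w ∈ A.2, (if (v, w) ∈ E then μ v * ν w else 0) - l * ∑ v ∈ A.1, μ v - κ * ∑ w ∈ A.2, ν w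
  obtain ⟨⟨V', W'⟩, hm, hmax⟩ := exists_max_image (V0.powerset ×ˢ W0.powerset) Φ ⟨(V0, W0), by simp⟩
  simp only [mem_product, mem_powerset] at hm
  have hV1 : ∑ v ∈ V0, μ v = ∑ v ∈ V, μ v := by
    rw [hV0, sum_filter]
    apply sum_congr rfl
    intro v _
    split_ifs with h1
    · rfl
    · linarith [hμ v]
  have hW1 : ∑ v ∈ W0, ν v = ∑ v ∈ W, ν v := by
    rw [hW0, sum_filter]
    apply sum_congr rfl
    intro v _
    split_ifs with h1
    · rfl
    · linarith [hν v]
  have hE1 : ∑ v ∈ V0, ∑ w ∈ W0, (if (v, w) ∈ E then μ v * ν w else 0) = ∑ z ∈ E, μ z.1 * ν z.2 := by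
    rw [← sum_product' (f := fun v w => if (v, w) ∈ E then μ v * ν w else 0), ← sum_filter]
    apply sum_subset
    · intro z hz
      exact (mem_filter.1 hz).2
    · intro z hz hz'
      have h1 := mem_product.1 (hE hz)
      by_contra h2
      apply hz'
      rw [mem_filter, mem_product, hV0, hW0, mem_filter, mem_filter]
      refine ⟨⟨⟨h1.1, ?_⟩, ⟨h1.2, ?_⟩⟩, hz⟩
      · exact lt_of_le_of_ne (hμ _) (fun h3 => h2 (by rw [← h3]; simp))
      · exact lt_of_le_of_ne (hν _) (fun h3 => h2 (by rw [← h3]; simp))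
  have hpos : 0 < Φ (V', W') := by
    have h1 := hmax (V0, W0) (by simp)
    have h2 : 0 < Φ (V0, W0) := by
      simp only [Φ]
      rw [hV1, hW1, hE1]; linarith
    linarith
  refine ⟨V', hm.1.trans (filter_subset _ _), W', hm.2.trans (filter_subset _ _), ?_, ?_, ?_⟩
  · by_contra hne
    rw [not_nonempty_iff_eq_empty] at hne
    rw [hne] at hpos
    simp only [Φ, sum_empty, sum_const_zero] at hpos
    have : 0 ≤ ∑ v ∈ V', μ v := sum_nonneg fun v _ => hμ v
    nlinarith [mul_nonneg hl this]
  · intro v hv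
    have h1 := hmax (V'.erase v, W') (by
      simp only [mem_product, mem_powerset]
      exact ⟨(erase_subset _ _).trans hm.1, hm.2⟩)
    simp only [Φ] at h1
    rw [← add_sum_erase V' _ hv, ← add_sum_erase V' μ hv] at h1
    have hvpos : 0 < μ v := (mem_filter.1 (hm.1 hv)).2
    have h2 : ∑ w ∈ W', (if (v, w) ∈ E then μ v * ν w else 0) = μ v * ∑ w ∈ W' with (v, w) ∈ E, ν w := by
      rw [sum_filter, mul_sum]
      apply sum_congr rfl
      intro w _
      split_ifs <;> simp
    rw [h2] at h1
    have h3 : μ v * l ≤ μ v * ∑ w ∈ W' with (v, w) ∈ E, ν w := by linarith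
    exact le_of_mul_le_mul_left h3 hvpos
  · intro w hw
    have h1 := hmax (V', W'.erase w) (by
      simp only [mem_product, mem_powerset]
      exact ⟨hm.1, (erase_subset _ _).trans hm.2⟩)
    simp only [Φ] at h1
    rw [sum_comm (s := V') (t := W'), sum_comm (s := V') (t := W'.erase w),
      ← add_sum_erase W' _ hw, ← add_sum_erase W' ν hw] at h1
    have hvpos : 0 < ν w := (mem_filter.1 (hm.2 hw)).2
    have h2 : ∑ v ∈ V', (if (v, w) ∈ E then μ v * ν w else 0) = ν w * ∑ v ∈ V' with (v, w) ∈ E, μ v := by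
      rw [sum_filter, mul_sum]
      apply sum_congr rfl
      intro w _
      split_ifs
      · ring
      · simp
    rw [h2] at h1
    have h3 : ν w * κ ≤ ν w * ∑ v ∈ V' with (v, w) ∈ E, μ v := by linarith
    exact le_of_mul_le_mul_left h3 hvpos

noncomputable def vm (e : ℕ → ℕ → ℕ) (k : ℕ → ℕ) (Q : Finset ℕ) (v : ℕ) : ℝ :=
  ∏ p ∈ Q, (p:ℝ) ^ (k p - e v p)

noncomputable def hh (e : ℕ → ℕ → ℕ) (k : ℕ → ℕ) (Q : Finset ℕ) (t : ℝ) (v : ℕ) : ℝ :=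
  ∏ p ∈ Q, (if e v p ≠ k p then 1 + dl t p else 1)

noncomputable def Ph (F : ℕ → ℕ → ℝ) (e : ℕ → ℕ → ℕ) (k : ℕ → ℕ) (Q : Finset ℕ) (t : ℝ) (v : ℕ) : ℝ :=
  ∏ p ∈ Q, (F p (e v p) * ((p:ℝ) ^ (k p - e v p))⁻¹ * (if e v p ≠ k p then 1 + dl t p else 1))

lemma Ph_eq (F e k Q t v) : Ph F e k Q t v = (∏ p ∈ Q, F p (e v p)) * (vm e k Q v)⁻¹ * hh e k Q t v := by
  unfold Ph vm hh
  rw [prod_mul_distrib, prod_mul_distrib, prod_inv_distrib]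

lemma edge_x {e : ℕ → ℕ → ℕ} {k : ℕ → ℕ} {Q : Finset ℕ} {v w : ℕ} {X : ℝ}
    (hk : ∀ p ∈ Q, e v p = k p ∨ e w p = k p)
    (h : X * ∏ p ∈ Q, (p : ℝ) ^ (e w p - e v p) ≤ 1) :
    X * (vp e k Q w * vm e k Q v) ≤ 1 := by
  refine le_trans (le_of_eq ?_) h
  unfold vp vm
  push_cast
  rw [← prod_mul_distrib]
  congr 1
  apply prod_congr rfl
  intro p hp
  rw [← pow_add]
  congr 1
  rcases hk p hp with h | h <;> omega

lemma edge_h {e : ℕ → ℕ → ℕ} {k : ℕ → ℕ} {Q : Finset ℕ} {v w : ℕ} {t C : ℝ} (ht : 1 ≤ t)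
    (hk : ∀ p ∈ Q, e v p = k p ∨ e w p = k p)
    (h : C ≤ ∑ p ∈ Q, if e v p ≠ e w p ∧ t ≤ (p : ℝ) then 1 / (p : ℝ) else 0) :
    Real.exp (10 * t * C) ≤ hh e k Q t v * hh e k Q t w := by
  calc Real.exp (10 * t * C) ≤
      Real.exp (10 * t * ∑ p ∈ Q, if e v p ≠ e w p ∧ t ≤ (p : ℝ) then 1 / (p : ℝ) else 0) := by
        rw [Real.exp_le_exp]
        exact mul_le_mul_of_nonneg_left h (by linarith)
    _ = ∏ p ∈ Q, Real.exp (10 * t * if e v p ≠ e w p ∧ t ≤ (p : ℝ) then 1 / (p : ℝ) else 0) := by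
        rw [mul_sum, Real.exp_sum]
    _ ≤ _ := by
        unfold hh
        rw [← prod_mul_distrib]
        apply prod_le_prod (fun _ _ => (Real.exp_pos _).le)
        intro p hp
        have hd := dl_nonneg ht p
        by_cases hvw : e v p ≠ e w p
        · have h1 : Real.exp (10 * t * if e v p ≠ e w p ∧ t ≤ (p : ℝ) then 1 / (p : ℝ) else 0) =
            1 + dl t p := by
            unfold dl
            by_cases htp : t ≤ (p:ℝ)
            · simp [hvw, htp]; rfl
            · simp [htp]
          rw [h1]
          rcases hk p hp with h | h
          · rw [if_neg (by simpa using h), if_pos (by rw [← h]; exact hvw.symm), one_mul]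
          · rw [if_pos (by rw [← h]; exact hvw), if_neg (by simpa using h), mul_one]
        · rw [if_neg (by tauto), mul_zero, Real.exp_zero]
          have : ∀ u, (1:ℝ) ≤ if e u p ≠ k p then 1 + dl t p else 1 := by
            intro u; split_ifs <;> linarith
          exact one_le_mul_of_one_le_of_one_le (this v) (this w)

lemma Ph_nonneg {F : ℕ → ℕ → ℝ} (hF : GoodF F) (e k Q) {t : ℝ} (ht : 1 ≤ t) (v) :
    0 ≤ Ph F e k Q t v := by
  apply prod_nonneg
  intro p _
  have h1 := dl_nonneg ht p
  have h2 := hF.1 p (e v p)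
  split_ifs <;> positivity

lemma hh_nonneg (e k Q) {t : ℝ} (ht : 1 ≤ t) (v) : 0 ≤ hh e k Q t v := by
  apply prod_nonneg
  intro p _
  have h1 := dl_nonneg ht p
  split_ifs <;> positivity

lemma mm_bound {F : ℕ → ℕ → ℝ} (hF : GoodF F) {e : ℕ → ℕ → ℕ} {k : ℕ → ℕ} {Q : Finset ℕ}
    (hQ : ∀ p ∈ Q, p.Prime) {t : ℝ} (ht : 1 ≤ t) {x : ℕ → ℝ} {v w : ℕ}
    (h : x v * (vp e k Q w * vm e k Q v) ≤ 1) :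
    mm F e Q x v * hh e k Q t v ≤ Ph F e k Q t v / vp e k Q w := by
  have h1 : (0:ℝ) < vp e k Q w := by
    exact_mod_cast prod_pos fun p hp => pow_pos (hQ p hp).pos _
  have h2 : 0 < vm e k Q v := prod_pos fun p hp => pow_pos (by exact_mod_cast (hQ p hp).pos) _
  have h3 : x v ≤ (vm e k Q v)⁻¹ / vp e k Q w := by
    rw [le_div_iff₀ h1, ← one_div, le_div_iff₀ h2]
    linarith
  rw [Ph_eq]
  unfold mm
  have h4 : 0 ≤ ∏ p ∈ Q, F p (e v p) := prod_nonneg fun p _ => hF.1 _ _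
  have h5 := hh_nonneg e k Q ht v
  calc _ ≤ (vm e k Q v)⁻¹ / vp e k Q w * (∏ p ∈ Q, F p (e v p)) * hh e k Q t v := by gcongr
    _ = _ := by ring

lemma T_bound {F G : ℕ → ℕ → ℝ} (hF : GoodF F) (hG : GoodF G) {e : ℕ → ℕ → ℕ} {k : ℕ → ℕ}
    {Q : Finset ℕ} (hQ : ∀ p ∈ Q, p.Prime) {t : ℝ} (ht : 1 ≤ t) {x y V W E C}
    (hD : Dat e t Q x y V W E C) (hk : ∀ z ∈ E, ∀ p ∈ Q, e z.1 p = k p ∨ e z.2 p = k p)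
    {V' W' : Finset ℕ} (hV' : V' ⊆ V) (hW' : W' ⊆ W) (w0 : ℕ)
    (hmax : ∀ w ∈ W', vp e k Q w ≤ vp e k Q w0) :
    ∑ w ∈ W', ∑ v ∈ V' with (v, w0) ∈ E ∧ (v, w) ∈ E, mm F e Q x v * mm G e Q y w ≤
      Real.exp (20 * Real.exp 10) ^ 4 * Real.exp (-(10 * t * C)) := by
  have hvp : ∀ v, (0:ℝ) < vp e k Q v := fun v => by
    exact_mod_cast prod_pos fun p hp => pow_pos (hQ p hp).pos _
  set c := (∏ p ∈ Q, (1 + dl t p / p)) ^ 2 with hc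
  have hc0 : 0 ≤ c := by positivity
  have hcle : c ≤ Real.exp (20 * Real.exp 10) ^ 2 := by
    rw [hc]
    apply pow_le_pow_left₀ (prod_nonneg fun p _ => ?_) (dl_prod Q ht)
    have := dl_nonneg ht p
    positivity
  have hw : ∀ w ∈ W', ∑ v ∈ V' with (v, w0) ∈ E ∧ (v, w) ∈ E, mm F e Q x v * mm G e Q y w ≤
      Real.exp (-(10 * t * C)) * (c / vp e k Q w0) * Ph G e k Q t w := by
    intro w hw
    set A := V'.filter (fun v => (v, w0) ∈ E ∧ (v, w) ∈ E) with hA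
    have hPG := Ph_nonneg hG e k Q ht w
    have hv0 := hvp w0
    rcases A.eq_empty_or_nonempty with h | h
    · rw [h, sum_empty]
      positivity
    · obtain ⟨v1, hv1, hv1m⟩ := exists_max_image A (vp e k Q) h
      have hv1' := (mem_filter.1 hv1).2
      have hmw : mm G e Q y w * hh e k Q t w ≤ Ph G e k Q t w / vp e k Q v1 :=
        mm_bound hG hQ ht (edge_x (fun p hp => (hk _ hv1'.2 p hp).symm) (hD.cy _ hv1'.2))
      have hmw0 : 0 ≤ mm G e Q y w * hh e k Q t w :=
        mul_nonneg (mm_nonneg hG hD.y0 _ _ _) (hh_nonneg e k Q ht _)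
      have hcount : ∑ v ∈ A, Ph F e k Q t v ≤ vp e k Q v1 * c := by
        refine le_trans ?_ (count hF k hQ V hD.injV (dl t) (dl_nonneg ht) (vp e k Q v1))
        apply sum_le_sum_of_subset_of_nonneg
        · intro v hv
          exact mem_filter.2 ⟨hV' (mem_filter.1 hv).1, hv1m v hv⟩
        · intro v _ _
          exact Ph_nonneg hF e k Q ht v
      calc ∑ v ∈ A, mm F e Q x v * mm G e Q y w ≤
          ∑ v ∈ A, Real.exp (-(10 * t * C)) * ((Ph F e k Q t v / vp e k Q w0) *
            (mm G e Q y w * hh e k Q t w)) := by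
            apply sum_le_sum
            intro v hv
            have hv' := (mem_filter.1 hv).2
            have h1 : mm F e Q x v * hh e k Q t v ≤ Ph F e k Q t v / vp e k Q w0 :=
              mm_bound hF hQ ht (edge_x (hk _ hv'.1) (hD.cx _ hv'.1))
            have h2 := edge_h ht (hk _ hv'.2) (hD.cC _ hv'.2)
            have h3 : 0 ≤ mm F e Q x v * mm G e Q y w :=
              mul_nonneg (mm_nonneg hF hD.x0 _ _ _) (mm_nonneg hG hD.y0 _ _ _)
            have h4 : 1 ≤ Real.exp (-(10 * t * C)) * (hh e k Q t v * hh e k Q t w) := by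
              rw [Real.exp_neg, inv_mul_eq_div, le_div_iff₀ (Real.exp_pos _), one_mul]
              exact h2
            calc mm F e Q x v * mm G e Q y w ≤ (mm F e Q x v * mm G e Q y w) *
                (Real.exp (-(10 * t * C)) * (hh e k Q t v * hh e k Q t w)) :=
                  le_mul_of_one_le_right h3 h4
              _ = Real.exp (-(10 * t * C)) * ((mm F e Q x v * hh e k Q t v) *
                  (mm G e Q y w * hh e k Q t w)) := by ring
              _ ≤ _ := by gcongr
        _ = Real.exp (-(10 * t * C)) * ((∑ v ∈ A, Ph F e k Q t v) / vp e k Q w0 *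
            (mm G e Q y w * hh e k Q t w)) := by
            rw [← mul_sum, ← sum_mul, sum_div]
        _ ≤ Real.exp (-(10 * t * C)) * ((vp e k Q v1 * c) / vp e k Q w0 *
            (Ph G e k Q t w / vp e k Q v1)) := by gcongr
        _ = _ := by
            have := hvp v1
            field_simp
  have hcount : ∑ w ∈ W', Ph G e k Q t w ≤ vp e k Q w0 * c := by
    refine le_trans ?_ (count hG k hQ W hD.injW (dl t) (dl_nonneg ht) (vp e k Q w0))
    apply sum_le_sum_of_subset_of_nonneg
    · intro v hv
      exact mem_filter.2 ⟨hW' hv, hmax v hv⟩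
    · intro v _ _
      exact Ph_nonneg hG e k Q ht v
  calc _ ≤ ∑ w ∈ W', Real.exp (-(10 * t * C)) * (c / vp e k Q w0) * Ph G e k Q t w := sum_le_sum hw
    _ = Real.exp (-(10 * t * C)) * (c / vp e k Q w0) * ∑ w ∈ W', Ph G e k Q t w := by rw [mul_sum]
    _ ≤ Real.exp (-(10 * t * C)) * (c / vp e k Q w0) * (vp e k Q w0 * c) := by gcongr
    _ = c ^ 2 * Real.exp (-(10 * t * C)) := by
        have := hvp w0
        field_simp
    _ ≤ (Real.exp (20 * Real.exp 10) ^ 2) ^ 2 * Real.exp (-(10 * t * C)) := by gcongr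
    _ = _ := by ring

lemma endgame {F G : ℕ → ℕ → ℝ} (hF : GoodF F) (hG : GoodF G) {e : ℕ → ℕ → ℕ} {k : ℕ → ℕ}
    {Q : Finset ℕ} (hQ : ∀ p ∈ Q, p.Prime) {t : ℝ} (ht : 1 ≤ t) {x y V W E C}
    (hD : Dat e t Q x y V W E C) (hk : ∀ z ∈ E, ∀ p ∈ Q, e z.1 p = k p ∨ e z.2 p = k p) :
    (∑ z ∈ E, mm F e Q x z.1 * mm G e Q y z.2) ^ 2 ≤ 16 *
      ((∑ v ∈ V, mm F e Q x v) * (∑ v ∈ W, mm G e Q y v)) * 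
      (Real.exp (20 * Real.exp 10) ^ 4 * Real.exp (-(10 * t * C))) := by
  have hz := zero_case hF hG hD
  have hμ : ∀ v, 0 ≤ mm F e Q x v := fun v => mm_nonneg hF hD.x0 _ _ _
  have hν : ∀ v, 0 ≤ mm G e Q y v := fun v => mm_nonneg hG hD.y0 _ _ _
  set a := ∑ v ∈ V, mm F e Q x v with had
  set b := ∑ v ∈ W, mm G e Q y v with hbd
  set M := ∑ z ∈ E, mm F e Q x z.1 * mm G e Q y z.2 with hM
  have ha : 0 ≤ a := sum_nonneg fun v _ => hμ v
  have hb : 0 ≤ b := sum_nonneg fun v _ => hν v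
  have hM0 : 0 ≤ M := sum_nonneg fun z _ => mul_nonneg (hμ _) (hν _)
  rcases hM0.eq_or_lt with h | hMpos
  · rw [← h, zero_pow two_ne_zero]
    positivity
  have ha' : 0 < a := by
    rcases ha.eq_or_lt with h | h
    · rw [← h] at hz; linarith
    · exact h
  have hb' : 0 < b := by
    rcases hb.eq_or_lt with h | h
    · rw [← h] at hz; linarith
    · exact h
  obtain ⟨V', hV', W', hW', hne, hdv, hdw⟩ := refine_graph E V W hD.sub _ _ hμ hν (M / (4 * a)) (M / (4 * b))
    (by positivity) (by positivity) (by
      rw [← had, ← hbd, ← hM]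
      have e1 : M / (4 * a) * a = M / 4 := by field_simp
      have e2 : M / (4 * b) * b = M / 4 := by field_simp
      rw [e1, e2]; linarith)
  obtain ⟨w0, hw0, hw0m⟩ := exists_max_image W' (vp e k Q) hne
  have hT := T_bound hF hG hQ ht hD hk hV' hW' w0 hw0m
  have hlow : M / (4 * a) * (M / (4 * b)) ≤ 
      ∑ w ∈ W', ∑ v ∈ V' with (v, w0) ∈ E ∧ (v, w) ∈ E, mm F e Q x v * mm G e Q y w := by
    calc M / (4 * a) * (M / (4 * b)) ≤ M / (4 * a) * ∑ v ∈ V' with (v, w0) ∈ E, mm F e Q x v :=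
          mul_le_mul_of_nonneg_left (hdw w0 hw0) (by positivity)
      _ = ∑ v ∈ V' with (v, w0) ∈ E, mm F e Q x v * (M / (4 * a)) := by rw [mul_comm, sum_mul]
      _ ≤ ∑ v ∈ V' with (v, w0) ∈ E, mm F e Q x v * ∑ w ∈ W' with (v, w) ∈ E, mm G e Q y w := by
          apply sum_le_sum
          intro v hv
          exact mul_le_mul_of_nonneg_left (hdv v (mem_filter.1 hv).1) (hμ v)
      _ = _ := by
          simp_rw [mul_sum]
          apply sum_comm'
          intro v w
          simp only [mem_filter]
          tauto
  have h1 := hlow.trans hT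
  have e1 : M / (4 * a) * (M / (4 * b)) = M ^ 2 / (16 * (a * b)) := by field_simp; norm_num
  rw [e1, div_le_iff₀ (by positivity)] at h1
  linarith


lemma tail_choice (q s0 D : ℝ) (hq : 1 / 2 < q) (hq1 : q < 1) (hs0 : 0 < s0) (hD : 0 < D) :
    ∃ p0 : ℕ, (∀ p : ℕ, p0 < p → (p:ℝ) ^ (-(1 - q)) ≤ s0) ∧
      ∀ Q : Finset ℕ, (∀ p ∈ Q, p0 < p) → ∑ p ∈ Q, D * (p:ℝ) ^ (-(2 * q)) ≤ 1 / 2 := by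
  have h1 : Filter.Tendsto (fun p : ℕ => (p:ℝ) ^ (-(1 - q))) Filter.atTop (nhds 0) :=
    (tendsto_rpow_neg_atTop (by linarith)).comp tendsto_natCast_atTop_atTop
  have h1' := h1.eventually (ge_mem_nhds hs0)
  obtain ⟨N1, hN1⟩ := Filter.eventually_atTop.1 h1'
  have h2 : Summable (fun p : ℕ => (p:ℝ) ^ (-(2 * q))) := by
    rw [Real.summable_nat_rpow]; linarith
  have h3 := summable_iff_vanishing_norm.1 h2 (1 / (2 * D)) (by positivity)
  obtain ⟨s, hs⟩ := h3
  refine ⟨max N1 (s.sup id), fun p hp => hN1 p (le_trans (le_max_left _ _) hp.le), ?_⟩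
  intro Q hQ
  have hd : Disjoint Q s := by
    rw [Finset.disjoint_left]
    intro p hp hps
    have := hQ p hp
    have h5 : p ≤ s.sup id := Finset.le_sup (f := id) hps
    have := le_max_right N1 (s.sup id)
    omega
  have := (le_abs_self _).trans_lt (hs Q hd)
  rw [← mul_sum]
  rw [lt_div_iff₀ (by positivity)] at this
  linarith

lemma final_arith {q M P X c : ℝ} (hq : 1 / 2 < q) (hq1 : q ≤ 9 / 10) (hM : 0 ≤ M) (hP : 0 ≤ P)
    (hX0 : 0 < X) (hX1 : X ≤ 1) (hc : 1 ≤ c) (h1 : M ≤ P)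
    (h2 : (M / 2) ^ 2 ≤ 16 * P * (c ^ 4 * X ^ 10)) : M ≤ 8 * c ^ 2 * (P * X) ^ q := by
  rcases hM.eq_or_lt with h | hMp
  · rw [← h]; positivity
  have hPp : 0 < P := hMp.trans_le h1
  have h3 : M ≤ 8 * c ^ 2 * X ^ 5 * P ^ (1 / 2 : ℝ) := by
    rw [← Real.sqrt_eq_rpow]
    refine (pow_le_pow_iff_left₀ hM (by positivity) two_ne_zero).1 ?_
    calc M ^ 2 = 4 * (M / 2) ^ 2 := by ring
      _ ≤ 4 * (16 * P * (c ^ 4 * X ^ 10)) := by linarith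
      _ = 64 * (Real.sqrt P ^ 2) * (c ^ 4 * X ^ 10) := by rw [Real.sq_sqrt hP]; ring
      _ = _ := by ring
  have e1 : M = M ^ (2 * q - 1) * M ^ (2 - 2 * q) := by
    rw [← Real.rpow_add hMp]; ring_nf; simp
  have h4 : M ^ (2 * q - 1) ≤ P ^ (2 * q - 1) := Real.rpow_le_rpow hM h1 (by linarith)
  have h5 : M ^ (2 - 2 * q) ≤ (8 * c ^ 2 * X ^ 5 * P ^ (1 / 2 : ℝ)) ^ (2 - 2 * q) :=
    Real.rpow_le_rpow hM h3 (by linarith)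
  have h6 : (8 * c ^ 2 * X ^ 5 * P ^ (1 / 2 : ℝ)) ^ (2 - 2 * q) =
      (8 * c ^ 2) ^ (2 - 2 * q) * (X ^ 5) ^ (2 - 2 * q) * P ^ (1 - q) := by
    rw [Real.mul_rpow (by positivity) (by positivity), Real.mul_rpow (by positivity) (by positivity),
      ← Real.rpow_mul hP]
    ring_nf
  have h7 : (8 * c ^ 2) ^ (2 - 2 * q) ≤ 8 * c ^ 2 := by
    have h8 : 1 ≤ 8 * c ^ 2 := by nlinarith
    calc (8 * c ^ 2) ^ (2 - 2 * q) ≤ (8 * c ^ 2) ^ (1:ℝ) :=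
          Real.rpow_le_rpow_of_exponent_le h8 (by linarith)
      _ = _ := Real.rpow_one _
  have h8 : (X ^ 5) ^ (2 - 2 * q) ≤ X ^ q := by
    rw [← Real.rpow_natCast, ← Real.rpow_mul hX0.le]
    apply Real.rpow_le_rpow_of_exponent_ge hX0 hX1
    push_cast; linarith
  calc M = M ^ (2 * q - 1) * M ^ (2 - 2 * q) := e1
    _ ≤ P ^ (2 * q - 1) * ((8 * c ^ 2) * X ^ q * P ^ (1 - q)) := by
        apply mul_le_mul h4 _ (by positivity) (by positivity)
        rw [h6] at h5
        refine h5.trans ?_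
        gcongr
    _ = 8 * c ^ 2 * (P ^ (2 * q - 1) * P ^ (1 - q) * X ^ q) := by ring
    _ = _ := by
        rw [← Real.rpow_add hPp, Real.mul_rpow hP hX0.le]
        ring_nf

lemma sum_biUnion_le' {α β : Type*} [DecidableEq α] [DecidableEq β] (Q : Finset α) (S : α → Finset β) (f : β → ℝ)
    (hf : ∀ z, 0 ≤ f z) : ∑ z ∈ Q.biUnion S, f z ≤ ∑ p ∈ Q, ∑ z ∈ S p, f z := by
  induction Q using Finset.induction_on with
  | empty => simp
  | insert a Q ha ih =>
    rw [biUnion_insert, sum_insert ha]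
    have := sum_union_inter (s₁ := S a) (s₂ := Q.biUnion S) (f := f)
    have h2 : 0 ≤ ∑ z ∈ S a ∩ Q.biUnion S, f z := sum_nonneg fun z _ => hf z
    linarith

lemma Dat.mono {e t Q x y V W E E' C} (h : Dat e t Q x y V W E C) (hE : E' ⊆ E) :
    Dat e t Q x y V W E' C :=
  ⟨h.x0, h.y0, hE.trans h.sub, h.injV, h.injW, fun z hz => h.cx z (hE hz),
    fun z hz => h.cy z (hE hz), fun z hz => h.cC z (hE hz)⟩

lemma Dat.max {e t Q x y V W E C} (h : Dat e t Q x y V W E C) :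
    Dat e t Q x y V W E (max C 0) :=
  ⟨h.x0, h.y0, h.sub, h.injV, h.injW, h.cx, h.cy, fun z hz => max_le (h.cC z hz)
    (sum_nonneg fun p _ => by split_ifs <;> positivity)⟩

lemma part1 (q : ℝ) (hq : 1 / 2 < q) (hq1 : q ≤ 9 / 10) : ∃ p0 : ℕ, ∃ K > (0:ℝ),
    ∀ (F G : ℕ → ℕ → ℝ), GoodF F → GoodF G → ∀ (e : ℕ → ℕ → ℕ) (t : ℝ), 1 ≤ t →
    ∀ Q : Finset ℕ, (∀ p ∈ Q, p.Prime ∧ p0 < p) → Bd F G e t q K Q := by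
  obtain ⟨s0, hs0, D, hD0, hloc⟩ := localB q hq (by linarith)
  obtain ⟨p0, hp1, hp2⟩ := tail_choice q s0 D hq (by linarith) hs0 hD0
  set c := Real.exp (20 * Real.exp 10) with hc
  have hc1 : 1 ≤ c := Real.one_le_exp (by positivity)
  refine ⟨p0, 8 * c ^ 2, by positivity, ?_⟩
  intro F G hF hG e t ht Q
  induction Q using Finset.strongInduction with
  | H Q ih =>
  intro hQ x y V W E C0 hDat0
  have hDat := hDat0.max
  set C := max C0 0 with hC
  have hCC : C0 ≤ C := le_max_left _ _
  have hC0 : 0 ≤ C := le_max_right _ _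
  have hz := zero_case hF hG hDat
  have hμ : ∀ v, 0 ≤ mm F e Q x v := fun v => mm_nonneg hF hDat.x0 _ _ _
  have hν : ∀ v, 0 ≤ mm G e Q y v := fun v => mm_nonneg hG hDat.y0 _ _ _
  have hterm : ∀ z : ℕ × ℕ, 0 ≤ mm F e Q x z.1 * mm G e Q y z.2 := fun z => mul_nonneg (hμ _) (hν _)
  have ha : 0 ≤ ∑ v ∈ V, mm F e Q x v := sum_nonneg fun v _ => hμ v
  have hb : 0 ≤ ∑ v ∈ W, mm G e Q y v := sum_nonneg fun v _ => hν v
  have hM0 : 0 ≤ ∑ z ∈ E, mm F e Q x z.1 * mm G e Q y z.2 := sum_nonneg fun z _ => hterm z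
  have hred : 8 * c ^ 2 * ((∑ v ∈ V, mm F e Q x v) * (∑ w ∈ W, mm G e Q y w) * Real.exp (-(C * t))) ^ q
      ≤ 8 * c ^ 2 * ((∑ v ∈ V, mm F e Q x v) * (∑ w ∈ W, mm G e Q y w) *
        Real.exp (-(C0 * t))) ^ q := by
    have : Real.exp (-(C * t)) ≤ Real.exp (-(C0 * t)) := by
      apply Real.exp_le_exp.2; nlinarith
    gcongr
  refine le_trans ?_ hred
  by_contra hbig
  rw [not_le] at hbig
  have hk : ∀ p ∈ Q, ∃ k, ∑ z ∈ E with e z.1 p ≠ k ∧ e z.2 p ≠ k, mm F e Q x z.1 * mm G e Q y z.2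
      ≤ D * (p:ℝ) ^ (-(2 * q)) * ∑ z ∈ E, mm F e Q x z.1 * mm G e Q y z.2 := by
    intro p hp
    have hins : insert p (Q.erase p) = Q := insert_erase hp
    have hB := ih (Q.erase p) (erase_ssubset hp) (fun r hr => hQ r (mem_of_mem_erase hr))
    have := large_step (x := x) (y := y) (V := V) (W := W) (E := E) (C := C) hF hG ht hq
      (by linarith) (by positivity) (hQ p hp).1 (notMem_erase p Q) hB hD0 hloc
      (hp1 p (hQ p hp).2)
    rw [hins] at this
    exact this hDat hbig
  choose! k hk using hk
  set E' := E.filter (fun z => ∀ p ∈ Q, e z.1 p = k p ∨ e z.2 p = k p) with hE'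
  have hD' : Dat e t Q x y V W E' C := hDat.mono (filter_subset _ _)
  have hend := endgame hF hG (fun p hp => (hQ p hp).1) ht hD' (fun z hz => (mem_filter.1 hz).2)
  have hsplit : ∑ z ∈ E, mm F e Q x z.1 * mm G e Q y z.2 ≤
      ∑ z ∈ E', mm F e Q x z.1 * mm G e Q y z.2 +
      ∑ p ∈ Q, ∑ z ∈ E with e z.1 p ≠ k p ∧ e z.2 p ≠ k p, mm F e Q x z.1 * mm G e Q y z.2 := by
    rw [← sum_filter_add_sum_filter_not E (fun z => ∀ p ∈ Q, e z.1 p = k p ∨ e z.2 p = k p)]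
    gcongr
    calc _ ≤ ∑ z ∈ Q.biUnion (fun p => E.filter (fun z => e z.1 p ≠ k p ∧ e z.2 p ≠ k p)),
          mm F e Q x z.1 * mm G e Q y z.2 := by
            apply sum_le_sum_of_subset_of_nonneg
            · intro z hz
              rw [mem_filter] at hz
              obtain ⟨h1, h2⟩ := hz
              push Not at h2
              obtain ⟨p, hp, h3⟩ := h2
              exact mem_biUnion.2 ⟨p, hp, mem_filter.2 ⟨h1, h3⟩⟩
            · intro z _ _
              exact hterm z
      _ ≤ _ := by
          exact sum_biUnion_le' _ _ _ hterm
  have hhalf : ∑ p ∈ Q, ∑ z ∈ E with e z.1 p ≠ k p ∧ e z.2 p ≠ k p, mm F e Q x z.1 * mm G e Q y z.2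
      ≤ 1 / 2 * ∑ z ∈ E, mm F e Q x z.1 * mm G e Q y z.2 := by
    refine (sum_le_sum hk).trans ?_
    rw [← sum_mul]
    exact mul_le_mul_of_nonneg_right (hp2 Q fun p hp => (hQ p hp).2) hM0
  have hX : Real.exp (-(10 * t * C)) = Real.exp (-(C * t)) ^ 10 := by
    rw [← Real.exp_nat_mul]; push_cast; ring_nf
  rw [hX] at hend
  refine absurd (final_arith (c := c) hq hq1 hM0 (mul_nonneg ha hb) (Real.exp_pos (-(C * t)))
    (Real.exp_le_one_iff.2 (by nlinarith)) hc1 hz ?_) (not_le.2 hbig)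
  refine le_trans ?_ hend
  apply pow_le_pow_left₀ (by positivity)
  linarith

lemma Bd.mono {F G e t q K K' Q} (hF : GoodF F) (hG : GoodF G) (h : Bd F G e t q K Q) (hK : K ≤ K') :
    Bd F G e t q K' Q := by
  intro x y V W E C hD
  refine (h x y V W E C hD).trans (mul_le_mul_of_nonneg_right hK ?_)
  have ha : 0 ≤ ∑ v ∈ V, mm F e Q x v := sum_nonneg fun v _ => mm_nonneg hF hD.x0 _ _ _
  have hb : 0 ≤ ∑ v ∈ W, mm G e Q y v := sum_nonneg fun v _ => mm_nonneg hG hD.y0 _ _ _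
  positivity

lemma part2 (q : ℝ) (hq : 1 / 2 < q) (hq1 : q ≤ 9 / 10) : ∃ K > (0:ℝ),
    ∀ (F G : ℕ → ℕ → ℝ), GoodF F → GoodF G → ∀ (e : ℕ → ℕ → ℕ) (t : ℝ), 1 ≤ t →
    ∀ Q : Finset ℕ, (∀ p ∈ Q, p.Prime) → Bd F G e t q K Q := by
  obtain ⟨p0, K, hK, h⟩ := part1 q hq hq1
  set m : ℕ → ℝ := fun p => 1 + 6 * ((p:ℝ) ^ (-(1 - q)) / (1 - (p:ℝ) ^ (-(1 - q)))) with hm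
  have hm1 : ∀ p, p.Prime → 1 ≤ m p := by
    intro p hp
    have hp1 : (1:ℝ) < p := by exact_mod_cast hp.one_lt
    have hs1 : (p:ℝ) ^ (-(1 - q)) < 1 := Real.rpow_lt_one_of_one_lt_of_neg hp1 (by linarith)
    have hs0 : 0 < (p:ℝ) ^ (-(1 - q)) := by positivity
    have : 0 < 1 - (p:ℝ) ^ (-(1 - q)) := by linarith
    have : 0 ≤ 6 * ((p:ℝ) ^ (-(1 - q)) / (1 - (p:ℝ) ^ (-(1 - q)))) := by positivity
    simp only [hm]; linarith
  set S := (range (p0 + 1)).filter Nat.Prime with hS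
  refine ⟨K * ∏ p ∈ S, m p, mul_pos hK (prod_pos fun p hp =>
    lt_of_lt_of_le one_pos (hm1 p (mem_filter.1 hp).2)), ?_⟩
  intro F G hF hG e t ht Q hQ
  have key : ∀ R : Finset ℕ, (∀ p ∈ R, p.Prime ∧ p ≤ p0) →
      Bd F G e t q (K * ∏ p ∈ R, m p) (R ∪ Q.filter (fun p => p0 < p)) := by
    intro R
    induction R using Finset.induction_on with
    | empty =>
      intro _
      rw [prod_empty, mul_one, empty_union]
      exact h F G hF hG e t ht _ fun p hp => ⟨hQ p (mem_filter.1 hp).1, (mem_filter.1 hp).2⟩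
    | insert a R haR ih =>
      intro hR
      have h1 := ih fun p hp => hR p (mem_insert_of_mem hp)
      have hpr := hR a (mem_insert_self _ _)
      have hn : a ∉ R ∪ Q.filter (fun p => p0 < p) := by
        simp only [mem_union, mem_filter, not_or]
        refine ⟨haR, fun h => ?_⟩
        omega
      have hpos : 0 ≤ K * ∏ p ∈ R, m p := mul_nonneg hK.le (prod_nonneg fun p hp =>
        zero_le_one.trans (hm1 p (hR p (mem_insert_of_mem hp)).1))
      have h2 := small_step hF hG ht hq (by linarith) hpos hpr.1 hn h1
      rw [prod_insert haR, insert_union]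
      convert h2 using 1
      simp only [hm]; ring
  have h1 := key (Q.filter (fun p => p ≤ p0)) (fun p hp => ⟨hQ p (mem_filter.1 hp).1, (mem_filter.1 hp).2⟩)
  have hu : Q.filter (fun p => p ≤ p0) ∪ Q.filter (fun p => p0 < p) = Q := by
    ext p; simp only [mem_union, mem_filter]
    constructor
    · tauto
    · intro hp; rcases le_or_gt p p0 with h | h <;> tauto
  rw [hu] at h1
  refine h1.mono hF hG (mul_le_mul_of_nonneg_left ?_ hK.le)
  have hsub : Q.filter (fun p => p ≤ p0) ⊆ S := by
    intro p hp
    rw [mem_filter] at hp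
    exact mem_filter.2 ⟨mem_range.2 (by omega), hQ p hp.1⟩
  rw [← prod_sdiff hsub]
  have h3 : 1 ≤ ∏ p ∈ S \ Q.filter (fun p => p ≤ p0), m p := by
    have := Finset.prod_le_prod (s := S \ Q.filter (fun p => p ≤ p0)) (f := fun _ => (1:ℝ)) (g := m)
      (fun _ _ => zero_le_one) (fun p hp => hm1 p (mem_filter.1 (mem_sdiff.1 hp).1).2)
    simpa using this
  exact le_mul_of_one_le_left (prod_nonneg fun p hp =>
    zero_le_one.trans (hm1 p (hQ p (mem_filter.1 hp).1))) h3

end Helpers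

section Translation
open Finset

lemma prodQ {n : ℕ} (hn : n ≠ 0) {Q : Finset ℕ} (hQ : n.primeFactors ⊆ Q) {R : Type*} [CommMonoid R]
    (h : ℕ → ℕ → R) (h0 : ∀ p, h p 0 = 1) :
    ∏ p ∈ Q, h p (n.factorization p) = n.factorization.prod h := by
  rw [Finsupp.prod_of_support_subset n.factorization (s := Q) (by simpa using hQ) h
    (fun p _ => h0 p)]

lemma goodF_of {f : ℕ → ℝ} (h0 : ∀ n, 0 ≤ f n)
    (hf : ∀ n : ℕ, 1 ≤ n → ∑ d ∈ n.divisors, f d ≤ (n : ℝ)) :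
    GoodF (fun p i => f (p ^ i) / (p : ℝ) ^ i) := by
  refine ⟨fun p i => div_nonneg (h0 _) (by positivity), ?_⟩
  intro p k hp
  have h := hf (p ^ k) (Nat.one_le_pow _ _ hp.pos)
  rw [Nat.sum_divisors_prime_pow hp] at h
  push_cast at h
  refine le_trans (le_of_eq ?_) h
  apply sum_congr rfl
  intro i _
  have : (p:ℝ) ≠ 0 := by exact_mod_cast hp.ne_zero
  field_simp

lemma mu_eq {f ψ : ℕ → ℝ} (f1 : f 1 = 1)
    (hm : ∀ a b : ℕ, Nat.Coprime a b → f (a * b) = f a * f b) {v : ℕ} (hv : v ≠ 0)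
    {Q : Finset ℕ} (hQ : v.primeFactors ⊆ Q) :
    mu ψ f v = mm (fun p i => f (p ^ i) / (p : ℝ) ^ i) (fun n => n.factorization) Q ψ v := by
  unfold mu mm
  rw [prod_div_distrib, prodQ hv hQ (fun p i => f (p ^ i)) (by simp [f1]),
    ← Nat.multiplicative_factorization f hm f1 hv]
  have h2 : ∏ p ∈ Q, (p:ℝ) ^ (v.factorization p) = v := by
    have h3 := prodQ hv hQ (fun p i => p ^ i) (by simp)
    have h4 : v.factorization.prod (fun p i => p ^ i) = v := Nat.prod_factorization_pow_eq_self hv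
    rw [h4] at h3
    exact_mod_cast h3
  rw [h2]; ring

lemma quot_eq {v w : ℕ} (hv : v ≠ 0) (hw : w ≠ 0) {Q : Finset ℕ} (hQ : w.primeFactors ⊆ Q) :
    (w : ℝ) / (Nat.gcd v w : ℝ) = ∏ p ∈ Q, (p:ℝ) ^ (w.factorization p - v.factorization p) := by
  have hg : Nat.gcd v w ≠ 0 := Nat.gcd_ne_zero_left hv
  have hd : Nat.gcd v w ∣ w := Nat.gcd_dvd_right _ _
  have hq : w / Nat.gcd v w ≠ 0 := (Nat.div_pos (Nat.le_of_dvd (Nat.pos_of_ne_zero hw) hd)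
    (Nat.pos_of_ne_zero hg)).ne'
  have hsub : (w / Nat.gcd v w).primeFactors ⊆ Q :=
    (Nat.primeFactors_mono (Nat.div_dvd_of_dvd hd) hw).trans hQ
  have h3 := prodQ hq hsub (fun p i => p ^ i) (by simp)
  have h4 : (w / Nat.gcd v w).factorization.prod (fun p i => p ^ i) = w / Nat.gcd v w :=
    Nat.prod_factorization_pow_eq_self hq
  rw [h4] at h3
  have h5 : (w : ℝ) / (Nat.gcd v w : ℝ) = ((w / Nat.gcd v w : ℕ) : ℝ) := by
    rw [Nat.cast_div hd (by exact_mod_cast hg)]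
  rw [h5, ← h3]
  push_cast
  apply prod_congr rfl
  intro p _
  congr 1
  rw [Nat.factorization_div hd, Nat.factorization_gcd hv hw]
  simp only [Finsupp.coe_tsub, Pi.sub_apply, Finsupp.inf_apply]
  omega

lemma primeSum_eq {v w : ℕ} (hv : v ≠ 0) (hw : w ≠ 0) {Q : Finset ℕ} (hQ : ∀ p ∈ Q, p.Prime)
    (hQv : v.primeFactors ⊆ Q) (hQw : w.primeFactors ⊆ Q) (t : ℝ) :
    primeSum t (v * w / Nat.gcd v w ^ 2) = ∑ p ∈ Q,
      if v.factorization p ≠ w.factorization p ∧ t ≤ (p : ℝ) then 1 / (p : ℝ) else 0 := by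
  have hg : Nat.gcd v w ≠ 0 := Nat.gcd_ne_zero_left hv
  have hd : Nat.gcd v w ^ 2 ∣ v * w := by
    rw [sq]; exact Nat.mul_dvd_mul (Nat.gcd_dvd_left _ _) (Nat.gcd_dvd_right _ _)
  have hfac : ∀ p, (v * w / Nat.gcd v w ^ 2).factorization p =
      v.factorization p + w.factorization p - 2 * min (v.factorization p) (w.factorization p) := by
    intro p
    rw [Nat.factorization_div hd, Nat.factorization_mul hv hw, Nat.factorization_pow,
      Nat.factorization_gcd hv hw]
    simp
  have hset : (v * w / Nat.gcd v w ^ 2).primeFactors =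
      Q.filter (fun p => v.factorization p ≠ w.factorization p) := by
    ext p
    rw [← Nat.support_factorization, Finsupp.mem_support_iff, hfac, mem_filter]
    constructor
    · intro h
      have hne : v.factorization p ≠ w.factorization p := by omega
      refine ⟨?_, hne⟩
      by_cases h1 : v.factorization p = 0
      · apply hQw
        rw [← Nat.support_factorization, Finsupp.mem_support_iff]; omega
      · apply hQv
        rw [← Nat.support_factorization, Finsupp.mem_support_iff]; omega
    · rintro ⟨_, h⟩; omega
  unfold primeSum
  rw [hset, sum_filter]
  apply sum_congr rfl
  intro p _
  by_cases h1 : v.factorization p = w.factorization p <;>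
    by_cases h2 : t ≤ (p:ℝ) <;> simp [h1, h2, Set.indicator]

end Translation

/-- **Main technical result**: for `ε ∈ (0, 2/5]` there is `K_ε > 0` such that
for finitely supported `ψ, θ : ℕ → ℝ≥0`, multiplicative `f, g` with
`(1⋆f)(n) ≤ n`, `(1⋆g)(n) ≤ n`, any `t ≥ 1`, `C ∈ ℝ` and
`ℰ ⊆ ℰ_{ψ,θ}^{t,C}`, one has
`μ_{ψ,θ}^{f,g}(ℰ) ≤ K_ε (μ_ψ^f(supp ψ) μ_θ^g(supp θ) e^{-Ct})^{1/2+ε}`. -/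
theorem main_technical_result (ε : ℝ) (hε : ε ∈ Set.Ioc (0:ℝ) (2/5)) :
    ∃ K : ℝ, 0 < K ∧
      ∀ (ψ θ f g : ℕ → ℝ) (t C : ℝ) (ℰ : Finset (ℕ × ℕ)),
        (∀ n, 0 ≤ ψ n) → (∀ n, 0 ≤ θ n) →
        ψ 0 = 0 → θ 0 = 0 →
        (Function.support ψ).Finite → (Function.support θ).Finite →
        (∀ n, 0 ≤ f n) → (∀ n, 0 ≤ g n) →
        f 1 = 1 → g 1 = 1 →
        (∀ a b : ℕ, Nat.Coprime a b → f (a * b) = f a * f b) →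
        (∀ a b : ℕ, Nat.Coprime a b → g (a * b) = g a * g b) →
        (∀ n : ℕ, 1 ≤ n → ∑ d ∈ n.divisors, f d ≤ (n : ℝ)) →
        (∀ n : ℕ, 1 ≤ n → ∑ d ∈ n.divisors, g d ≤ (n : ℝ)) →
        1 ≤ t →
        (↑ℰ : Set (ℕ × ℕ)) ⊆ Eset ψ θ t C →
        ∑ vw ∈ ℰ, mu ψ f vw.1 * mu θ g vw.2 ≤
          K * ((∑' v : ℕ, mu ψ f v) * (∑' w : ℕ, mu θ g w) *
            Real.exp (-(C * t))) ^ ((1:ℝ)/2 + ε) := by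
  obtain ⟨K, hK, h⟩ := part2 (1 / 2 + ε) (by linarith [hε.1]) (by linarith [hε.2])
  refine ⟨K, hK, ?_⟩
  intro ψ θ f g t C E hψ hθ hψ0 hθ0 hsψ hsθ hf hg f1 g1 fm gm fs gs ht hE
  set V := hsψ.toFinset with hV
  set W := hsθ.toFinset with hW
  have hVm : ∀ v, v ∈ V ↔ ψ v ≠ 0 := fun v => by simp [hV]
  have hWm : ∀ v, v ∈ W ↔ θ v ≠ 0 := fun v => by simp [hW]
  have hV0 : ∀ v ∈ V, v ≠ 0 := by
    rintro v hv rfl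
    exact (hVm _).1 hv hψ0
  have hW0 : ∀ v ∈ W, v ≠ 0 := by
    rintro v hv rfl
    exact (hWm _).1 hv hθ0
  set Q : Finset ℕ := (V ∪ W).biUnion Nat.primeFactors with hQd
  have hQp : ∀ p ∈ Q, p.Prime := by
    intro p hp
    obtain ⟨v, _, h1⟩ := Finset.mem_biUnion.1 hp
    exact Nat.prime_of_mem_primeFactors h1
  have hQV : ∀ v ∈ V, v.primeFactors ⊆ Q := fun v hv =>
    Finset.subset_biUnion_of_mem Nat.primeFactors (Finset.mem_union_left _ hv)
  have hQW : ∀ v ∈ W, v.primeFactors ⊆ Q := fun v hv =>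
    Finset.subset_biUnion_of_mem Nat.primeFactors (Finset.mem_union_right _ hv)
  have hEm : ∀ z ∈ E, z.1 ∈ V ∧ z.2 ∈ W ∧ Dpair ψ θ z.1 z.2 ≤ 1 ∧
      C ≤ primeSum t (z.1 * z.2 / Nat.gcd z.1 z.2 ^ 2) := by
    intro z hz
    have h1 : z ∈ Eset ψ θ t C := hE hz
    exact ⟨(hVm _).2 h1.1, (hWm _).2 h1.2.1, h1.2.2.1, h1.2.2.2⟩
  have hinj : ∀ v w : ℕ, v ≠ 0 → w ≠ 0 → v.primeFactors ⊆ Q → w.primeFactors ⊆ Q →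
      (∀ p ∈ Q, v.factorization p = w.factorization p) → v = w := by
    intro v w hv hw h1 h2 h3
    apply Nat.eq_of_factorization_eq hv hw
    intro p
    by_cases hp : p ∈ Q
    · exact h3 p hp
    · have e1 : v.factorization p = 0 := by
        by_contra hc
        exact hp (h1 (by rw [← Nat.support_factorization, Finsupp.mem_support_iff]; exact hc))
      have e2 : w.factorization p = 0 := by
        by_contra hc
        exact hp (h2 (by rw [← Nat.support_factorization, Finsupp.mem_support_iff]; exact hc))
      rw [e1, e2]
  have hDat : Dat (fun n => n.factorization) t Q ψ θ V W E C := by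
    refine ⟨hψ, hθ, ?_, ?_, ?_, ?_, ?_, ?_⟩
    · intro z hz
      have h1 := hEm z hz
      exact Finset.mem_product.2 ⟨h1.1, h1.2.1⟩
    · intro v hv w hw h1
      exact hinj v w (hV0 v hv) (hV0 w hw) (hQV v hv) (hQV w hw) h1
    · intro v hv w hw h1
      exact hinj v w (hW0 v hv) (hW0 w hw) (hQW v hv) (hQW w hw) h1
    · intro z hz
      obtain ⟨h1, h2, h3, _⟩ := hEm z hz
      rw [← quot_eq (hV0 _ h1) (hW0 _ h2) (hQW _ h2)]
      refine le_trans ?_ h3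
      unfold Dpair
      rw [mul_div_assoc', mul_comm (ψ z.1)]
      gcongr
      exact le_max_left _ _
    · intro z hz
      obtain ⟨h1, h2, h3, _⟩ := hEm z hz
      rw [← quot_eq (hW0 _ h2) (hV0 _ h1) (hQV _ h1), Nat.gcd_comm]
      refine le_trans ?_ h3
      unfold Dpair
      rw [mul_div_assoc', mul_comm (θ z.2)]
      gcongr
      exact le_max_right _ _
    · intro z hz
      obtain ⟨h1, h2, _, h3⟩ := hEm z hz
      rw [primeSum_eq (hV0 _ h1) (hW0 _ h2) hQp (hQV _ h1) (hQW _ h2)] at h3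
      exact h3
  have key := h _ _ (goodF_of hf fs) (goodF_of hg gs) (fun n => n.factorization) t ht Q hQp
    ψ θ V W E C hDat
  have hsumV : ∑' v : ℕ, mu ψ f v = ∑ v ∈ V,
      mm (fun p i => f (p ^ i) / (p : ℝ) ^ i) (fun n => n.factorization) Q ψ v := by
    rw [tsum_eq_sum (s := V)]
    · exact Finset.sum_congr rfl fun v hv => mu_eq f1 fm (hV0 v hv) (hQV v hv)
    · intro v hv
      have : ψ v = 0 := by
        by_contra hc; exact hv ((hVm v).2 hc)
      simp [mu, this]
  have hsumW : ∑' v : ℕ, mu θ g v = ∑ v ∈ W,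
      mm (fun p i => g (p ^ i) / (p : ℝ) ^ i) (fun n => n.factorization) Q θ v := by
    rw [tsum_eq_sum (s := W)]
    · exact Finset.sum_congr rfl fun v hv => mu_eq g1 gm (hW0 v hv) (hQW v hv)
    · intro v hv
      have : θ v = 0 := by
        by_contra hc; exact hv ((hWm v).2 hc)
      simp [mu, this]
  rw [hsumV, hsumW]
  refine le_trans (le_of_eq ?_) key
  apply Finset.sum_congr rfl
  intro z hz
  obtain ⟨h1, h2, _, _⟩ := hEm z hz
  rw [mu_eq f1 fm (hV0 _ h1) (hQV _ h1), mu_eq g1 gm (hW0 _ h2) (hQW _ h2)]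
end

section
/- Let q > 2 and let q′ be the conjugate index to q (i.e. 1/q + 1/q′ = 1). Let c₁ ≤ 1, 0 < c₂ < 1, λ ∈ (0, 1−c₂], and C₃ > 0. Let m be a finitely-supported probability measure on ℤ², and suppose there exist sequences (x_i)_{i∈ℤ} and (y_j)_{j∈ℤ} of non-negative reals with ‖x‖_{ℓ^{q′}(ℤ)} = ‖y‖_{ℓ^{q′}(ℤ)} = 1 such that for all (i,j) ∈ ℤ²: m(i,j) ≤ c₁·x_i·y_j if i = j, and m(i,j) ≤ c₁·C₃·λ^{|i−j|}·x_i·y_j if i ≠ j. Then c₁ ≥ c₂/(1 + (2C₃ − 1)λ), and there exists k ∈ ℤ such that ∑_{(i,j): |i−k|+|j−k| ≥ 2} m(i,j) ≪_{q,c₂,C₃} (λ^q)^{2/q′} + (λ^q)^{1+1/q}. -/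
open Finset in
lemma geo_half (lam : ℝ) (h0 : 0 < lam) (h1 : lam < 1) (n : ℕ) (T : Finset ℤ) (k : ℤ)
    (hT : ∀ j ∈ T, n ≤ (j - k).natAbs)
    (hinj : ∀ i ∈ T, ∀ j ∈ T, (i - k).natAbs = (j - k).natAbs → i = j) :
    ∑ j ∈ T, lam ^ (j - k).natAbs ≤ lam ^ n / (1 - lam) := by
  have e : ∑ j ∈ T, lam ^ (j - k).natAbs = lam ^ n * ∑ j ∈ T, lam ^ ((j - k).natAbs - n) := by
    rw [mul_sum]
    refine sum_congr rfl fun j hj => ?_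
    rw [← pow_add]
    congr 1
    have := hT j hj
    omega
  rw [e, div_eq_mul_inv]
  refine mul_le_mul_of_nonneg_left ?_ (by positivity)
  rw [← sum_image (f := fun d : ℕ => lam ^ d) (g := fun j : ℤ => (j - k).natAbs - n) (s := T)]
  · rw [← tsum_geometric_of_lt_one h0.le h1]
    exact (summable_geometric_of_lt_one h0.le h1).sum_le_tsum _ (fun _ _ => by positivity)
  · intro i hi j hj h
    have h1 := hT i hi
    have h2 := hT j hj
    apply hinj i hi j hj
    simp only at h
    omega

open Finset in
lemma geo_full (lam : ℝ) (h0 : 0 < lam) (h1 : lam < 1) (n : ℕ) (T : Finset ℤ) (k : ℤ)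
    (hT : ∀ j ∈ T, n ≤ (j - k).natAbs) :
    ∑ j ∈ T, lam ^ (j - k).natAbs ≤ 2 * lam ^ n / (1 - lam) := by
  rw [← sum_filter_add_sum_filter_not T (fun j => k ≤ j)]
  have a := geo_half lam h0 h1 n (T.filter (fun j => k ≤ j)) k
    (fun j hj => hT j (mem_filter.1 hj).1)
    (fun i hi j hj h => by
      have h1 := (mem_filter.1 hi).2
      have h2 := (mem_filter.1 hj).2
      omega)
  have b := geo_half lam h0 h1 n (T.filter (fun j => ¬ k ≤ j)) k
    (fun j hj => hT j (mem_filter.1 hj).1)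
    (fun i hi j hj h => by
      have h1 := (mem_filter.1 hi).2
      have h2 := (mem_filter.1 hj).2
      omega)
  have : 2 * lam ^ n / (1 - lam) = lam ^ n / (1 - lam) + lam ^ n / (1 - lam) := by ring
  linarith

open Finset in
lemma geo_ite (lam : ℝ) (h0 : 0 < lam) (h1 : lam < 1) (T : Finset ℤ) (k : ℤ) :
    ∑ j ∈ T, (if k = j then 0 else lam ^ (k - j).natAbs) ≤ 2 * lam / (1 - lam) := by
  have := geo_full lam h0 h1 1 (T.filter (fun j => ¬ k = j)) k
    (fun j hj => by have := (mem_filter.1 hj).2; omega)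
  rw [pow_one] at this
  refine le_trans (le_of_eq ?_) this
  rw [sum_filter]
  refine sum_congr rfl fun j hj => ?_
  by_cases h : k = j
  · simp [h]
  · simp only [h, if_false, not_false_eq_true, if_true]
    congr 1; omega

open Finset in
lemma schur (lam : ℝ) (h0 : 0 < lam) (h1 : lam < 1) (T : Finset ℤ) (u v : ℤ → ℝ) :
    ∑ i ∈ T, ∑ j ∈ T, (if i = j then 0 else lam ^ (i - j).natAbs) * (u i * v j) ≤
      2 * lam / (1 - lam) * ((∑ i ∈ T, u i ^ 2 + ∑ j ∈ T, v j ^ 2) / 2) := by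
  have nn : ∀ i j : ℤ, 0 ≤ (if i = j then 0 else lam ^ (i - j).natAbs) := by
    intro i j; split_ifs <;> positivity
  have A : ∑ i ∈ T, ∑ j ∈ T, (if i = j then 0 else lam ^ (i - j).natAbs) * (u i * v j) ≤
      ∑ i ∈ T, ∑ j ∈ T, ((if i = j then 0 else lam ^ (i - j).natAbs) * (u i ^ 2 / 2)
        + (if i = j then 0 else lam ^ (i - j).natAbs) * (v j ^ 2 / 2)) := by
    refine sum_le_sum fun i _ => sum_le_sum fun j _ => ?_
    rw [← mul_add]
    exact mul_le_mul_of_nonneg_left (by nlinarith [sq_nonneg (u i - v j)]) (nn i j)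
  refine A.trans ?_
  simp only [sum_add_distrib]
  have B : ∑ i ∈ T, ∑ j ∈ T, (if i = j then 0 else lam ^ (i - j).natAbs) * (u i ^ 2 / 2) ≤
      ∑ i ∈ T, 2 * lam / (1 - lam) * (u i ^ 2 / 2) := by
    refine sum_le_sum fun i _ => ?_
    rw [← sum_mul]
    exact mul_le_mul_of_nonneg_right (geo_ite lam h0 h1 T i) (by positivity)
  have C : ∑ i ∈ T, ∑ j ∈ T, (if i = j then 0 else lam ^ (i - j).natAbs) * (v j ^ 2 / 2) ≤
      ∑ j ∈ T, 2 * lam / (1 - lam) * (v j ^ 2 / 2) := by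
    rw [sum_comm]
    refine sum_le_sum fun i _ => ?_
    rw [← sum_mul]
    refine mul_le_mul_of_nonneg_right (le_trans (le_of_eq ?_) (geo_ite lam h0 h1 T i)) (by positivity)
    refine sum_congr rfl fun j _ => ?_
    by_cases h : i = j
    · simp [h]
    · rw [if_neg h, if_neg (Ne.symm h)]
      congr 1; omega
  rw [← mul_sum, ← sum_div] at B C
  linarith

open Finset in
/-- bound of the mass in a box, diagonal term kept separate -/
lemma box_bound (lam c₁ C₃ : ℝ) (h0 : 0 < lam) (h1 : lam < 1) (hc : 0 ≤ c₁) (hC : 0 < C₃)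
    (m : ℤ × ℤ → ℝ) (x y : ℤ → ℝ)
    (H : ∀ i j : ℤ, (i = j → m (i, j) ≤ c₁ * x i * y j) ∧
          (i ≠ j → m (i, j) ≤ c₁ * C₃ * lam ^ (i - j).natAbs * x i * y j)) (T : Finset ℤ) :
    ∑ i ∈ T, ∑ j ∈ T, m (i, j) ≤ c₁ * (∑ i ∈ T, x i * y i +
      C₃ * (2 * lam / (1 - lam) * ((∑ i ∈ T, x i ^ 2 + ∑ j ∈ T, y j ^ 2) / 2))) := by
  have A : ∑ i ∈ T, ∑ j ∈ T, m (i, j) ≤ ∑ i ∈ T, ∑ j ∈ T, c₁ * ((if i = j then x i * y j else 0)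
      + C₃ * ((if i = j then 0 else lam ^ (i - j).natAbs) * (x i * y j))) := by
    refine sum_le_sum fun i _ => sum_le_sum fun j _ => ?_
    by_cases h : i = j
    · have := (H i j).1 h
      simp only [h, if_true] at this ⊢
      linarith
    · have := (H i j).2 h
      simp only [h, if_false] at this ⊢
      linarith
  refine A.trans ?_
  simp only [← mul_sum, sum_add_distrib]
  refine mul_le_mul_of_nonneg_left ?_ hc
  refine add_le_add (le_of_eq ?_) (mul_le_mul_of_nonneg_left (schur lam h0 h1 T x y) hC.le)
  refine sum_congr rfl fun i hi => ?_
  simp [hi]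

lemma sqb (a α r : ℝ) (ha : 0 ≤ a) (h : a ≤ α) (hr : 1/2 < r) :
    (a ^ r) ^ 2 ≤ a * α ^ (2 * r - 1) := by
  have : (a ^ r) ^ 2 = a * a ^ (2 * r - 1) := by
    rw [← Real.rpow_natCast, ← Real.rpow_mul ha]
    conv_rhs => rw [← Real.rpow_one a, ← Real.rpow_mul ha]
    rw [← Real.rpow_add_of_nonneg ha (by norm_num) (by linarith)]
    congr 1; push_cast; ring
  rw [this]
  exact mul_le_mul_of_nonneg_left (Real.rpow_le_rpow ha h (by linarith)) ha

open Finset in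
lemma sum_sq_bound (a : ℤ → ℝ) (r α : ℝ) (hr : 1/2 < r) (ha : ∀ i, 0 ≤ a i) (T : Finset ℤ)
    (hT : ∑ i ∈ T, a i ≤ α) : ∑ i ∈ T, (a i ^ r) ^ 2 ≤ α * α ^ (2 * r - 1) := by
  have h0 : 0 ≤ α := (sum_nonneg fun i _ => ha i).trans hT
  calc ∑ i ∈ T, (a i ^ r) ^ 2 ≤ ∑ i ∈ T, a i * α ^ (2 * r - 1) := by
        refine sum_le_sum fun i hi => sqb _ _ _ (ha i) ?_ hr
        exact (single_le_sum (fun j _ => ha j) hi).trans hT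
    _ = (∑ i ∈ T, a i) * α ^ (2 * r - 1) := by rw [sum_mul]
    _ ≤ _ := mul_le_mul_of_nonneg_right hT (by positivity)

lemma prodb (a b P r : ℝ) (ha : 0 ≤ a) (hb : 0 ≤ b) (h : a * b ≤ P) (hr : 1/2 < r) :
    a ^ r * b ^ r ≤ (a + b) / 2 * P ^ (r - 1/2) := by
  have hab := mul_nonneg ha hb
  rw [← Real.mul_rpow ha hb]
  have : (a * b) ^ r = (a * b) ^ (1/2 : ℝ) * (a * b) ^ (r - 1/2) := by
    rw [← Real.rpow_add_of_nonneg hab (by norm_num) (by linarith)]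
    congr 1; ring
  rw [this]
  refine mul_le_mul ?_ (Real.rpow_le_rpow hab h (by linarith)) (by positivity) (by positivity)
  rw [← Real.sqrt_eq_rpow]
  apply Real.sqrt_le_iff.2
  constructor
  · positivity
  · nlinarith [sq_nonneg (a - b)]

open Finset in
/-- sums over the row through `k` -/
lemma row_bound (lam c₁ C₃ E : ℝ) (h0 : 0 < lam) (h1 : lam < 1) (hc : 0 ≤ c₁) (hc1 : c₁ ≤ 1)
    (hC : 0 < C₃) (f : ℤ → ℝ) (z : ℤ → ℝ) (w : ℝ) (k : ℤ) (n : ℕ) (T : Finset ℤ)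
    (hE : 0 ≤ E) (hz0 : ∀ j, 0 ≤ z j) (hw : 0 ≤ w) (hw1 : w ≤ 1)
    (hz : ∀ j ∈ T, z j ≤ E) (hT : ∀ j ∈ T, n ≤ (j - k).natAbs)
    (H : ∀ j ∈ T, f j ≤ c₁ * C₃ * lam ^ (j - k).natAbs * w * z j) :
    ∑ j ∈ T, f j ≤ C₃ * (2 * lam ^ n / (1 - lam)) * E := by
  calc ∑ j ∈ T, f j ≤ ∑ j ∈ T, C₃ * lam ^ (j - k).natAbs * E := by
        refine sum_le_sum fun j hj => (H j hj).trans ?_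
        have e1 : w * z j ≤ 1 * E := mul_le_mul hw1 (hz j hj) (hz0 j) zero_le_one
        have e2 : c₁ * (w * z j) ≤ 1 * (1 * E) := mul_le_mul hc1 e1 (mul_nonneg hw (hz0 j)) zero_le_one
        have e3 : 0 ≤ C₃ * lam ^ (j - k).natAbs := by positivity
        nlinarith [mul_le_mul_of_nonneg_left e2 e3]
    _ = C₃ * (∑ j ∈ T, lam ^ (j - k).natAbs) * E := by rw [mul_sum, sum_mul]
    _ ≤ _ := mul_le_mul_of_nonneg_right
        (mul_le_mul_of_nonneg_left (geo_full lam h0 h1 n T k hT) hC.le) hE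

open Finset in
lemma box_split (m : ℤ × ℤ → ℝ) (T : Finset ℤ) (k : ℤ) (hk : k ∈ T) :
    ∑ i ∈ T, ∑ j ∈ T, m (i, j) = m (k, k) + ∑ j ∈ T.erase k, m (k, j) + ∑ i ∈ T.erase k, m (i, k)
      + ∑ i ∈ T.erase k, ∑ j ∈ T.erase k, m (i, j) := by
  rw [← add_sum_erase T _ hk, ← add_sum_erase T (fun j => m (k, j)) hk]
  have : ∀ i, ∑ j ∈ T, m (i, j) = m (i, k) + ∑ j ∈ T.erase k, m (i, j) := fun i =>
    (add_sum_erase T (fun j => m (i, j)) hk).symm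
  simp only [this, sum_add_distrib]
  ring

open Finset in
lemma core (lam c₁ C₃ r δ : ℝ) (h0 : 0 < lam) (h1 : lam < 1) (hc : 0 ≤ c₁) (hc1 : c₁ ≤ 1)
    (hC : 0 < C₃) (hr : 1/2 < r) (hδ0 : 0 < δ) (hδ1 : δ < 1)
    (hδ : (2 * δ) ^ (2 * r - 1) ≤ 1/8)
    (hL : C₃ * (2 * lam / (1 - lam)) ≤ 1 - (1 - δ) ^ (r - 1/2))
    (m : ℤ × ℤ → ℝ) (hm : ∀ p, 0 ≤ m p) (x y a b : ℤ → ℝ) (ha : ∀ i, 0 ≤ a i) (hb : ∀ i, 0 ≤ b i)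
    (hx : ∀ i, x i = a i ^ r) (hy : ∀ i, y i = b i ^ r)
    (H : ∀ i j : ℤ, (i = j → m (i, j) ≤ c₁ * x i * y j) ∧
          (i ≠ j → m (i, j) ≤ c₁ * C₃ * lam ^ (i - j).natAbs * x i * y j)) (T : Finset ℤ)
    (haT : ∑ i ∈ T, a i ≤ 1) (hbT : ∑ i ∈ T, b i ≤ 1) (hmT : ∑ i ∈ T, ∑ j ∈ T, m (i, j) = 1) :
    ∃ k : ℤ, ∃ ε : ℝ, 0 ≤ ε ∧ ε ≤ 8 * (C₃ * (2 * lam / (1 - lam))) * ε ^ r ∧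
      ∑ i ∈ T, ∑ j ∈ T, Set.indicator {p : ℤ × ℤ | 2 ≤ |p.1 - k| + |p.2 - k|} m (i, j) ≤
        2 * (ε * ε ^ (2 * r - 1)) + 2 * (C₃ * (2 * lam ^ 2 / (1 - lam)) * ε ^ r) := by
  have h1' : 0 < 1 - lam := by linarith
  set L := C₃ * (2 * lam / (1 - lam)) with hLdef
  have hL0 : 0 ≤ L := by positivity
  have hp0 : 0 < (1 - δ) ^ (r - 1/2) := Real.rpow_pos_of_pos (by linarith) _
  have hL1 : L ≤ 1 := by linarith
  have hx0 : ∀ i, 0 ≤ x i := fun i => by rw [hx]; exact Real.rpow_nonneg (ha i) _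
  have hy0 : ∀ i, 0 ≤ y i := fun i => by rw [hy]; exact Real.rpow_nonneg (hb i) _
  have hne : T.Nonempty := by
    rw [nonempty_iff_ne_empty]; rintro rfl; simp at hmT
  obtain ⟨k, hk, hmax⟩ := exists_max_image T (fun i => a i * b i) hne
  have sx := sum_sq_bound a r 1 hr ha T haT
  have sy := sum_sq_bound b r 1 hr hb T hbT
  simp only [← hx, ← hy, Real.one_rpow, mul_one] at sx sy
  have hak1 : a k ≤ 1 := (single_le_sum (fun j _ => ha j) hk).trans haT
  have hbk1 : b k ≤ 1 := (single_le_sum (fun j _ => hb j) hk).trans hbT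
  -- locate the mass
  have hP : 1 - δ ≤ a k * b k := by
    by_contra hcon
    push Not at hcon
    have hPn : 0 ≤ a k * b k := mul_nonneg (ha k) (hb k)
    have lt := Real.rpow_lt_rpow hPn hcon (z := r - 1/2) (by linarith)
    have B := box_bound lam c₁ C₃ h0 h1 hc hC m x y H T
    have D : ∑ i ∈ T, x i * y i ≤ (a k * b k) ^ (r - 1/2) := by
      calc ∑ i ∈ T, x i * y i ≤ ∑ i ∈ T, (a i + b i) / 2 * (a k * b k) ^ (r - 1/2) := by
            refine sum_le_sum fun i hi => ?_
            rw [hx, hy]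
            exact prodb _ _ _ _ (ha i) (hb i) (hmax i hi) hr
        _ = (∑ i ∈ T, a i + ∑ i ∈ T, b i) / 2 * (a k * b k) ^ (r - 1/2) := by
            rw [← sum_mul, ← sum_div, sum_add_distrib]
        _ ≤ 1 * (a k * b k) ^ (r - 1/2) :=
            mul_le_mul_of_nonneg_right (by linarith) (Real.rpow_nonneg hPn _)
        _ = _ := one_mul _
    have F : L * ((∑ i ∈ T, x i ^ 2 + ∑ j ∈ T, y j ^ 2) / 2) ≤ L * 1 :=
      mul_le_mul_of_nonneg_left (by linarith) hL0
    rw [hmT, ← mul_assoc, ← hLdef] at B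
    have G0 : 0 ≤ ∑ i ∈ T, x i * y i + L * ((∑ i ∈ T, x i ^ 2 + ∑ j ∈ T, y j ^ 2) / 2) :=
      add_nonneg (sum_nonneg fun i _ => mul_nonneg (hx0 i) (hy0 i))
        (mul_nonneg hL0 (by positivity))
    have := mul_le_mul_of_nonneg_right hc1 G0
    linarith
  have hakδ : 1 - δ ≤ a k := hP.trans (mul_le_of_le_one_right (ha k) hbk1)
  have hbkδ : 1 - δ ≤ b k := hP.trans (mul_le_of_le_one_left (hb k) hak1)
  set ε := (1 - a k) + (1 - b k) with hε
  have hε0 : 0 ≤ ε := by linarith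
  have hεδ : ε ≤ 2 * δ := by linarith
  have hεs : ε ^ (2 * r - 1) ≤ 1/8 := (Real.rpow_le_rpow hε0 hεδ (by linarith)).trans hδ
  have haE : ∑ i ∈ T.erase k, a i ≤ ε := by
    have := add_sum_erase T a hk; linarith
  have hbE : ∑ i ∈ T.erase k, b i ≤ ε := by
    have := add_sum_erase T b hk; linarith
  have sxE := sum_sq_bound a r ε hr ha _ haE
  have syE := sum_sq_bound b r ε hr hb _ hbE
  simp only [← hx, ← hy] at sxE syE
  have hxE : ∀ i ∈ T.erase k, x i ≤ ε ^ r := fun i hi => by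
    rw [hx]
    exact Real.rpow_le_rpow (ha i) ((single_le_sum (fun j _ => ha j) hi).trans haE) (by linarith)
  have hyE : ∀ i ∈ T.erase k, y i ≤ ε ^ r := fun i hi => by
    rw [hy]
    exact Real.rpow_le_rpow (hb i) ((single_le_sum (fun j _ => hb j) hi).trans hbE) (by linarith)
  have hxk : x k ≤ 1 := by rw [hx]; exact Real.rpow_le_one (ha k) hak1 (by linarith)
  have hyk : y k ≤ 1 := by rw [hy]; exact Real.rpow_le_one (hb k) hbk1 (by linarith)
  have hεr : 0 ≤ ε ^ r := Real.rpow_nonneg hε0 _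
  have hεε : 0 ≤ ε * ε ^ (2 * r - 1) := mul_nonneg hε0 (Real.rpow_nonneg hε0 _)
  -- rest of the box
  have R : ∑ i ∈ T.erase k, ∑ j ∈ T.erase k, m (i, j) ≤ 2 * (ε * ε ^ (2 * r - 1)) := by
    have B := box_bound lam c₁ C₃ h0 h1 hc hC m x y H (T.erase k)
    rw [← mul_assoc C₃, ← hLdef] at B
    set Q := (∑ i ∈ T.erase k, x i ^ 2 + ∑ j ∈ T.erase k, y j ^ 2) / 2 with hQ
    have hQ0 : 0 ≤ Q := by positivity
    have D : ∑ i ∈ T.erase k, x i * y i ≤ Q := by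
      rw [hQ, ← sum_add_distrib, sum_div]
      exact sum_le_sum fun i _ => by nlinarith [sq_nonneg (x i - y i)]
    have D0 : 0 ≤ ∑ i ∈ T.erase k, x i * y i := sum_nonneg fun i _ => mul_nonneg (hx0 i) (hy0 i)
    have F : L * Q ≤ 1 * Q := mul_le_mul_of_nonneg_right hL1 hQ0
    have G := mul_le_mul_of_nonneg_right hc1 (add_nonneg D0 (mul_nonneg hL0 hQ0))
    linarith
  have Hrow : ∀ j, k ≠ j → m (k, j) ≤ c₁ * C₃ * lam ^ (j - k).natAbs * x k * y j := by
    intro j hj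
    have := (H k j).2 hj
    rwa [show (k - j).natAbs = (j - k).natAbs by omega] at this
  have Hcol : ∀ i, i ≠ k → m (i, k) ≤ c₁ * C₃ * lam ^ (i - k).natAbs * y k * x i := by
    intro i hi
    have := (H i k).2 hi
    linarith
  refine ⟨k, ε, hε0, ?_, ?_⟩
  · have S := box_split m T k hk
    rw [hmT] at S
    have r1 := row_bound lam c₁ C₃ (ε ^ r) h0 h1 hc hc1 hC (fun j => m (k, j)) y (x k) k 1 (T.erase k)
      hεr hy0 (hx0 k) hxk hyE (fun j hj => by have := ne_of_mem_erase hj; omega)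
      (fun j hj => Hrow j (ne_of_mem_erase hj).symm)
    have r2 := row_bound lam c₁ C₃ (ε ^ r) h0 h1 hc hc1 hC (fun i => m (i, k)) x (y k) k 1 (T.erase k)
      hεr hx0 (hy0 k) hyk hxE (fun j hj => by have := ne_of_mem_erase hj; omega)
      (fun j hj => Hcol j (ne_of_mem_erase hj))
    rw [pow_one, ← hLdef] at r1 r2
    have d : m (k, k) ≤ 1 - ε / 2 := by
      have d1 := (H k k).1 rfl
      have d2 := prodb (a k) (b k) 1 r (ha k) (hb k) (mul_le_one₀ hak1 (hb k) hbk1) hr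
      rw [← hx, ← hy, Real.one_rpow, mul_one] at d2
      have d3 := mul_le_mul_of_nonneg_right hc1 (mul_nonneg (hx0 k) (hy0 k))
      linarith
    have e : ε * ε ^ (2 * r - 1) ≤ ε * (1/8) := mul_le_mul_of_nonneg_left hεs hε0
    linarith
  · rw [box_split _ T k hk]
    set A : Set (ℤ × ℤ) := {p : ℤ × ℤ | 2 ≤ |p.1 - k| + |p.2 - k|} with hA
    have i0 : A.indicator m (k, k) = 0 := by simp [hA]
    have i1 : ∑ j ∈ T.erase k, A.indicator m (k, j) =
        ∑ j ∈ (T.erase k).filter (fun j => 2 ≤ (j - k).natAbs), m (k, j) := by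
      rw [sum_filter]
      refine sum_congr rfl fun j _ => ?_
      rw [Set.indicator_apply]
      refine if_congr ?_ rfl rfl
      simp only [hA, Set.mem_ofPred_eq]
      rw [sub_self, abs_zero, Int.abs_eq_natAbs]; omega
    have i2 : ∑ j ∈ T.erase k, A.indicator m (j, k) =
        ∑ j ∈ (T.erase k).filter (fun j => 2 ≤ (j - k).natAbs), m (j, k) := by
      rw [sum_filter]
      refine sum_congr rfl fun j _ => ?_
      rw [Set.indicator_apply]
      refine if_congr ?_ rfl rfl
      simp only [hA, Set.mem_ofPred_eq]
      rw [sub_self, abs_zero, Int.abs_eq_natAbs]; omega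
    have i3 : ∑ i ∈ T.erase k, ∑ j ∈ T.erase k, A.indicator m (i, j) ≤
        ∑ i ∈ T.erase k, ∑ j ∈ T.erase k, m (i, j) :=
      sum_le_sum fun i _ => sum_le_sum fun j _ => Set.indicator_le_self' (fun _ _ => hm _) _
    have r1 := row_bound lam c₁ C₃ (ε ^ r) h0 h1 hc hc1 hC (fun j => m (k, j)) y (x k) k 2
      ((T.erase k).filter (fun j => 2 ≤ (j - k).natAbs))
      hεr hy0 (hx0 k) hxk (fun j hj => hyE j (mem_filter.1 hj).1) (fun j hj => (mem_filter.1 hj).2)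
      (fun j hj => Hrow j (ne_of_mem_erase (mem_filter.1 hj).1).symm)
    have r2 := row_bound lam c₁ C₃ (ε ^ r) h0 h1 hc hc1 hC (fun i => m (i, k)) x (y k) k 2
      ((T.erase k).filter (fun j => 2 ≤ (j - k).natAbs))
      hεr hx0 (hy0 k) hyk (fun j hj => hxE j (mem_filter.1 hj).1) (fun j hj => (mem_filter.1 hj).2)
      (fun j hj => Hcol j (ne_of_mem_erase (mem_filter.1 hj).1))
    rw [i0, i1, i2]
    linarith

/-- conclusion of the bootstrap, in terms of powers of `lam` -/
lemma boot (q r lam G ε : ℝ) (hq : 2 < q) (hr : r = 1 - 1/q) (hlam : 0 < lam) (hG : 0 < G)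
    (hε : 0 ≤ ε) (h : ε ≤ G * lam * ε ^ r) :
    ε ^ r ≤ G ^ (q - 1) * lam ^ (q - 1) ∧
      ε * ε ^ (2 * r - 1) ≤ G ^ (2 * (q - 1)) * lam ^ (2 * (q - 1)) := by
  have hq0 : 0 < q := by linarith
  have hGl : 0 < G * lam := mul_pos hG hlam
  have hi : 1 / q < 1/2 := by
    rw [div_lt_div_iff₀ hq0 (by norm_num)]; linarith
  have hqr : q * r = q - 1 := by rw [hr]; field_simp
  have key : ε ≤ (G * lam) ^ q := by
    rcases hε.eq_or_lt with h' | h'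
    · rw [← h']; positivity
    · have e : ε = ε ^ (1/q) * ε ^ r := by
        rw [← Real.rpow_add h', hr]; simp
      have h2 : ε ^ (1/q) ≤ G * lam := by
        have hp : 0 < ε ^ r := Real.rpow_pos_of_pos h' _
        nth_rewrite 1 [e] at h
        exact le_of_mul_le_mul_right h hp
      calc ε = (ε ^ (1/q)) ^ q := by
            rw [← Real.rpow_mul hε]; field_simp; simp
        _ ≤ _ := Real.rpow_le_rpow (by positivity) h2 hq0.le
  constructor
  · calc ε ^ r ≤ ((G * lam) ^ q) ^ r := Real.rpow_le_rpow hε key (by linarith)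
      _ = _ := by rw [← Real.rpow_mul hGl.le, hqr, Real.mul_rpow hG.le hlam.le]
  · calc ε * ε ^ (2 * r - 1) = ε ^ (2 * r) := by
          nth_rewrite 1 [← Real.rpow_one ε]
          rw [← Real.rpow_add_of_nonneg hε (by norm_num) (by linarith)]
          congr 1; ring
      _ ≤ ((G * lam) ^ q) ^ (2 * r) := Real.rpow_le_rpow hε key (by linarith)
      _ = _ := by
        rw [← Real.rpow_mul hGl.le, show q * (2 * r) = 2 * (q - 1) by rw [← hqr]; ring,
          Real.mul_rpow hG.le hlam.le]


/-- **Decay away from the diagonal** (after Green–Walker).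
Let `q > 2` with conjugate index `q′`, `c₁ ≤ 1`, `0 < c₂ < 1`, `λ ∈ (0, 1-c₂]`,
`C₃ > 0`. If `m` is a finitely supported probability measure on `ℤ²` and there
are non-negative sequences `x, y` with `ℓ^{q′}` norm `1` such that
`m(i,j) ≤ c₁ x_i y_j` when `i = j` and `m(i,j) ≤ c₁ C₃ λ^{|i-j|} x_i y_j` when
`i ≠ j`, then `c₁ ≥ c₂/(1 + (2C₃-1)λ)` and there is `k ∈ ℤ` with
`∑_{|i-k|+|j-k| ≥ 2} m(i,j) ≪_{q,c₂,C₃} (λ^q)^{2/q′} + (λ^q)^{1+1/q}`. -/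
theorem decay_away_from_diagonal (q c₂ C₃ : ℝ) (hq : 2 < q)
    (hc₂ : 0 < c₂) (hc₂' : c₂ < 1) (hC₃ : 0 < C₃) :
    ∃ K : ℝ, 0 < K ∧
      ∀ (q' c₁ lam : ℝ) (m : ℤ × ℤ → ℝ) (x y : ℤ → ℝ),
        1/q + 1/q' = 1 → c₁ ≤ 1 → lam ∈ Set.Ioc (0:ℝ) (1 - c₂) →
        (∀ p, 0 ≤ m p) → (Function.support m).Finite → HasSum m 1 →
        (∀ i, 0 ≤ x i) → (∀ j, 0 ≤ y j) →
        HasSum (fun i : ℤ => x i ^ q') 1 → HasSum (fun j : ℤ => y j ^ q') 1 →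
        (∀ i j : ℤ, (i = j → m (i, j) ≤ c₁ * x i * y j) ∧
          (i ≠ j → m (i, j) ≤ c₁ * C₃ * lam ^ (i - j).natAbs * x i * y j)) →
        (c₂ / (1 + (2 * C₃ - 1) * lam) ≤ c₁ ∧
          ∃ k : ℤ,
            (∑' p : ℤ × ℤ,
              Set.indicator {p : ℤ × ℤ | 2 ≤ |p.1 - k| + |p.2 - k|} m p) ≤
              K * ((lam ^ q) ^ (2/q') + (lam ^ q) ^ (1 + 1/q))) := by
  classical
  have hq0 : 0 < q := by linarith
  have hi : 1 / q < 1/2 := by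
    rw [div_lt_div_iff₀ hq0 (by norm_num)]; linarith
  have hiq : 0 < 1 / q := by positivity
  obtain ⟨r, hr⟩ : ∃ r : ℝ, r = 1 - 1/q := ⟨_, rfl⟩
  have hr2 : 1/2 < r := by linarith
  have hr1 : r < 1 := by linarith
  obtain ⟨δ, hδ⟩ : ∃ δ : ℝ, δ = (1/8 : ℝ) ^ (1 / (2 * r - 1)) / 2 := ⟨_, rfl⟩
  have hδ0 : 0 < δ := by rw [hδ]; positivity
  have hs : 0 < 2 * r - 1 := by linarith
  have hδ1 : δ < 1 := by
    have : (1/8 : ℝ) ^ (1 / (2 * r - 1)) ≤ 1 :=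
      Real.rpow_le_one (by norm_num) (by norm_num) (by positivity)
    linarith
  have hδ8 : (2 * δ) ^ (2 * r - 1) ≤ 1/8 := by
    rw [hδ, mul_div_cancel₀ _ (by norm_num), ← Real.rpow_mul (by norm_num),
      one_div_mul_cancel hs.ne', Real.rpow_one]
  obtain ⟨η, hη⟩ : ∃ η : ℝ, η = 1 - (1 - δ) ^ (r - 1/2) := ⟨_, rfl⟩
  have hη0 : 0 < η := by
    have := Real.rpow_lt_one (x := 1 - δ) (z := r - 1/2) (by linarith) (by linarith) (by linarith)
    linarith
  obtain ⟨l0, hl0⟩ : ∃ l0 : ℝ, l0 = η * c₂ / (2 * C₃) := ⟨_, rfl⟩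
  have hl0p : 0 < l0 := by rw [hl0]; positivity
  obtain ⟨G, hG⟩ : ∃ G : ℝ, G = 16 * C₃ / c₂ := ⟨_, rfl⟩
  have hGp : 0 < G := by rw [hG]; positivity
  refine ⟨1 / l0 ^ (q + 1) + 2 * G ^ (2 * (q - 1)) + 2 * (C₃ * (2 / c₂)) * G ^ (q - 1),
    by positivity, ?_⟩
  intro q' c₁ lam m x y hqq hc1 hlam hm hfin hsum hx hy hxs hys H
  obtain ⟨hlam0, hlam1⟩ := hlam
  have hl1 : lam < 1 := by linarith
  have hl1' : 0 < 1 - lam := by linarith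
  have hrq : 1 / q' = r := by linarith
  have hq'0 : q' ≠ 0 := by
    rintro rfl
    simp at hrq; linarith
  have hq'r : q' * r = 1 := by rw [← hrq]; field_simp
  have hxr : ∀ i, x i = (x i ^ q') ^ r := fun i => by
    rw [← Real.rpow_mul (hx i), hq'r, Real.rpow_one]
  have hyr : ∀ i, y i = (y i ^ q') ^ r := fun i => by
    rw [← Real.rpow_mul (hy i), hq'r, Real.rpow_one]
  have ha0 : ∀ i, 0 ≤ x i ^ q' := fun i => Real.rpow_nonneg (hx i) _
  have hb0 : ∀ i, 0 ≤ y i ^ q' := fun i => Real.rpow_nonneg (hy i) _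
  obtain ⟨T, hT⟩ : ∃ T : Finset ℤ, ∀ p : ℤ × ℤ, p ∉ T ×ˢ T → m p = 0 := by
    refine ⟨hfin.toFinset.image Prod.fst ∪ hfin.toFinset.image Prod.snd, fun p hp => ?_⟩
    by_contra hne
    apply hp
    have hmem : p ∈ hfin.toFinset := by simpa using hne
    rw [Finset.mem_product]
    exact ⟨Finset.mem_union_left _ (Finset.mem_image_of_mem _ hmem),
      Finset.mem_union_right _ (Finset.mem_image_of_mem _ hmem)⟩
  have hmT : ∑ i ∈ T, ∑ j ∈ T, m (i, j) = 1 := by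
    rw [← Finset.sum_product']
    exact (hasSum_sum_of_ne_finset_zero (f := m) (s := T ×ˢ T) hT).unique hsum
  have hIT : ∀ A : Set (ℤ × ℤ), ∑' p, A.indicator m p = ∑ i ∈ T, ∑ j ∈ T, A.indicator m (i, j) := by
    intro A
    rw [← Finset.sum_product']
    refine tsum_eq_sum fun p hp => ?_
    rw [Set.indicator_apply]
    split_ifs
    · exact hT p hp
    · rfl
  have haT : ∑ i ∈ T, x i ^ q' ≤ 1 := sum_le_hasSum T (fun i _ => ha0 i) hxs
  have hbT : ∑ i ∈ T, y i ^ q' ≤ 1 := sum_le_hasSum T (fun i _ => hb0 i) hys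
  have hcpos : 0 < c₁ := by
    by_contra hcon
    push Not at hcon
    have : ∑ i ∈ T, ∑ j ∈ T, m (i, j) ≤ 0 := by
      refine Finset.sum_nonpos fun i _ => Finset.sum_nonpos fun j _ => ?_
      by_cases h : i = j
      · have h2 := (H i j).1 h
        have h3 := mul_nonneg (hx i) (hy j)
        nlinarith
      · have h2 := (H i j).2 h
        have h3 : 0 ≤ C₃ * lam ^ (i - j).natAbs * x i * y j :=
          mul_nonneg (mul_nonneg (by positivity) (hx i)) (hy j)
        nlinarith
    linarith
  have sx := sum_sq_bound (fun i => x i ^ q') r 1 hr2 ha0 T haT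
  have sy := sum_sq_bound (fun i => y i ^ q') r 1 hr2 hb0 T hbT
  simp only [← hxr, ← hyr, Real.one_rpow, mul_one] at sx sy
  constructor
  · have B := box_bound lam c₁ C₃ hlam0 hl1 hcpos.le hC₃ m x y H T
    have D : ∑ i ∈ T, x i * y i ≤ 1 := by
      have : ∑ i ∈ T, x i * y i ≤ ∑ i ∈ T, (x i ^ 2 + y i ^ 2) / 2 :=
        Finset.sum_le_sum fun i _ => by nlinarith [sq_nonneg (x i - y i)]
      rw [← Finset.sum_div, Finset.sum_add_distrib] at this
      linarith
    have F : C₃ * (2 * lam / (1 - lam) * ((∑ i ∈ T, x i ^ 2 + ∑ j ∈ T, y j ^ 2) / 2)) ≤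
        C₃ * (2 * lam / (1 - lam) * 1) := by
      have : 0 ≤ 2 * lam / (1 - lam) := by positivity
      gcongr
      linarith
    have B2 : 1 ≤ c₁ * (1 + C₃ * (2 * lam / (1 - lam) * 1)) := by
      rw [hmT] at B
      exact B.trans (mul_le_mul_of_nonneg_left (by linarith) hcpos.le)
    have e : c₁ * (1 + C₃ * (2 * lam / (1 - lam) * 1)) =
        c₁ * (1 + (2 * C₃ - 1) * lam) / (1 - lam) := by
      field_simp; ring
    rw [e, le_div_iff₀ hl1'] at B2
    have hpos : 0 < 1 + (2 * C₃ - 1) * lam := by nlinarith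
    rw [div_le_iff₀ hpos]
    linarith
  · have e1 : (lam ^ q) ^ (2 / q') = lam ^ (2 * (q - 1)) := by
      rw [← Real.rpow_mul hlam0.le]
      congr 1
      rw [show 2 / q' = 2 * (1 / q') by ring, hrq, hr]; field_simp
    have e2 : (lam ^ q) ^ (1 + 1 / q) = lam ^ (q + 1) := by
      rw [← Real.rpow_mul hlam0.le]
      congr 1
      field_simp
    rw [e1, e2]
    have p1 : 0 < lam ^ (2 * (q - 1)) := Real.rpow_pos_of_pos hlam0 _
    have p2 : 0 < lam ^ (q + 1) := Real.rpow_pos_of_pos hlam0 _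
    have g1 : 0 < 2 * G ^ (2 * (q - 1)) := by positivity
    have g2 : 0 < 2 * (C₃ * (2 / c₂)) * G ^ (q - 1) := by positivity
    have g3 : 0 < 1 / l0 ^ (q + 1) := by positivity
    by_cases hsm : lam ≤ l0
    · have hLle : C₃ * (2 * lam / (1 - lam)) ≤ C₃ * (2 * lam / c₂) := by
        gcongr; linarith
      have hLη : C₃ * (2 * lam / (1 - lam)) ≤ 1 - (1 - δ) ^ (r - 1/2) := by
        refine hLle.trans ?_
        rw [← hη]
        rw [hl0, le_div_iff₀ (by positivity)] at hsm
        rw [← mul_div_assoc, div_le_iff₀ hc₂]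
        linarith
      obtain ⟨k, ε, hε0, hε1, hbad⟩ := core lam c₁ C₃ r δ hlam0 hl1 hcpos.le hc1 hC₃ hr2 hδ0 hδ1 hδ8
        hLη m hm x y (fun i => x i ^ q') (fun i => y i ^ q') ha0 hb0 hxr hyr H T haT hbT hmT
      refine ⟨k, ?_⟩
      rw [hIT]
      have hεr : 0 ≤ ε ^ r := Real.rpow_nonneg hε0 _
      have hε2 : ε ≤ G * lam * ε ^ r := by
        refine hε1.trans (mul_le_mul_of_nonneg_right ?_ hεr)
        have : G * lam = 8 * (C₃ * (2 * lam / c₂)) := by rw [hG]; ring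
        linarith
      obtain ⟨b1, b2⟩ := boot q r lam G ε hq hr hlam0 hGp hε0 hε2
      have t : C₃ * (2 * lam ^ 2 / (1 - lam)) * ε ^ r ≤
          C₃ * (2 * lam ^ 2 / c₂) * (G ^ (q - 1) * lam ^ (q - 1)) := by
        gcongr; linarith
      have e3 : lam ^ (q + 1) = lam ^ 2 * lam ^ (q - 1) := by
        rw [← Real.rpow_natCast lam 2, ← Real.rpow_add hlam0]
        congr 1; push_cast; ring
      have t2 : 2 * (C₃ * (2 * lam ^ 2 / c₂) * (G ^ (q - 1) * lam ^ (q - 1))) =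
          2 * (C₃ * (2 / c₂)) * G ^ (q - 1) * lam ^ (q + 1) := by
        rw [e3]; ring
      have := mul_pos g1 p2
      have := mul_pos g2 p1
      have := mul_pos g3 p1
      have := mul_pos g3 p2
      linarith
    · push Not at hsm
      refine ⟨0, ?_⟩
      have le1 : ∑' p : ℤ × ℤ, Set.indicator {p : ℤ × ℤ | 2 ≤ |p.1 - 0| + |p.2 - 0|} m p ≤ 1 := by
        rw [hIT, ← hmT]
        exact Finset.sum_le_sum fun i _ => Finset.sum_le_sum fun j _ =>
          Set.indicator_le_self' (fun _ _ => hm _) _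
      refine le1.trans ?_
      have hl : l0 ^ (q + 1) ≤ lam ^ (q + 1) := Real.rpow_le_rpow hl0p.le hsm.le (by linarith)
      have h1 : 1 ≤ 1 / l0 ^ (q + 1) * lam ^ (q + 1) := by
        rw [one_div_mul_eq_div, le_div_iff₀ (by positivity)]; linarith
      have := mul_pos g1 p2
      have := mul_pos g1 p1
      have := mul_pos g2 p1
      have := mul_pos g2 p2
      have := mul_pos g3 p1
      linarith
end

section
/- Let ψ, θ: ℕ → ℝ≥0 be finitely supported, let f, g: ℕ → ℝ≥0 be multiplicative functions satisfying (1⋆f)(n) ≤ n and (1⋆g)(n) ≤ n for all n ≥ 1, let ε ∈ (0,2/5], set q′ := 2/(1+2ε), and let t ≥ 1, C ∈ ℝ. Let ℰ′ ⊆ ℰ_{ψ,θ}^{t,C} := {(v,w) ∈ supp ψ × supp θ : D_{ψ,θ}(v,w) ≤ 1, ∑_{p prime, p | vw/gcd(v,w)², p ≥ t} 1/p ≥ C}, where D_{ψ,θ}(v,w) := max(w·ψ(v), v·θ(w))/gcd(v,w), and write V′ := {v : ∃w, (v,w)∈ℰ′}, W′ := {w : ∃v, (v,w)∈ℰ′}.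 Suppose: (i) for all v ∈ V′ and w ∈ W′, μ_θ^g(Γ_{ℰ′}(v)) ≥ (1/q′)·μ_{ψ,θ}^{f,g}(ℰ′)/μ_ψ^f(V′) and μ_ψ^f(Γ_{ℰ′}(w)) ≥ (1/q′)·μ_{ψ,θ}^{f,g}(ℰ′)/μ_θ^g(W′); and (ii) there exists N ∈ ℕ such that for all primes p and all (v,w) ∈ ℰ′, |ν_p(v/N)| + |ν_p(w/N)| ≤ 1, where ν_p is the p-adic valuation on ℚ. Then μ_{ψ,θ}^{f,g}(ℰ′) ≪ (μ_ψ^f(V′)·μ_θ^g(W′)·e^{−25Ct})^{1/2}, with an absolute implied constant. -/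
noncomputable def rind (t : ℝ) (p : ℕ) : ℝ :=
  Set.indicator {q : ℕ | t ≤ (q : ℝ)} (fun q => 1 / (q : ℝ)) p

noncomputable def rkap (t : ℝ) (p : ℕ) : ℝ := Real.exp (50 * t * rind t p) - 1

noncomputable def rH (t : ℝ) (n : ℕ) : ℝ := ∏ p ∈ n.primeFactors, (1 + rkap t p)

lemma rind_nonneg (t : ℝ) (p : ℕ) : 0 ≤ rind t p := by
  unfold rind
  apply Set.indicator_nonneg
  intro x _
  positivity

lemma rkap_nonneg (t : ℝ) (ht : 1 ≤ t) (p : ℕ) : 0 ≤ rkap t p := by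
  unfold rkap
  have := rind_nonneg t p
  have h : 0 ≤ 50 * t * rind t p := by positivity
  linarith [Real.add_one_le_exp (50 * t * rind t p)]

lemma rH_eq (t : ℝ) (n : ℕ) : rH t n = Real.exp (50 * t * primeSum t n) := by
  unfold rH primeSum rkap rind
  rw [Finset.mul_sum, Real.exp_sum]
  apply Finset.prod_congr rfl
  intro p _
  ring

lemma primeSum_nonneg (t : ℝ) (n : ℕ) : 0 ≤ primeSum t n :=
  Finset.sum_nonneg fun p _ => rind_nonneg t p

lemma rkap_le (t : ℝ) (ht : 1 ≤ t) (p : ℕ) (hp : 0 < p) :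
    rkap t p / p ≤ if t ≤ (p:ℝ) then 50 * Real.exp 50 * t * ((p:ℝ)^2)⁻¹ else 0 := by
  have hp' : (0:ℝ) < p := by exact_mod_cast hp
  split_ifs with h
  · have h1 : rind t p = 1 / (p:ℝ) := by
      unfold rind; rw [Set.indicator_of_mem]; exact h
    unfold rkap
    rw [h1]
    set x := 50 * t * (1 / (p:ℝ)) with hx
    have hx0 : 0 ≤ x := by positivity
    have htp : t * (1 / (p:ℝ)) ≤ 1 := by
      rw [mul_one_div, div_le_one hp']; exact h
    have hx1 : x ≤ 50 := by rw [hx]; nlinarith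
    have h2 : Real.exp x - 1 ≤ x * Real.exp x := by
      have := Real.add_one_le_exp (-x)
      have h3 : Real.exp (-x) * Real.exp x = 1 := by rw [← Real.exp_add]; simp
      nlinarith [Real.exp_pos x]
    have h3 : Real.exp x ≤ Real.exp 50 := Real.exp_le_exp.mpr hx1
    have h4 : Real.exp x - 1 ≤ x * Real.exp 50 := by nlinarith
    calc (Real.exp x - 1) / p ≤ (x * Real.exp 50) / p := by gcongr
      _ = _ := by rw [hx]; field_simp
  · have h1 : rind t p = 0 := by
      unfold rind; rw [Set.indicator_of_notMem]; exact h
    unfold rkap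
    rw [h1]; simp

lemma exists_B : ∃ B : ℝ, 0 < B ∧ ∀ t : ℝ, 1 ≤ t → ∀ P : Finset ℕ, (∀ p ∈ P, 0 < p) →
    ∏ p ∈ P, (1 + rkap t p / p) ≤ B := by
  refine ⟨Real.exp (50 * Real.exp 50 * 2), Real.exp_pos _, ?_⟩
  intro t ht P hP
  have h1 : ∏ p ∈ P, (1 + rkap t p / p) ≤ Real.exp (∑ p ∈ P, rkap t p / p) := by
    rw [Real.exp_sum]
    apply Finset.prod_le_prod
    · intro p _
      have := rkap_nonneg t ht p
      positivity
    · intro p _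
      linarith [Real.add_one_le_exp (rkap t p / p)]
  refine h1.trans (Real.exp_le_exp.mpr ?_)
  have h2 : ∑ p ∈ P, rkap t p / p ≤
      ∑ p ∈ P, if t ≤ (p:ℝ) then 50 * Real.exp 50 * t * ((p:ℝ)^2)⁻¹ else 0 :=
    Finset.sum_le_sum fun p hp => rkap_le t ht p (hP p hp)
  refine h2.trans ?_
  rw [← Finset.sum_filter, ← Finset.mul_sum]
  obtain ⟨k, hk⟩ : ∃ k : ℕ, ⌈t⌉₊ = k + 1 := by
    have : 0 < ⌈t⌉₊ := Nat.ceil_pos.mpr (by linarith)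
    exact ⟨⌈t⌉₊ - 1, by omega⟩
  have h3 : ∑ p ∈ P.filter (fun p : ℕ => t ≤ (p:ℝ)), ((p:ℝ)^2)⁻¹ ≤
      ∑ p ∈ Finset.Ioo k (P.sup id + 1), ((p:ℝ)^2)⁻¹ := by
    apply Finset.sum_le_sum_of_subset_of_nonneg
    · intro p hp
      rw [Finset.mem_filter] at hp
      have h4 : ⌈t⌉₊ ≤ p := Nat.ceil_le.mpr hp.2
      have h5 : p ≤ P.sup id := Finset.le_sup (f := id) hp.1
      rw [Finset.mem_Ioo]; omega
    · intros; positivity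
  have h4 := sum_Ioo_inv_sq_le (α := ℝ) k (P.sup id + 1)
  have h5 : t ≤ (k:ℝ) + 1 := by
    have := Nat.le_ceil t
    rw [hk] at this; exact_mod_cast this
  have h6 : (2:ℝ) / (k + 1) ≤ 2 / t := by
    apply div_le_div_of_nonneg_left <;> linarith
  have h7 := h3.trans (h4.trans h6)
  calc 50 * Real.exp 50 * t * _ ≤ 50 * Real.exp 50 * t * (2 / t) := by gcongr
    _ = _ := by field_simp

lemma rH_expand (t : ℝ) (n : ℕ) (P : Finset ℕ) (h : n.primeFactors ⊆ P) :
    rH t n = ∑ s ∈ P.powerset, if s ⊆ n.primeFactors then ∏ p ∈ s, rkap t p else 0 := by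
  unfold rH
  rw [Finset.prod_one_add, ← Finset.sum_filter]
  apply Finset.sum_congr _ (fun _ _ => rfl)
  ext s
  simp only [Finset.mem_powerset, Finset.mem_filter]
  exact ⟨fun hs => ⟨hs.trans h, hs⟩, fun hs => hs.2⟩

lemma prod_dvd_of_subset (n : ℕ) (s : Finset ℕ) (h : s ⊆ n.primeFactors) : ∏ p ∈ s, p ∣ n :=
  (Finset.prod_dvd_prod_of_subset _ _ _ h).trans (Nat.prod_primeFactors_dvd n)

lemma sum_kap (t : ℝ) (P : Finset ℕ) (M : ℝ) :
    ∑ s ∈ P.powerset, (∏ p ∈ s, rkap t p) * (M / ((∏ p ∈ s, p : ℕ) : ℝ)) =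
      M * ∏ p ∈ P, (1 + rkap t p / p) := by
  rw [Finset.prod_one_add, Finset.mul_sum]
  apply Finset.sum_congr rfl
  intro s _
  rw [Finset.prod_div_distrib]
  push_cast
  ring

lemma conv_le (B t : ℝ) (ht : 1 ≤ t)
    (hB : ∀ P : Finset ℕ, (∀ p ∈ P, 0 < p) → ∏ p ∈ P, (1 + rkap t p / p) ≤ B)
    (g : ℕ → ℝ) (hg0 : ∀ n, 0 ≤ g n)
    (hg : ∀ n : ℕ, 1 ≤ n → ∑ d ∈ n.divisors, g d ≤ (n : ℝ)) (M : ℕ) (hM : 1 ≤ M) :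
    ∑ w ∈ M.divisors, g w * rH t (M / w) ≤ B * M := by
  have h1 : ∀ w ∈ M.divisors, g w * rH t (M / w) = ∑ s ∈ M.primeFactors.powerset,
      (∏ p ∈ s, rkap t p) * (if s ⊆ (M/w).primeFactors then g w else 0) := by
    intro w hw
    have hw' := Nat.dvd_of_mem_divisors hw
    rw [rH_expand t (M / w) M.primeFactors
      (Nat.primeFactors_mono (Nat.div_dvd_of_dvd hw') (by omega)), Finset.mul_sum]
    apply Finset.sum_congr rfl
    intro s _
    split_ifs <;> ring
  rw [Finset.sum_congr rfl h1, Finset.sum_comm]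
  calc _ ≤ ∑ s ∈ M.primeFactors.powerset,
        (∏ p ∈ s, rkap t p) * ((M:ℝ) / ((∏ p ∈ s, p : ℕ) : ℝ)) := by
        apply Finset.sum_le_sum
        intro s hs
        rw [Finset.mem_powerset] at hs
        rw [← Finset.mul_sum]
        apply mul_le_mul_of_nonneg_left _ (Finset.prod_nonneg fun p _ => rkap_nonneg t ht p)
        rw [← Finset.sum_filter]
        have hj := prod_dvd_of_subset M s hs
        set j := ∏ p ∈ s, p with hjdef
        have hjpos : 0 < j := Nat.pos_of_dvd_of_pos hj (by omega)
        have hMj : 1 ≤ M / j := Nat.div_pos (Nat.le_of_dvd (by omega) hj) hjpos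
        calc _ ≤ ∑ w ∈ (M / j).divisors, g w := by
              apply Finset.sum_le_sum_of_subset_of_nonneg
              · intro w hw
                rw [Finset.mem_filter] at hw
                obtain ⟨hw1, hw2⟩ := hw
                obtain ⟨k, hk⟩ := Nat.dvd_of_mem_divisors hw1
                have hwpos : 0 < w := Nat.pos_of_mem_divisors hw1
                have h3 := prod_dvd_of_subset _ s hw2
                rw [hk, Nat.mul_div_cancel_left _ hwpos] at h3
                obtain ⟨l, hl⟩ := h3
                rw [Nat.mem_divisors]
                refine ⟨⟨l, ?_⟩, by omega⟩
                rw [hk, hl]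
                apply Nat.div_eq_of_eq_mul_right hjpos
                rw [hjdef]; ring
              · intros; exact hg0 _
          _ ≤ ((M / j : ℕ) : ℝ) := hg _ hMj
          _ ≤ _ := Nat.cast_div_le
    _ = M * ∏ p ∈ M.primeFactors, (1 + rkap t p / p) := sum_kap _ _ _
    _ ≤ M * B := by
        gcongr
        exact hB _ fun p hp => (Nat.prime_of_mem_primeFactors hp).pos
    _ = _ := by ring

lemma avg_le (B t : ℝ) (ht : 1 ≤ t)
    (hB : ∀ P : Finset ℕ, (∀ p ∈ P, 0 < p) → ∏ p ∈ P, (1 + rkap t p / p) ≤ B) (X : ℕ) :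
    ∑ c ∈ Finset.Ioc 0 X, rH t c ≤ B * X := by
  have h1 : ∀ c ∈ Finset.Ioc 0 X, rH t c = ∑ s ∈ (Finset.Ioc 0 X).powerset,
      (∏ p ∈ s, rkap t p) * (if s ⊆ c.primeFactors then 1 else 0) := by
    intro c hc
    rw [Finset.mem_Ioc] at hc
    rw [rH_expand t c (Finset.Ioc 0 X)]
    · apply Finset.sum_congr rfl
      intro s _
      split_ifs <;> ring
    · intro p hp
      have := Nat.le_of_mem_primeFactors hp
      have := (Nat.prime_of_mem_primeFactors hp).pos
      rw [Finset.mem_Ioc]; omega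
  rw [Finset.sum_congr rfl h1, Finset.sum_comm]
  calc _ ≤ ∑ s ∈ (Finset.Ioc 0 X).powerset,
        (∏ p ∈ s, rkap t p) * ((X:ℝ) / ((∏ p ∈ s, p : ℕ) : ℝ)) := by
        apply Finset.sum_le_sum
        intro s hs
        rw [← Finset.mul_sum]
        apply mul_le_mul_of_nonneg_left _ (Finset.prod_nonneg fun p _ => rkap_nonneg t ht p)
        rw [← Finset.sum_filter]
        set j := ∏ p ∈ s, p with hjdef
        rw [Finset.sum_const, nsmul_eq_mul, mul_one]
        calc _ ≤ ((((Finset.Ioc 0 X).filter (fun c => j ∣ c)).card : ℕ) : ℝ) := by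
              norm_cast
              apply Finset.card_le_card
              intro c hc
              rw [Finset.mem_filter] at hc ⊢
              exact ⟨hc.1, prod_dvd_of_subset _ s hc.2⟩
          _ = ((X / j : ℕ) : ℝ) := by rw [Nat.Ioc_filter_dvd_card_eq_div]
          _ ≤ _ := Nat.cast_div_le
    _ = X * ∏ p ∈ Finset.Ioc 0 X, (1 + rkap t p / p) := sum_kap _ _ _
    _ ≤ X * B := by
        gcongr
        exact hB _ fun p hp => (Finset.mem_Ioc.mp hp).1
    _ = _ := by ring

/-- numerator of `v/N`. -/
def rnum (N v : ℕ) : ℕ := v / Nat.gcd v N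
/-- denominator of `v/N`. -/
def rden (N v : ℕ) : ℕ := N / Nat.gcd v N

noncomputable def rS (t : ℝ) (N v : ℕ) : ℝ := primeSum t (rnum N v) + primeSum t (rden N v)

lemma rnum_pos (N v : ℕ) (hv : 0 < v) : 0 < rnum N v :=
  Nat.div_pos (Nat.gcd_le_left _ hv) (Nat.gcd_pos_of_pos_left _ hv)

lemma rden_pos (N v : ℕ) (hN : 0 < N) : 0 < rden N v :=
  Nat.div_pos (Nat.gcd_le_right _ hN) (Nat.gcd_pos_of_pos_right _ hN)

lemma rnum_rden (N v : ℕ) : N * rnum N v = v * rden N v := by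
  unfold rnum rden
  rw [← Nat.mul_div_assoc _ (Nat.gcd_dvd_left _ _), ← Nat.mul_div_assoc _ (Nat.gcd_dvd_right _ _),
    mul_comm]

lemma key1 (B t : ℝ) (ht : 1 ≤ t) (hB0 : 0 < B)
    (hB : ∀ P : Finset ℕ, (∀ p ∈ P, 0 < p) → ∏ p ∈ P, (1 + rkap t p / p) ≤ B)
    (g : ℕ → ℝ) (hg0 : ∀ n, 0 ≤ g n)
    (hg : ∀ n : ℕ, 1 ≤ n → ∑ d ∈ n.divisors, g d ≤ (n : ℝ)) (N : ℕ) (hN : 0 < N)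
    (T : Finset ℕ) (hT : ∀ w ∈ T, 0 < w) (X L : ℝ) (hX : ∀ w ∈ T, (rnum N w : ℝ) ≤ X)
    (hX0 : 0 ≤ X) (hL : ∀ w ∈ T, L ≤ rS t N w) :
    ∑ w ∈ T, g w / (N * rnum N w) ≤ B ^ 2 * X * Real.exp (-(50 * t * L)) := by
  have hH0 : ∀ n, 0 ≤ rH t n := fun n => by rw [rH_eq]; positivity
  have hN' : (0:ℝ) < N := by exact_mod_cast hN
  have h1 : ∑ w ∈ T, g w / (N * rnum N w) ≤ Real.exp (-(50 * t * L)) *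
      ∑ w ∈ T, rH t (rnum N w) / (N * rnum N w) * (g w * rH t (rden N w)) := by
    rw [Finset.mul_sum]
    apply Finset.sum_le_sum
    intro w hw
    have h2 : 1 ≤ Real.exp (-(50 * t * L)) * (rH t (rnum N w) * rH t (rden N w)) := by
      rw [rH_eq, rH_eq, ← Real.exp_add, ← Real.exp_add]
      apply Real.one_le_exp
      have h3 := hL w hw
      unfold rS at h3
      nlinarith
    calc g w / (N * rnum N w) = g w / (N * rnum N w) * 1 := by ring
      _ ≤ g w / (N * rnum N w) *
        (Real.exp (-(50 * t * L)) * (rH t (rnum N w) * rH t (rden N w))) := by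
          apply mul_le_mul_of_nonneg_left h2
          have := hg0 w
          positivity
      _ = _ := by ring
  have h2 : ∑ w ∈ T, rH t (rnum N w) / (N * rnum N w) * (g w * rH t (rden N w)) ≤ B ^ 2 * X := by
    have hmap : ∀ w ∈ T, rnum N w ∈ Finset.Ioc 0 ⌊X⌋₊ := by
      intro w hw
      rw [Finset.mem_Ioc]
      exact ⟨rnum_pos N w (hT w hw), Nat.le_floor (hX w hw)⟩
    rw [← Finset.sum_fiberwise_of_maps_to hmap]
    calc _ ≤ ∑ c ∈ Finset.Ioc 0 ⌊X⌋₊, rH t c * B := by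
          apply Finset.sum_le_sum
          intro c hc
          have hc0 : 0 < c := (Finset.mem_Ioc.mp hc).1
          have hc0' : (0:ℝ) < c := by exact_mod_cast hc0
          calc _ = ∑ w ∈ T with rnum N w = c, rH t c / (N * c) * (g w * rH t (N * c / w)) := by
                apply Finset.sum_congr rfl
                intro w hw
                rw [Finset.mem_filter] at hw
                have hwp := hT w hw.1
                have h3 : rden N w = N * c / w := by
                  symm
                  apply Nat.div_eq_of_eq_mul_right hwp
                  rw [← hw.2, rnum_rden]
                rw [h3, hw.2]
            _ = rH t c / (N * c) * ∑ w ∈ T with rnum N w = c, (g w * rH t (N * c / w)) := by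
                rw [Finset.mul_sum]
            _ ≤ rH t c / (N * c) * ∑ w ∈ (N * c).divisors, (g w * rH t (N * c / w)) := by
                apply mul_le_mul_of_nonneg_left
                · apply Finset.sum_le_sum_of_subset_of_nonneg
                  · intro w hw
                    rw [Finset.mem_filter] at hw
                    rw [Nat.mem_divisors, ← hw.2]
                    refine ⟨⟨_, rnum_rden N w⟩, ?_⟩
                    rw [hw.2]; positivity
                  · intro w _ _
                    exact mul_nonneg (hg0 _) (hH0 _)
                · have := hH0 c
                  positivity
            _ ≤ rH t c / (N * c) * (B * ((N * c : ℕ) : ℝ)) := by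
                apply mul_le_mul_of_nonneg_left
                · exact conv_le B t ht hB g hg0 hg _ (Nat.mul_pos hN hc0)
                · have := hH0 c
                  positivity
            _ = rH t c * B := by push_cast; field_simp
      _ = (∑ c ∈ Finset.Ioc 0 ⌊X⌋₊, rH t c) * B := by rw [Finset.sum_mul]
      _ ≤ (B * (⌊X⌋₊ : ℝ)) * B := by
          gcongr
          exact avg_le B t ht hB _
      _ ≤ (B * X) * B := by
          gcongr
          exact Nat.floor_le hX0
      _ = _ := by ring
  calc _ ≤ _ := h1
    _ ≤ Real.exp (-(50 * t * L)) * (B ^ 2 * X) := by gcongr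
    _ = _ := by ring

def rGood (N v w : ℕ) : Prop := ∀ p : ℕ, p.Prime →
  |padicValRat p ((v : ℚ) / (N : ℚ))| + |padicValRat p ((w : ℚ) / (N : ℚ))| ≤ 1

lemma rGood.symm {N v w : ℕ} (h : rGood N v w) : rGood N w v := fun p hp => by
  rw [add_comm]; exact h p hp

lemma gcd_le (N v w : ℕ) (hN : 0 < N) (hv : 0 < v) (hw : 0 < w) (h : rGood N v w) :
    Nat.gcd v w * (rden N v * rden N w) ∣ N := by
  have h1 := rden_pos N v hN
  have h2 := rden_pos N w hN
  have h3 : 0 < Nat.gcd v w := Nat.gcd_pos_of_pos_left _ hv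
  rw [← Nat.factorization_le_iff_dvd (by positivity) hN.ne']
  intro p
  by_cases hp : p.Prime
  swap
  · rw [Nat.factorization_eq_zero_of_not_prime _ hp]; exact Nat.zero_le _
  have := Fact.mk hp
  have h4 := h p hp
  have hNq : (N:ℚ) ≠ 0 := by exact_mod_cast hN.ne'
  have hvq : (v:ℚ) ≠ 0 := by exact_mod_cast hv.ne'
  have hwq : (w:ℚ) ≠ 0 := by exact_mod_cast hw.ne'
  rw [padicValRat.div hvq hNq, padicValRat.div hwq hNq, padicValRat.of_nat, padicValRat.of_nat,
    padicValRat.of_nat, ← Nat.factorization_def _ hp, ← Nat.factorization_def _ hp,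
    ← Nat.factorization_def _ hp] at h4
  rw [Nat.factorization_mul (by positivity) (by positivity),
    Nat.factorization_mul (by positivity) (by positivity), Nat.factorization_gcd hv.ne' hw.ne']
  unfold rden
  rw [Nat.factorization_div (Nat.gcd_dvd_right _ _), Nat.factorization_div (Nat.gcd_dvd_right _ _),
    Nat.factorization_gcd hv.ne' hN.ne', Nat.factorization_gcd hw.ne' hN.ne']
  simp only [Finsupp.add_apply, Finsupp.tsub_apply, Finsupp.inf_apply]
  rcases abs_cases ((v.factorization p : ℤ) - (N.factorization p : ℤ)) with h5 | h5 <;>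
    rcases abs_cases ((w.factorization p : ℤ) - (N.factorization p : ℤ)) with h6 | h6 <;>
    omega

lemma primeSum_sub (t : ℝ) (N v w : ℕ) (hN : 0 < N) (hv : 0 < v) (hw : 0 < w) :
    primeSum t (v * w / Nat.gcd v w ^ 2) ≤ rS t N v + rS t N w := by
  have h1 := (rden_pos N v hN).ne'
  have h2 := (rden_pos N w hN).ne'
  have h3 := (rnum_pos N v hv).ne'
  have h4 := (rnum_pos N w hw).ne'
  have hdvd : Nat.gcd v w ^ 2 ∣ v * w := by
    rw [sq]; exact Nat.mul_dvd_mul (Nat.gcd_dvd_left _ _) (Nat.gcd_dvd_right _ _)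
  have hsub : (v * w / Nat.gcd v w ^ 2).primeFactors ⊆
      ((rnum N v).primeFactors ∪ (rden N v).primeFactors) ∪
      ((rnum N w).primeFactors ∪ (rden N w).primeFactors) := by
    intro p hp
    by_contra hcon
    simp only [Finset.mem_union, ← Nat.support_factorization, Finsupp.mem_support_iff] at hp hcon
    push Not at hcon
    apply hp
    rw [Nat.factorization_div hdvd, Nat.factorization_mul hv.ne' hw.ne', Nat.factorization_pow,
      Nat.factorization_gcd hv.ne' hw.ne']
    unfold rden rnum at hcon
    rw [Nat.factorization_div (Nat.gcd_dvd_right _ _), Nat.factorization_div (Nat.gcd_dvd_right _ _),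
      Nat.factorization_div (Nat.gcd_dvd_left _ _), Nat.factorization_div (Nat.gcd_dvd_left _ _),
      Nat.factorization_gcd hv.ne' hN.ne', Nat.factorization_gcd hw.ne' hN.ne'] at hcon
    simp only [Finsupp.add_apply, Finsupp.tsub_apply, Finsupp.inf_apply, Finsupp.smul_apply,
      smul_eq_mul] at hcon ⊢
    omega
  have hun : ∀ A B : Finset ℕ, ∑ p ∈ A ∪ B, rind t p ≤ ∑ p ∈ A, rind t p + ∑ p ∈ B, rind t p := by
    intro A B
    rw [← Finset.sum_union_inter]
    have : 0 ≤ ∑ p ∈ A ∩ B, rind t p := Finset.sum_nonneg fun p _ => rind_nonneg t p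
    linarith
  calc _ ≤ ∑ p ∈ ((rnum N v).primeFactors ∪ (rden N v).primeFactors) ∪
      ((rnum N w).primeFactors ∪ (rden N w).primeFactors), rind t p :=
        Finset.sum_le_sum_of_subset_of_nonneg hsub fun p _ _ => rind_nonneg t p
    _ ≤ _ := by
      refine (hun _ _).trans (add_le_add (hun _ _) (hun _ _))

lemma key2 (B t : ℝ) (ht : 1 ≤ t) (hB0 : 0 < B)
    (hB : ∀ P : Finset ℕ, (∀ p ∈ P, 0 < p) → ∏ p ∈ P, (1 + rkap t p / p) ≤ B)
    (g θ : ℕ → ℝ) (hg0 : ∀ n, 0 ≤ g n)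
    (hg : ∀ n : ℕ, 1 ≤ n → ∑ d ∈ n.divisors, g d ≤ (n : ℝ)) (N : ℕ) (hN : 0 < N)
    (v : ℕ) (hv : 0 < v)
    (T : Finset ℕ) (hT : ∀ w ∈ T, 0 < w ∧ rGood N v w ∧ (v:ℝ) * θ w ≤ Nat.gcd v w)
    (X L : ℝ) (hX : ∀ w ∈ T, (rnum N w : ℝ) ≤ X)
    (hX0 : 0 ≤ X) (hL : ∀ w ∈ T, L ≤ rS t N w) :
    ∑ w ∈ T, mu θ g w ≤ B ^ 2 * X * Real.exp (-(50 * t * L)) / rnum N v := by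
  have ha : (0:ℝ) < rnum N v := by exact_mod_cast rnum_pos N v hv
  have hN' : (0:ℝ) < N := by exact_mod_cast hN
  have hv' : (0:ℝ) < v := by exact_mod_cast hv
  rw [le_div_iff₀ ha, Finset.sum_mul]
  refine le_trans ?_ (key1 B t ht hB0 hB g hg0 hg N hN T (fun w hw => (hT w hw).1) X L hX hX0 hL)
  apply Finset.sum_le_sum
  intro w hw
  obtain ⟨hw0, hgood, hD⟩ := hT w hw
  have hw' : (0:ℝ) < w := by exact_mod_cast hw0
  have hc : (0:ℝ) < rnum N w := by exact_mod_cast rnum_pos N w hw0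
  have hb : (0:ℝ) < rden N v := by exact_mod_cast rden_pos N v hN
  have hd : (0:ℝ) < rden N w := by exact_mod_cast rden_pos N w hN
  have e1 : (N:ℝ) * rnum N v = v * rden N v := by exact_mod_cast rnum_rden N v
  have e2 : (N:ℝ) * rnum N w = w * rden N w := by exact_mod_cast rnum_rden N w
  have h1 : (Nat.gcd v w : ℝ) * (rden N v * rden N w) ≤ N := by
    exact_mod_cast Nat.le_of_dvd hN (gcd_le N v w hN hv hw0 hgood)
  have h2 : θ w * (rnum N v * rden N w) ≤ 1 := by
    have h3 : (v:ℝ) * θ w * (rden N v * rden N w) ≤ N :=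
      le_trans (by gcongr) h1
    have h4 : N * (θ w * (rnum N v * rden N w)) ≤ N * 1 := by
      calc N * (θ w * (rnum N v * rden N w)) = (N * rnum N v) * (θ w * rden N w) := by ring
        _ = v * θ w * (rden N v * rden N w) := by rw [e1]; ring
        _ ≤ _ := by linarith
    exact le_of_mul_le_mul_left h4 hN'
  rw [e2]
  unfold mu
  calc g w * θ w / w * rnum N v = g w / (w * rden N w) * (θ w * (rnum N v * rden N w)) := by
        field_simp
    _ ≤ g w / (w * rden N w) * 1 := by
        apply mul_le_mul_of_nonneg_left h2
        have := hg0 w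
        positivity
    _ = _ := by ring

/-- The combinatorial heart. -/
lemma exists_pair (E : Finset (ℕ × ℕ)) (hne : E.Nonempty) (a c : ℕ → ℝ) (s S μ ν : ℕ → ℝ)
    (A C e : ℝ) (hA : 0 < A) (he : 0 < e) (he1 : e ≤ 1)
    (ha : ∀ vw ∈ E, 0 < a vw.1) (hc : ∀ vw ∈ E, 0 < c vw.2)
    (hC : ∀ vw ∈ E, C ≤ s vw.1 + S vw.2)
    (hν : ∀ v ∈ E.image Prod.fst, ∀ T ⊆ (E.filter (fun vw => vw.1 = v)).image Prod.snd,
      ∀ X : ℝ, 0 ≤ X → (∀ w ∈ T, c w ≤ X) → ∑ w ∈ T, ν w ≤ A * X / a v ∧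
        ((∀ w ∈ T, C / 2 ≤ S w) → ∑ w ∈ T, ν w ≤ A * X * e / a v))
    (hμ : ∀ w ∈ E.image Prod.snd, ∀ T ⊆ (E.filter (fun vw => vw.2 = w)).image Prod.fst,
      ∀ X : ℝ, 0 ≤ X → (∀ v ∈ T, a v ≤ X) → ∑ v ∈ T, μ v ≤ A * X / c w ∧
        ((∀ v ∈ T, C / 2 ≤ s v) → ∑ v ∈ T, μ v ≤ A * X * e / c w)) :
    ∃ v ∈ E.image Prod.fst, ∃ w ∈ E.image Prod.snd, ∃ x y : ℝ, x * y ≤ 2 * A ^ 2 * e ∧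
      ∑ w ∈ (E.filter (fun vw => vw.1 = v)).image Prod.snd, ν w ≤ x ∧
      ∑ v ∈ (E.filter (fun vw => vw.2 = w)).image Prod.fst, μ v ≤ y := by
  have ha' : ∀ v ∈ E.image Prod.fst, 0 < a v := by
    intro v hv
    obtain ⟨vw, h, rfl⟩ := Finset.mem_image.mp hv
    exact ha vw h
  have hc' : ∀ w ∈ E.image Prod.snd, 0 < c w := by
    intro v hv
    obtain ⟨vw, h, rfl⟩ := Finset.mem_image.mp hv
    exact hc vw h
  obtain ⟨v0, hv0, hv0max⟩ := Finset.exists_max_image (E.image Prod.fst) a (hne.image _)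
  obtain ⟨w0, hw0, hw0max⟩ := Finset.exists_max_image (E.image Prod.snd) c (hne.image _)
  have hsub1 : ∀ v, (E.filter (fun vw => vw.1 = v)).image Prod.snd ⊆ E.image Prod.snd :=
    fun v => Finset.image_subset_image (Finset.filter_subset _ _)
  have hsub2 : ∀ w, (E.filter (fun vw => vw.2 = w)).image Prod.fst ⊆ E.image Prod.fst :=
    fun v => Finset.image_subset_image (Finset.filter_subset _ _)
  have a0 := ha' v0 hv0
  have c0 := hc' w0 hw0
  -- splitting bound at `w0`
  have split : ∀ Y : ℝ, 0 ≤ Y → (∀ v ∈ E.image Prod.fst, s v < C / 2 → a v ≤ Y) →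
      ∑ v ∈ (E.filter (fun vw => vw.2 = w0)).image Prod.fst, μ v ≤
        A * (a v0) * e / c w0 + A * Y / c w0 := by
    intro Y hY hsmall
    rw [← Finset.sum_filter_add_sum_filter_not _ (fun v => C / 2 ≤ s v)]
    apply add_le_add
    · refine (hμ w0 hw0 _ (Finset.filter_subset _ _) (a v0) a0.le ?_).2 ?_
      · intro v hv
        exact hv0max v (hsub2 w0 (Finset.mem_filter.mp hv).1)
      · intro v hv
        exact (Finset.mem_filter.mp hv).2
    · refine (hμ w0 hw0 _ (Finset.filter_subset _ _) Y hY ?_).1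
      intro v hv
      have := Finset.mem_filter.mp hv
      exact hsmall v (hsub2 w0 this.1) (not_le.mp this.2)
  by_cases hcase : ∃ v ∈ (E.image Prod.fst).filter (fun v => s v < C / 2), e * a v0 ≤ a v
  · obtain ⟨v2, hv2, hv2'⟩ := hcase
    obtain ⟨v1, hv1, hv1max⟩ := Finset.exists_max_image _ a ⟨v2, hv2⟩
    have hle : e * a v0 ≤ a v1 := hv2'.trans (hv1max v2 hv2)
    rw [Finset.mem_filter] at hv1
    have a1 := ha' v1 hv1.1
    refine ⟨v1, hv1.1, w0, hw0, A * c w0 * e / a v1, 2 * A * a v1 / c w0, ?_, ?_, ?_⟩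
    · apply le_of_eq; field_simp
    · refine (hν v1 hv1.1 _ subset_rfl (c w0) c0.le fun w hw => hw0max w (hsub1 _ hw)).2 ?_
      intro w hw
      obtain ⟨vw, h, rfl⟩ := Finset.mem_image.mp hw
      rw [Finset.mem_filter] at h
      have := hC vw h.1
      rw [h.2] at this
      linarith [hv1.2]
    · refine (split (a v1) a1.le fun v hv hs => hv1max v (Finset.mem_filter.mpr ⟨hv, hs⟩)).trans ?_
      rw [← add_div]
      gcongr
      nlinarith
  · push Not at hcase
    refine ⟨v0, hv0, w0, hw0, A * c w0 / a v0, 2 * A * (e * a v0) / c w0, ?_, ?_, ?_⟩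
    · apply le_of_eq; field_simp
    · exact (hν v0 hv0 _ subset_rfl (c w0) c0.le fun w hw => hw0max w (hsub1 _ hw)).1
    · refine (split (e * a v0) (by positivity)
        fun v hv hs => (hcase v (Finset.mem_filter.mpr ⟨hv, hs⟩)).le).trans ?_
      apply le_of_eq; ring

/-- **Resolution of the minimal potential counterexample** (main estimate):
if `ℰ′ ⊆ ℰ_{ψ,θ}^{t,C}` is combinatorially structured (one-sided regular) and
arithmetically structured (`|ν_p(v/N)| + |ν_p(w/N)| ≤ 1` for all primes `p`),
then `μ_{ψ,θ}^{f,g}(ℰ′) ≪ (μ_ψ^f(V′) μ_θ^g(W′) e^{-25Ct})^{1/2}` with an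
absolute implied constant. -/
theorem resolution_of_minimal_counterexample :
    ∃ K : ℝ, 0 < K ∧
      ∀ (ψ θ f g : ℕ → ℝ) (ε t C q' : ℝ) (ℰ' : Finset (ℕ × ℕ)),
        (∀ n, 0 ≤ ψ n) → (∀ n, 0 ≤ θ n) →
        ψ 0 = 0 → θ 0 = 0 →
        (Function.support ψ).Finite → (Function.support θ).Finite →
        (∀ n, 0 ≤ f n) → (∀ n, 0 ≤ g n) →
        f 1 = 1 → g 1 = 1 →
        (∀ a b : ℕ, Nat.Coprime a b → f (a * b) = f a * f b) →
        (∀ a b : ℕ, Nat.Coprime a b → g (a * b) = g a * g b) →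
        (∀ n : ℕ, 1 ≤ n → ∑ d ∈ n.divisors, f d ≤ (n : ℝ)) →
        (∀ n : ℕ, 1 ≤ n → ∑ d ∈ n.divisors, g d ≤ (n : ℝ)) →
        ε ∈ Set.Ioc (0:ℝ) (2/5) → q' = 2 / (1 + 2 * ε) → 1 ≤ t →
        (↑ℰ' : Set (ℕ × ℕ)) ⊆ Eset ψ θ t C →
        -- (i) combinatorial structure: one-sided regularity
        (∀ v ∈ ℰ'.image Prod.fst,
          (1 / q') * (∑ vw ∈ ℰ', mu ψ f vw.1 * mu θ g vw.2) /
              (∑ v' ∈ ℰ'.image Prod.fst, mu ψ f v') ≤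
            ∑ w ∈ (ℰ'.filter (fun vw => vw.1 = v)).image Prod.snd, mu θ g w) →
        (∀ w ∈ ℰ'.image Prod.snd,
          (1 / q') * (∑ vw ∈ ℰ', mu ψ f vw.1 * mu θ g vw.2) /
              (∑ w' ∈ ℰ'.image Prod.snd, mu θ g w') ≤
            ∑ v ∈ (ℰ'.filter (fun vw => vw.2 = w)).image Prod.fst, mu ψ f v) →
        -- (ii) arithmetic structure
        (∃ N : ℕ, 0 < N ∧ ∀ p : ℕ, p.Prime → ∀ vw ∈ ℰ',
          |padicValRat p ((vw.1 : ℚ) / (N : ℚ))| +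
            |padicValRat p ((vw.2 : ℚ) / (N : ℚ))| ≤ 1) →
        ∑ vw ∈ ℰ', mu ψ f vw.1 * mu θ g vw.2 ≤
          K * ((∑ v ∈ ℰ'.image Prod.fst, mu ψ f v) *
            (∑ w ∈ ℰ'.image Prod.snd, mu θ g w) *
            Real.exp (-(25 * C * t))) ^ ((1:ℝ)/2) := by
  obtain ⟨B, hB0, hB⟩ := exists_B
  refine ⟨3 * B ^ 2, by positivity, ?_⟩
  intro ψ θ f g ε t C q' E hψ hθ hψ0 hθ0 _ _ hf hg _ _ _ _ hf1 hg1 hε hq ht hE hi1 hi2 hN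
  obtain ⟨N, hN, hgood⟩ := hN
  have hμ0 : ∀ v, 0 ≤ mu ψ f v := fun v => by
    unfold mu; have := hf v; have := hψ v; positivity
  have hν0 : ∀ v, 0 ≤ mu θ g v := fun v => by
    unfold mu; have := hg v; have := hθ v; positivity
  set e := ∑ vw ∈ E, mu ψ f vw.1 * mu θ g vw.2 with he
  set MV := ∑ v ∈ E.image Prod.fst, mu ψ f v with hMV
  set MW := ∑ w ∈ E.image Prod.snd, mu θ g w with hMW
  have he0 : 0 ≤ e := Finset.sum_nonneg fun vw _ => mul_nonneg (hμ0 _) (hν0 _)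
  have hMV0 : 0 ≤ MV := Finset.sum_nonneg fun vw _ => hμ0 _
  have hMW0 : 0 ≤ MW := Finset.sum_nonneg fun vw _ => hν0 _
  rcases he0.eq_or_lt with h0 | hepos
  · rw [← h0]; positivity
  have hne : E.Nonempty := by
    rw [Finset.nonempty_iff_ne_empty]
    intro h
    rw [he, h] at hepos
    simp at hepos
  have hMVpos : 0 < MV := by
    rcases hMV0.eq_or_lt with h | h
    · exfalso
      have h1 := (Finset.sum_eq_zero_iff_of_nonneg (fun v _ => hμ0 v)).mp (hMV ▸ h.symm)
      have : e = 0 := Finset.sum_eq_zero fun vw hvw => by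
        rw [h1 vw.1 (Finset.mem_image_of_mem _ hvw), zero_mul]
      linarith
    · exact h
  have hMWpos : 0 < MW := by
    rcases hMW0.eq_or_lt with h | h
    · exfalso
      have h1 := (Finset.sum_eq_zero_iff_of_nonneg (fun v _ => hν0 v)).mp (hMW ▸ h.symm)
      have : e = 0 := Finset.sum_eq_zero fun vw hvw => by
        rw [h1 vw.2 (Finset.mem_image_of_mem _ hvw), mul_zero]
      linarith
    · exact h
  set C' := max C 0 with hC'
  have hC'0 : 0 ≤ C' := le_max_right _ _
  have hedge : ∀ vw ∈ E, 0 < vw.1 ∧ 0 < vw.2 ∧ rGood N vw.1 vw.2 ∧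
      (vw.1 : ℝ) * θ vw.2 ≤ Nat.gcd vw.1 vw.2 ∧ (vw.2 : ℝ) * ψ vw.1 ≤ Nat.gcd vw.1 vw.2 ∧
      C' ≤ rS t N vw.1 + rS t N vw.2 := by
    intro vw hvw
    obtain ⟨h1, h2, h3, h4⟩ := hE hvw
    have hv : 0 < vw.1 := Nat.pos_of_ne_zero fun h => h1 (h ▸ hψ0)
    have hw : 0 < vw.2 := Nat.pos_of_ne_zero fun h => h2 (h ▸ hθ0)
    have hgc : (0:ℝ) < Nat.gcd vw.1 vw.2 := by exact_mod_cast Nat.gcd_pos_of_pos_left _ hv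
    unfold Dpair at h3
    rw [div_le_one hgc, max_le_iff] at h3
    refine ⟨hv, hw, fun p hp => hgood p hp vw hvw, h3.2, h3.1, ?_⟩
    refine le_trans (max_le h4 (primeSum_nonneg _ _)) (primeSum_sub t N _ _ hN hv hw)
  have hexp : ∀ X : ℝ, Real.exp (-(50 * t * (C' / 2))) = Real.exp (-(25 * C' * t)) := by
    intro _; congr 1; ring
  have hS0 : ∀ w, 0 ≤ rS t N w := fun w => add_nonneg (primeSum_nonneg _ _) (primeSum_nonneg _ _)
  obtain ⟨v, hv, w, hw, x, y, hxy, hx, hy⟩ := exists_pair E hne (fun v => (rnum N v : ℝ))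
    (fun v => (rnum N v : ℝ)) (rS t N) (rS t N) (mu ψ f) (mu θ g) (B ^ 2) C'
    (Real.exp (-(25 * C' * t))) (by positivity) (Real.exp_pos _)
    (by rw [Real.exp_le_one_iff]; have : 0 ≤ 25 * C' * t := by positivity
        linarith)
    (fun vw h => by exact_mod_cast rnum_pos N _ (hedge vw h).1)
    (fun vw h => by exact_mod_cast rnum_pos N _ (hedge vw h).2.1)
    (fun vw h => (hedge vw h).2.2.2.2.2)
    (by
      intro v hv T hT X hX0 hX
      have hvpos : 0 < v := by
        obtain ⟨vw, h, rfl⟩ := Finset.mem_image.mp hv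
        exact (hedge vw h).1
      have hT' : ∀ w ∈ T, 0 < w ∧ rGood N v w ∧ (v:ℝ) * θ w ≤ Nat.gcd v w := by
        intro w hw
        obtain ⟨vw, h, rfl⟩ := Finset.mem_image.mp (hT hw)
        obtain ⟨hh, rfl⟩ := Finset.mem_filter.mp h
        exact ⟨(hedge vw hh).2.1, (hedge vw hh).2.2.1, (hedge vw hh).2.2.2.1⟩
      constructor
      · have := key2 B t ht hB0 (hB t ht) g θ hg hg1 N hN v hvpos T hT' X 0 hX hX0
          (fun w _ => hS0 w)
        simpa using this
      · intro hS
        have := key2 B t ht hB0 (hB t ht) g θ hg hg1 N hN v hvpos T hT' X (C' / 2) hX hX0 hS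
        rwa [hexp 0] at this)
    (by
      intro w hw T hT X hX0 hX
      have hwpos : 0 < w := by
        obtain ⟨vw, h, rfl⟩ := Finset.mem_image.mp hw
        exact (hedge vw h).2.1
      have hT' : ∀ v ∈ T, 0 < v ∧ rGood N w v ∧ (w:ℝ) * ψ v ≤ Nat.gcd w v := by
        intro v hv
        obtain ⟨vw, h, rfl⟩ := Finset.mem_image.mp (hT hv)
        obtain ⟨hh, rfl⟩ := Finset.mem_filter.mp h
        rw [Nat.gcd_comm]
        exact ⟨(hedge vw hh).1, (hedge vw hh).2.2.1.symm, (hedge vw hh).2.2.2.2.1⟩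
      constructor
      · have := key2 B t ht hB0 (hB t ht) f ψ hf hf1 N hN w hwpos T hT' X 0 hX hX0
          (fun w _ => hS0 w)
        simpa using this
      · intro hS
        have := key2 B t ht hB0 (hB t ht) f ψ hf hf1 N hN w hwpos T hT' X (C' / 2) hX hX0 hS
        rwa [hexp 0] at this)
  have hx' := (hi1 v hv).trans hx
  have hy' := (hi2 w hw).trans hy
  have hq' : 1 / 2 ≤ 1 / q' := by
    rw [hq, one_div_div]
    have := hε.1
    linarith
  have hx2 : 1 / 2 * e / MV ≤ x := le_trans (by gcongr) hx'
  have hy2 : 1 / 2 * e / MW ≤ y := le_trans (by gcongr) hy'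
  have hprod : (1 / 2 * e / MV) * (1 / 2 * e / MW) ≤ 2 * (B ^ 2) ^ 2 * Real.exp (-(25 * C' * t)) :=
    le_trans (mul_le_mul hx2 hy2 (by positivity) (le_trans (by positivity) hx2)) hxy
  have hee : Real.exp (-(25 * C' * t)) ≤ Real.exp (-(25 * C * t)) := by
    apply Real.exp_le_exp.mpr
    have : C ≤ C' := le_max_left _ _
    nlinarith
  rw [← Real.sqrt_eq_rpow]
  have hfin : e ^ 2 ≤ 8 * (B ^ 2) ^ 2 * (MV * MW * Real.exp (-(25 * C * t))) := by
    have h1 : (1 / 2 * e / MV) * (1 / 2 * e / MW) = e ^ 2 / (4 * (MV * MW)) := by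
      field_simp; ring
    rw [h1, div_le_iff₀ (by positivity)] at hprod
    calc e ^ 2 ≤ _ := hprod
      _ ≤ 2 * (B ^ 2) ^ 2 * Real.exp (-(25 * C * t)) * (4 * (MV * MW)) := by gcongr
      _ = _ := by ring
  refine (sq_le_sq₀ he0 (by positivity)).mp ?_
  rw [mul_pow, Real.sq_sqrt (by positivity)]
  refine hfin.trans ?_
  gcongr
  nlinarith [sq_nonneg (B ^ 2)]
end

section
/- For any reals x, t ≥ 1 and any c ∈ ℝ, the number of positive integers n ≤ x such that ∑_{p prime, p ≥ t, p | n} 1/p ≥ c is ≪ x·e^{−100ct}, with an absolute implied constant. -/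
lemma anatomy_moment (N : ℕ) (P : Finset ℕ) (hP : ∀ p ∈ P, p.Prime) (f : ℕ → ℝ)
    (hf : ∀ p, 0 ≤ f p) :
    ∑ n ∈ Finset.Icc 1 N, ∏ p ∈ P, (1 + if p ∣ n then f p else 0) ≤
      N * ∏ p ∈ P, (1 + f p / p) := by
  simp_rw [Finset.prod_one_add]
  rw [Finset.sum_comm, Finset.mul_sum]
  refine Finset.sum_le_sum fun S hS => ?_
  rw [Finset.mem_powerset] at hS
  have h1 : ∀ n ∈ Finset.Icc 1 N, (∏ p ∈ S, if p ∣ n then f p else 0) =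
      if (∏ p ∈ S, p) ∣ n then ∏ p ∈ S, f p else 0 := by
    intro n _
    by_cases h : (∏ p ∈ S, p) ∣ n
    · rw [if_pos h]
      exact Finset.prod_congr rfl fun p hp => if_pos ((Finset.dvd_prod_of_mem _ hp).trans h)
    · rw [if_neg h]
      by_contra h2
      apply h
      refine Finset.prod_primes_dvd n (fun p hp => (hP p (hS hp)).prime) fun p hp => ?_
      by_contra h3
      exact h2 (Finset.prod_eq_zero hp (if_neg h3))
  rw [Finset.sum_congr rfl h1, ← Finset.sum_filter, Finset.sum_const, nsmul_eq_mul,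
    Finset.prod_div_distrib, ← Nat.cast_prod]
  have h2 : ((Finset.Icc 1 N).filter (fun n => (∏ p ∈ S, p) ∣ n)).card = N / ∏ p ∈ S, p := by
    rw [← Nat.Ioc_filter_dvd_card_eq_div]; rfl
  rw [h2, mul_div_assoc', mul_div_right_comm]
  exact mul_le_mul_of_nonneg_right Nat.cast_div_le (Finset.prod_nonneg fun p _ => hf p)

lemma anatomy_exp (u : ℝ) (h0 : 0 ≤ u) (h1 : u ≤ 1) :
    Real.exp (100 * u) - 1 ≤ Real.exp 100 * u := by
  have := convexOn_exp.2 (Set.mem_univ 0) (Set.mem_univ 100) (sub_nonneg.2 h1) h0 (by ring)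
  simp only [smul_eq_mul, Real.exp_zero, mul_zero, zero_add, mul_one] at this
  rw [mul_comm 100 u]
  nlinarith

/-- **Unweighted anatomy property**: for `x, t ≥ 1` and `c ∈ ℝ`,
`#{n ≤ x : ∑_{p ≥ t, p | n} 1/p ≥ c} ≪ x e^{-100ct}`. -/
theorem unweighted_anatomy :
    ∃ K : ℝ, 0 < K ∧ ∀ (x t c : ℝ), 1 ≤ x → 1 ≤ t →
      (Set.ncard {n : ℕ | 0 < n ∧ (n : ℝ) ≤ x ∧ c ≤ primeSum t n} : ℝ) ≤
        K * x * Real.exp (-(100 * c * t)) := by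
  classical
  refine ⟨Real.exp (2 * Real.exp 100), Real.exp_pos _, fun x t c hx ht => ?_⟩
  set N := ⌊x⌋₊ with hN
  have hNx : (N : ℝ) ≤ x := Nat.floor_le (by linarith)
  set P : Finset ℕ := (Finset.range (N + 1)).filter (fun p => p.Prime ∧ t ≤ (p : ℝ)) with hPdef
  have hPm : ∀ p, p ∈ P ↔ p < N + 1 ∧ p.Prime ∧ t ≤ (p : ℝ) := by
    intro p; simp [hPdef]
  set f : ℕ → ℝ := fun p => Real.exp (100 * (t / p)) - 1 with hfdef
  have hf : ∀ p, 0 ≤ f p := by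
    intro p
    have : 0 ≤ 100 * (t / (p : ℝ)) := by positivity
    simp only [hfdef]
    linarith [Real.one_le_exp this]
  have hset : {n : ℕ | 0 < n ∧ (n : ℝ) ≤ x ∧ c ≤ primeSum t n} =
      ((Finset.Icc 1 N).filter (fun n => c ≤ primeSum t n) : Finset ℕ) := by
    ext n
    have : (n : ℝ) ≤ x ↔ n ≤ N := (Nat.le_floor_iff (by linarith)).symm
    simp [this, Nat.succ_le_iff, and_assoc]
  rw [hset, Set.ncard_coe_finset]
  have hexp : ∀ n ∈ Finset.Icc 1 N, Real.exp (100 * t * primeSum t n) =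
      ∏ p ∈ P, (1 + if p ∣ n then f p else 0) := by
    intro n hn
    rw [Finset.mem_Icc] at hn
    have h1 : primeSum t n = ∑ p ∈ P, if p ∣ n then 1 / (p : ℝ) else 0 := by
      unfold primeSum
      simp only [Set.indicator_apply, Set.mem_setOf_eq]
      rw [← Finset.sum_filter, ← Finset.sum_filter]
      refine Finset.sum_congr ?_ fun _ _ => rfl
      ext p
      simp only [Finset.mem_filter, hPm, Nat.mem_primeFactors]
      constructor
      · rintro ⟨⟨a, b, d⟩, e⟩
        have := Nat.le_of_dvd (by omega) b
        exact ⟨⟨by omega, a, e⟩, b⟩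
      · rintro ⟨⟨_, a, e⟩, b⟩
        exact ⟨⟨a, b, by omega⟩, e⟩
    rw [h1, Finset.mul_sum, Real.exp_sum]
    refine Finset.prod_congr rfl fun p _ => ?_
    split_ifs
    · simp only [hfdef]
      rw [add_sub_cancel]
      congr 1
      ring
    · simp
  have hprod : ∏ p ∈ P, (1 + f p / p) ≤ Real.exp (2 * Real.exp 100) := by
    have h1 : ∏ p ∈ P, (1 + f p / p) ≤
        ∏ p ∈ P, Real.exp (Real.exp 100 * t * ((p : ℝ) ^ 2)⁻¹) := by
      refine Finset.prod_le_prod (fun p _ => by have := hf p; positivity) fun p hp => ?_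
      obtain ⟨_, hpp, htp⟩ := (hPm p).1 hp
      have hp0 : (0 : ℝ) < p := by linarith
      have h2 := anatomy_exp (t / p) (by positivity) ((div_le_one hp0).2 htp)
      have h3 : f p / p ≤ Real.exp 100 * t * ((p : ℝ) ^ 2)⁻¹ := by
        calc f p / p ≤ (Real.exp 100 * (t / p)) / p := by
              simp only [hfdef]; gcongr
          _ = _ := by field_simp
      linarith [Real.add_one_le_exp (Real.exp 100 * t * ((p : ℝ) ^ 2)⁻¹)]
    refine h1.trans ?_
    rw [← Real.exp_sum, ← Finset.mul_sum]
    apply Real.exp_le_exp.2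
    obtain ⟨k, hk⟩ : ∃ k, ⌈t⌉₊ = k + 1 :=
      Nat.exists_eq_succ_of_ne_zero (Nat.ceil_pos.2 (by linarith)).ne'
    have hkt : t ≤ (k : ℝ) + 1 := by
      have := Nat.le_ceil t
      rw [hk] at this
      exact_mod_cast this
    have h4 : ∑ p ∈ P, ((p : ℝ) ^ 2)⁻¹ ≤ 2 / t := by
      calc ∑ p ∈ P, ((p : ℝ) ^ 2)⁻¹ ≤ ∑ p ∈ Finset.Ioo k (N + 1), ((p : ℝ) ^ 2)⁻¹ := by
            refine Finset.sum_le_sum_of_subset_of_nonneg ?_ fun _ _ _ => by positivity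
            intro p hp
            obtain ⟨a, _, b⟩ := (hPm p).1 hp
            have := Nat.ceil_le.2 b
            rw [Finset.mem_Ioo]
            omega
        _ ≤ 2 / ((k : ℝ) + 1) := sum_Ioo_inv_sq_le k (N + 1)
        _ ≤ 2 / t := by gcongr
    calc Real.exp 100 * t * ∑ p ∈ P, ((p : ℝ) ^ 2)⁻¹ ≤ Real.exp 100 * t * (2 / t) := by gcongr
      _ = 2 * Real.exp 100 := by field_simp
  have hmom := anatomy_moment N P (fun p hp => ((hPm p).1 hp).2.1) f hf
  rw [← Finset.sum_congr rfl hexp] at hmom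
  have hmark : (((Finset.Icc 1 N).filter (fun n => c ≤ primeSum t n)).card : ℝ) *
      Real.exp (100 * c * t) ≤ ∑ n ∈ Finset.Icc 1 N, Real.exp (100 * t * primeSum t n) := by
    rw [← nsmul_eq_mul, ← Finset.sum_const]
    calc _ ≤ ∑ n ∈ (Finset.Icc 1 N).filter (fun n => c ≤ primeSum t n),
          Real.exp (100 * t * primeSum t n) := by
          refine Finset.sum_le_sum fun n hn => Real.exp_le_exp.2 ?_
          have := (Finset.mem_filter.1 hn).2
          nlinarith
      _ ≤ _ := Finset.sum_le_sum_of_subset_of_nonneg (Finset.filter_subset _ _)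
          fun _ _ _ => (Real.exp_pos _).le
  rw [Real.exp_neg, ← div_eq_mul_inv, le_div_iff₀ (Real.exp_pos _)]
  refine (hmark.trans hmom).trans ?_
  rw [mul_comm (Real.exp _) x]
  gcongr
  exact Finset.prod_nonneg fun p _ => by have := hf p; positivity
end
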